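/- arXiv:2012.11276 — 3 statements merged into one kernel-verified Lean document; each statement's English description precedes it below -/
import Mathlib

section
/- There exists a constant C > 0, independent of k and h, such that for every integer k ≥ 2, every h > 0, every real polynomial λ of degree at most k (regarded as a function on e = (0,h)), and every N ≥ 0 the following holds: if ∫_e λ ψ ≤ N ‖ψ‖_{H^{1/2}_{00}(e)} for every measurable ψ : e → ℝ with finite ‖ψ‖_{H^{1/2}_{00}(e)}, then (i) |∫_e λ| ≤ C (log k) N, and (ii) ∫_e λ φ ≤ C (log k) N |φ|_{1/2,e} for every measurable φ : e → ℝ with finite |φ|_{1/2,e} and ∫_e φ = 0. (Equivalence, up to a log k factor, of the (H^{1/2}(e))' and (H^{1/2}_{00}(e))' norms on polynomials: ‖λ‖_{−1/2,e} ≲ log k · ‖λ‖_{(H^{1/2}_{00}(e))'}.) -/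
open MeasureTheory

/-- Squared Gagliardo seminorm `|φ|_{1/2,(0,h)}²` on the interval `(0,h)`. -/
noncomputable def gagHalfSq (h : ℝ) (φ : ℝ → ℝ) : ℝ :=
  ∫ x in Set.Ioo (0:ℝ) h, ∫ y in Set.Ioo (0:ℝ) h, (φ x - φ y) ^ 2 / (x - y) ^ 2

/-- Finiteness of the Gagliardo double integral on `(0,h)`. -/
def gagHalfFinite (h : ℝ) (φ : ℝ → ℝ) : Prop :=
  IntegrableOn (fun q : ℝ × ℝ => (φ q.1 - φ q.2) ^ 2 / (q.1 - q.2) ^ 2)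
    (Set.Ioo (0:ℝ) h ×ˢ Set.Ioo (0:ℝ) h) (volume.prod volume)

/-- Squared `H^{1/2}_{00}((0,h))` norm. -/
noncomputable def H1200NormSq (h : ℝ) (ψ : ℝ → ℝ) : ℝ :=
  gagHalfSq h ψ + (∫ x in Set.Ioo (0:ℝ) h, ψ x ^ 2 / x)
    + ∫ x in Set.Ioo (0:ℝ) h, ψ x ^ 2 / (h - x)

/-- Finiteness of the `H^{1/2}_{00}((0,h))` norm. -/
def H1200Finite (h : ℝ) (ψ : ℝ → ℝ) : Prop :=
  gagHalfFinite h ψ ∧ IntegrableOn (fun x => ψ x ^ 2 / x) (Set.Ioo (0:ℝ) h) ∧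
    IntegrableOn (fun x => ψ x ^ 2 / (h - x)) (Set.Ioo (0:ℝ) h)
theorem Polynomial.abs_derivative_eval_le {k : ℕ} {p : Polynomial ℝ} (hp : p.natDegree ≤ k)
    {M : ℝ} (hM : 0 < M) (hb : ∀ x ∈ Set.Icc (0:ℝ) 1, |p.eval x| ≤ M) {x : ℝ}
    (hx : x ∈ Set.Icc (0:ℝ) 1) : |p.derivative.eval x| ≤ 4 * k ^ 2 * M := by
  have key : ∀ a ∈ Set.Icc (0:ℝ) 1, ∀ s : ℝ, |s| = 1 →
      s * ((x - a) * p.derivative.eval x) ≤ 2 * k ^ 2 * M := by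
    intro a ha s hs
    set q : Polynomial ℝ :=
      Polynomial.C (s / M) * p.comp (Polynomial.C ((x - a) / 2) * Polynomial.X
        + Polynomial.C ((x + a) / 2)) with hq
    have hqd : q.degree ≤ k := by
      refine Polynomial.degree_le_of_natDegree_le ?_
      refine (Polynomial.natDegree_C_mul_le _ _).trans ?_
      refine Polynomial.natDegree_comp_le.trans ?_
      calc p.natDegree * _ ≤ p.natDegree * 1 :=
            Nat.mul_le_mul_left _ Polynomial.natDegree_linear_le
        _ ≤ k := by simpa using hp
    have hqb : ∀ t ∈ Set.Icc (-1:ℝ) 1, |q.eval t| ≤ 1 := by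
      rintro t ⟨ht1, ht2⟩
      have : |p.eval ((x - a) / 2 * t + (x + a) / 2)| ≤ M := by
        obtain ⟨hx0, hx1⟩ := hx
        obtain ⟨ha0, ha1⟩ := ha
        apply hb
        constructor <;> nlinarith
      simp only [hq, Polynomial.eval_mul, Polynomial.eval_C, Polynomial.eval_comp,
        Polynomial.eval_add, Polynomial.eval_X, abs_mul, abs_div, hs, abs_of_pos hM]
      rw [div_mul_eq_mul_div, div_le_one hM]
      simpa using this
    have h1 := Polynomial.Chebyshev.eval_iterate_derivative_le_of_forall_abs_le_one
      (k := 1) le_rfl hqd hqb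
    simp only [Function.iterate_one, Polynomial.Chebyshev.derivative_T_eval_one] at h1
    have h2 : q.derivative.eval 1 = s / M * ((x - a) / 2 * p.derivative.eval x) := by
      simp only [hq, Polynomial.derivative_mul, Polynomial.derivative_comp, Polynomial.derivative_add,
        Polynomial.derivative_C, Polynomial.derivative_X, Polynomial.eval_mul, Polynomial.eval_C,
        Polynomial.eval_comp, Polynomial.eval_add, Polynomial.eval_X, Polynomial.eval_zero,
        Polynomial.eval_one]
      have : (x - a) / 2 * 1 + (x + a) / 2 = x := by ring
      rw [this]; ring
    rw [h2, div_mul_eq_mul_div, div_le_iff₀ hM] at h1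
    push_cast at h1
    nlinarith
  have hk : 0 ≤ (k:ℝ) ^ 2 * M := by positivity
  rcases le_total x (1 / 2) with h | h
  · have h1 := key 1 (by simp) 1 (by simp)
    have h2 := key 1 (by simp) (-1) (by simp)
    rw [abs_le]
    obtain ⟨hx0, hx1⟩ := hx
    constructor <;> by_contra! hc <;> nlinarith
  · have h1 := key 0 (by simp) 1 (by simp)
    have h2 := key 0 (by simp) (-1) (by simp)
    rw [abs_le]
    obtain ⟨hx0, hx1⟩ := hx
    constructor <;> by_contra! hc <;> nlinarith

theorem picone_le {a b u v : ℝ} (hu : 0 < u) (hv : 0 < v) :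
    (u - v) * (a ^ 2 / u - b ^ 2 / v) ≤ (a - b) ^ 2 := by
  have h : (a - b) ^ 2 - (u - v) * (a ^ 2 / u - b ^ 2 / v) = (v * a - u * b) ^ 2 / (u * v) := by
    field_simp
    ring
  have : 0 ≤ (v * a - u * b) ^ 2 / (u * v) := by positivity
  linarith

theorem integral_picone_le {α : Type*} [MeasurableSpace α] {μ : Measure α} [IsFiniteMeasure μ]
    {K : α × α → ℝ} {u φ : α → ℝ} {c A B : ℝ} (hc : 0 < c) (hK : Measurable K)
    (hKs : ∀ q, K q.swap = K q) (hK0 : ∀ q, 0 ≤ K q) (hKb : ∀ᵐ q ∂μ.prod μ, K q ≤ A)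
    (hu : Measurable u) (hcu : ∀ᵐ x ∂μ, c ≤ u x) (huB : ∀ᵐ x ∂μ, u x ≤ B)
    (hφ : Measurable φ) (hφ2 : Integrable (fun x => φ x ^ 2) μ)
    (hφK : Integrable (fun q : α × α => K q * (φ q.1 - φ q.2) ^ 2) (μ.prod μ)) :
    Integrable (fun x => φ x ^ 2 / u x * ∫ y, K (x, y) * (u x - u y) ∂μ) μ ∧
    2 * ∫ x, φ x ^ 2 / u x * ∫ y, K (x, y) * (u x - u y) ∂μ ∂μ
      ≤ ∫ q, K q * (φ q.1 - φ q.2) ^ 2 ∂μ.prod μ := by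
  have hfst : ∀ {p : α → Prop}, (∀ᵐ x ∂μ, p x) → ∀ᵐ q ∂μ.prod μ, p q.1 := fun h =>
    Measure.quasiMeasurePreserving_fst.ae h
  have hsnd : ∀ {p : α → Prop}, (∀ᵐ x ∂μ, p x) → ∀ᵐ q ∂μ.prod μ, p q.2 := fun h =>
    Measure.quasiMeasurePreserving_snd.ae h
  have hg : Integrable (fun x => φ x ^ 2 / u x) μ := by
    refine (hφ2.const_mul c⁻¹).mono' ((hφ.pow_const 2).div hu).aestronglyMeasurable ?_
    filter_upwards [hcu] with x hx
    have hux : 0 < u x := hc.trans_le hx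
    rw [Real.norm_of_nonneg (by positivity), div_eq_inv_mul]
    gcongr
  set F : α × α → ℝ := fun q => K q * (u q.1 - u q.2) * (φ q.1 ^ 2 / u q.1) with hF
  have hFi : Integrable F (μ.prod μ) := by
    refine (hg.comp_fst μ).bdd_mul (c := A * (B + B)) ?_ ?_
    · exact (hK.mul ((hu.comp measurable_fst).sub (hu.comp measurable_snd))).aestronglyMeasurable
    · filter_upwards [hKb, hfst hcu, hsnd hcu, hfst huB, hsnd huB] with q h1 h2 h3 h4 h5
      rw [norm_mul, Real.norm_of_nonneg (hK0 q), Real.norm_eq_abs]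
      have : |u q.1 - u q.2| ≤ B + B := by rw [abs_le]; constructor <;> linarith
      exact mul_le_mul h1 this (abs_nonneg _) ((hK0 q).trans h1)
  have h0 : (fun x => φ x ^ 2 / u x * ∫ y, K (x, y) * (u x - u y) ∂μ)
      = fun x => ∫ y, F (x, y) ∂μ := by
    ext x
    simp only [hF]
    rw [integral_mul_const, mul_comm]
  have h1 : ∫ x, φ x ^ 2 / u x * ∫ y, K (x, y) * (u x - u y) ∂μ ∂μ = ∫ q, F q ∂μ.prod μ := by
    rw [integral_prod _ hFi, h0]
  refine ⟨h0 ▸ hFi.integral_prod_left, ?_⟩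
  have h2 : ∫ q, F q.swap ∂μ.prod μ = ∫ q, F q ∂μ.prod μ := integral_prod_swap F
  have hFs : Integrable (fun q : α × α => F q.swap) (μ.prod μ) := hFi.swap
  rw [h1, two_mul]
  nth_rw 2 [← h2]
  rw [← integral_add hFi hFs]
  refine integral_mono_ae (hFi.add hFs) hφK ?_
  filter_upwards [hfst hcu, hsnd hcu] with q h3 h4
  have := mul_le_mul_of_nonneg_left
    (picone_le (a := φ q.1) (b := φ q.2) (hc.trans_le h3) (hc.trans_le h4)) (hK0 q)
  refine le_trans (le_of_eq ?_) this
  simp only [hF, hKs, Prod.fst_swap, Prod.snd_swap]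
  ring

/-- Lebesgue measure on the unit interval. -/
noncomputable abbrev unitVol : Measure ℝ := volume.restrict (Set.Ioo (0:ℝ) 1)

theorem integrable_gagHalf {h : ℝ} {φ : ℝ → ℝ} (hφ : gagHalfFinite h φ) :
    Integrable (fun q : ℝ × ℝ => (φ q.1 - φ q.2) ^ 2 / (q.1 - q.2) ^ 2)
      ((volume.restrict (Set.Ioo (0:ℝ) h)).prod (volume.restrict (Set.Ioo (0:ℝ) h))) := by
  rw [Measure.prod_restrict]
  exact hφ

theorem gagHalfSq_eq_integral_prod {h : ℝ} {φ : ℝ → ℝ} (hφ : gagHalfFinite h φ) :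
    gagHalfSq h φ = ∫ q : ℝ × ℝ, (φ q.1 - φ q.2) ^ 2 / (q.1 - q.2) ^ 2
      ∂((volume.restrict (Set.Ioo (0:ℝ) h)).prod (volume.restrict (Set.Ioo (0:ℝ) h))) :=
  (integral_prod _ (integrable_gagHalf hφ)).symm

theorem gagHalfSq_nonneg (h : ℝ) (φ : ℝ → ℝ) : 0 ≤ gagHalfSq h φ :=
  integral_nonneg fun _ => integral_nonneg fun _ => by positivity

theorem ae_unitVol : ∀ᵐ x ∂unitVol, x ∈ Set.Ioo (0:ℝ) 1 := ae_restrict_mem measurableSet_Ioo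

theorem ae_unitVol_prod :
    ∀ᵐ q ∂unitVol.prod unitVol, q.1 ∈ Set.Ioo (0:ℝ) 1 ∧ q.2 ∈ Set.Ioo (0:ℝ) 1 :=
  (Measure.quasiMeasurePreserving_fst.ae ae_unitVol).and
    (Measure.quasiMeasurePreserving_snd.ae ae_unitVol)

theorem sq_sub_le_div {a x y : ℝ} (ha : x = y → a = 0) (hx : x ∈ Set.Ioo (0:ℝ) 1)
    (hy : y ∈ Set.Ioo (0:ℝ) 1) : a ^ 2 ≤ a ^ 2 / (x - y) ^ 2 := by
  obtain ⟨hx0, hx1⟩ := hx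
  obtain ⟨hy0, hy1⟩ := hy
  rcases eq_or_ne x y with h | h
  · simp [ha h]
  · have : 0 < (x - y) ^ 2 := by have := sub_ne_zero.2 h; positivity
    rw [le_div_iff₀ this]
    have h2 : (x - y) ^ 2 ≤ 1 := by nlinarith
    nlinarith [sq_nonneg a]

theorem integrable_sq_sub {φ : ℝ → ℝ} (hφm : Measurable φ) (hφ : gagHalfFinite 1 φ) :
    Integrable (fun q : ℝ × ℝ => (φ q.1 - φ q.2) ^ 2) (unitVol.prod unitVol) := by
  refine (integrable_gagHalf hφ).mono' (by fun_prop) ?_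
  filter_upwards [ae_unitVol_prod] with q hq
  rw [Real.norm_of_nonneg (by positivity)]
  exact sq_sub_le_div (fun h => by rw [h, sub_self]) hq.1 hq.2

instance : IsProbabilityMeasure unitVol := ⟨by simp⟩

theorem integrable_sq_of_gagHalfFinite {φ : ℝ → ℝ} (hφm : Measurable φ)
    (hφ : gagHalfFinite 1 φ) : Integrable (fun x => φ x ^ 2) unitVol := by
  obtain ⟨y, hy⟩ := (integrable_sq_sub hφm hφ).prod_left_ae.exists
  refine ((hy.const_mul 2).add (integrable_const (2 * φ y ^ 2))).mono' (by fun_prop) ?_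
  refine .of_forall fun x => ?_
  rw [Real.norm_of_nonneg (by positivity)]
  simp only [Pi.add_apply]
  nlinarith [sq_nonneg (φ x - 2 * φ y)]

theorem integrable_of_integrable_sq {φ : ℝ → ℝ} (hφm : Measurable φ)
    (hφ : Integrable (fun x => φ x ^ 2) unitVol) : Integrable φ unitVol := by
  refine (hφ.add (integrable_const 1)).mono' (by fun_prop) (.of_forall fun x => ?_)
  rw [Real.norm_eq_abs, abs_le]
  simp only [Pi.add_apply]
  constructor <;> nlinarith [sq_nonneg (φ x - 1), sq_nonneg (φ x + 1)]

theorem integral_sq_le_gagHalfSq {φ : ℝ → ℝ} (hφm : Measurable φ) (hφ : gagHalfFinite 1 φ)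
    (h0 : ∫ x, φ x ∂unitVol = 0) : ∫ x, φ x ^ 2 ∂unitVol ≤ gagHalfSq 1 φ := by
  have h2 := integrable_sq_of_gagHalfFinite hφm hφ
  have h1 := integrable_of_integrable_sq hφm h2
  have hle : ∫ q : ℝ × ℝ, (φ q.1 - φ q.2) ^ 2 ∂unitVol.prod unitVol ≤ gagHalfSq 1 φ := by
    rw [gagHalfSq_eq_integral_prod hφ]
    refine integral_mono_ae (integrable_sq_sub hφm hφ) (integrable_gagHalf hφ) ?_
    filter_upwards [ae_unitVol_prod] with q hq
    exact sq_sub_le_div (fun h => by rw [h, sub_self]) hq.1 hq.2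
  have heq : ∫ q : ℝ × ℝ, (φ q.1 - φ q.2) ^ 2 ∂unitVol.prod unitVol
      = 2 * ∫ x, φ x ^ 2 ∂unitVol := by
    rw [integral_prod _ (integrable_sq_sub hφm hφ)]
    have hin : ∀ x, ∫ y, (φ x - φ y) ^ 2 ∂unitVol = φ x ^ 2 + ∫ y, φ y ^ 2 ∂unitVol := by
      intro x
      calc ∫ y, (φ x - φ y) ^ 2 ∂unitVol
          = ∫ y, ((φ x ^ 2 - 2 * φ x * φ y) + φ y ^ 2) ∂unitVol := by
            congr 1; ext y; ring
        _ = _ := by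
          have hi : Integrable (fun y => φ x ^ 2 - 2 * φ x * φ y) unitVol :=
            (integrable_const _).sub (h1.const_mul _)
          rw [integral_add hi h2,
            integral_sub (integrable_const _) (h1.const_mul _), integral_const_mul, h0]
          simp
    simp only [hin]
    rw [integral_add h2 (integrable_const _)]
    simp
    ring
  have : 0 ≤ ∫ x, φ x ^ 2 ∂unitVol := integral_nonneg fun _ => by positivity
  linarith

/-- A lower bound for the operator with kernel `(max x y + ε)⁻²` applied to the concave profile
`2Λ² - log² ((x + ε) / ε)`. -/
theorem integral_kernel_profile_ge {ε Λ x : ℝ} (hε : 0 < ε)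
    (hΛ : Λ = Real.log (1 + ε) - Real.log ε) (hΛ1 : 1 ≤ Λ) (hx : x ∈ Set.Ioo (0:ℝ) 1) :
    2 / (x + ε) - 5 * Λ ^ 2 ≤ ∫ y, ((max x y + ε) ^ 2)⁻¹ *
      ((2 * Λ ^ 2 - (Real.log (x + ε) - Real.log ε) ^ 2) -
        (2 * Λ ^ 2 - (Real.log (y + ε) - Real.log ε) ^ 2)) ∂unitVol := by
  obtain ⟨hx0, hx1⟩ := hx
  set l : ℝ → ℝ := fun y => Real.log (y + ε) - Real.log ε with hl
  have hld : ∀ y, 0 ≤ y → HasDerivAt l (1 / (y + ε)) y := by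
    intro y hy
    exact (((hasDerivAt_id y).add_const ε).log (by simp; positivity)).sub_const _
  have hX : 0 < x + ε := by positivity
  have hlc : ContinuousOn l (Set.Ici 0) := fun y hy => (hld y hy).continuousAt.continuousWithinAt
  set f : ℝ → ℝ := fun y => ((max x y + ε) ^ 2)⁻¹ *
      ((2 * Λ ^ 2 - l x ^ 2) - (2 * Λ ^ 2 - l y ^ 2)) with hf
  have hfc : ContinuousOn f (Set.Ici 0) := by
    refine ContinuousOn.mul (ContinuousOn.inv₀ (by fun_prop) ?_) (by fun_prop)
    intro y hy
    have : x ≤ max x y := le_max_left _ _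
    have : 0 < max x y + ε := by linarith
    positivity
  have hfi : ∀ a b, 0 ≤ a → 0 ≤ b → IntervalIntegrable f volume a b := fun a b ha hb =>
    (hfc.mono fun y hy => le_trans (le_min ha hb) hy.1).intervalIntegrable
  have e0 : ∫ y, f y ∂unitVol = (∫ y in (0:ℝ)..x, f y) + ∫ y in x..1, f y := by
    rw [intervalIntegral.integral_add_adjacent_intervals (hfi _ _ le_rfl hx0.le)
      (hfi _ _ hx0.le zero_le_one), intervalIntegral.integral_of_le zero_le_one,
      integral_Ioc_eq_integral_Ioo]
  have l0 : l 0 = 0 := by simp [hl]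
  have l1 : l 1 = Λ := by simp [hl, hΛ]
  have e1 : ∫ y in (0:ℝ)..x, f y = (-2 * l x + 2) / (x + ε) - (2 * ε - ε * l x ^ 2) / (x + ε) ^ 2 := by
    have hd : ∀ y ∈ Set.uIcc 0 x, HasDerivAt
        (fun y => ((x + ε) ^ 2)⁻¹ * ((y + ε) * (l y ^ 2 - 2 * l y + 2) - l x ^ 2 * y)) (f y) y := by
      intro y hy
      rw [Set.uIcc_of_le hx0.le] at hy
      have hY : 0 < y + ε := by linarith [hy.1]
      have h1 := hld y hy.1
      have := (((((hasDerivAt_id y).add_const ε).mul (((h1.pow 2).sub (h1.const_mul 2)).add_const 2)).sub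
        ((hasDerivAt_id y).const_mul (l x ^ 2))).const_mul (((x + ε) ^ 2)⁻¹))
      refine this.congr_deriv ?_
      simp only [hf, max_eq_left hy.2, id, Pi.sub_apply, Pi.pow_apply]
      field_simp
      ring
    rw [intervalIntegral.integral_eq_sub_of_hasDerivAt hd (hfi _ _ le_rfl hx0.le), l0]
    field_simp
    ring
  have e2 : ∫ y in x..1, f y = (2 * l x + 2) / (x + ε) - (Λ ^ 2 + 2 * Λ + 2 - l x ^ 2) / (1 + ε) := by
    have hd : ∀ y ∈ Set.uIcc x 1, HasDerivAt
        (fun y => (l x ^ 2 - (l y ^ 2 + 2 * l y + 2)) / (y + ε)) (f y) y := by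
      intro y hy
      rw [Set.uIcc_of_le hx1.le] at hy
      have hy0 : 0 ≤ y := hx0.le.trans hy.1
      have hY : 0 < y + ε := by linarith
      have h1 := hld y hy0
      have := ((((h1.pow 2).add (h1.const_mul 2)).add_const 2).const_sub (l x ^ 2)).div
        ((hasDerivAt_id y).add_const ε) hY.ne'
      refine this.congr_deriv ?_
      simp only [hf, max_eq_right hy.1, id, Pi.add_apply, Pi.pow_apply]
      field_simp
      ring
    rw [intervalIntegral.integral_eq_sub_of_hasDerivAt hd (hfi _ _ hx0.le zero_le_one), l1]
    have : 0 < 1 + ε := by positivity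
    field_simp
    ring
  change _ ≤ ∫ y, f y ∂unitVol
  rw [e0, e1, e2]
  have hE : 0 < 1 + ε := by positivity
  have i1 : (Λ ^ 2 + 2 * Λ + 2 - l x ^ 2) / (1 + ε) ≤ 5 * Λ ^ 2 := by
    rw [div_le_iff₀ hE]
    nlinarith [sq_nonneg (l x), sq_nonneg Λ, mul_nonneg (sq_nonneg Λ) hε.le]
  have i2 : (2 * ε - ε * l x ^ 2) / (x + ε) ^ 2 ≤ 2 / (x + ε) := by
    rw [div_le_div_iff₀ (by positivity) hX]
    nlinarith [mul_nonneg (mul_nonneg hε.le (sq_nonneg (l x))) hX.le, mul_pos hx0 hX]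
  have i3 : (-2 * l x + 2) / (x + ε) + (2 * l x + 2) / (x + ε) = 2 / (x + ε) + 2 / (x + ε) := by
    field_simp; ring
  linarith

theorem integrable_sq_div {φ : ℝ → ℝ} (hφm : Measurable φ)
    (hφ : Integrable (fun x => φ x ^ 2) unitVol) {ε : ℝ} (hε : 0 < ε) :
    Integrable (fun x => φ x ^ 2 / (x + ε)) unitVol := by
  refine (hφ.const_mul ε⁻¹).mono'
    ((hφm.pow_const 2).div (measurable_id.add_const ε)).aestronglyMeasurable ?_
  filter_upwards [ae_unitVol] with x hx
  have hx0 := hx.1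
  rw [Real.norm_of_nonneg (by positivity), div_eq_inv_mul]
  gcongr
  linarith

theorem integral_sq_div_le {φ : ℝ → ℝ} (hφm : Measurable φ) (hφ : gagHalfFinite 1 φ)
    {ε Λ : ℝ} (hε : 0 < ε) (hΛ : Λ = Real.log (1 + ε) - Real.log ε) (hΛ1 : 1 ≤ Λ) :
    ∫ x, φ x ^ 2 / (x + ε) ∂unitVol
      ≤ Λ ^ 2 / 2 * (gagHalfSq 1 φ + 10 * ∫ x, φ x ^ 2 ∂unitVol) := by
  have hφ2 := integrable_sq_of_gagHalfFinite hφm hφ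
  have hΛ0 : 0 < Λ := by linarith
  set K : ℝ × ℝ → ℝ := fun q => ((max q.1 q.2 + ε) ^ 2)⁻¹ with hK
  set u : ℝ → ℝ := fun x => 2 * Λ ^ 2 - (Real.log (x + ε) - Real.log ε) ^ 2 with hu
  have hKm : Measurable K := by fun_prop
  have hub : ∀ x ∈ Set.Ioo (0:ℝ) 1, Λ ^ 2 ≤ u x ∧ u x ≤ 2 * Λ ^ 2 := by
    rintro x ⟨hx0, hx1⟩
    have h1 : Real.log ε ≤ Real.log (x + ε) := Real.log_le_log hε (by linarith)
    have h2 : Real.log (x + ε) ≤ Real.log (1 + ε) := Real.log_le_log (by linarith) (by linarith)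
    simp only [hu]
    constructor
    · have : (Real.log (x + ε) - Real.log ε) ^ 2 ≤ Λ ^ 2 :=
        pow_le_pow_left₀ (by linarith) (by linarith) 2
      linarith
    · have := sq_nonneg (Real.log (x + ε) - Real.log ε)
      linarith
  have hle : ∀ᵐ q ∂unitVol.prod unitVol,
      K q * (φ q.1 - φ q.2) ^ 2 ≤ (φ q.1 - φ q.2) ^ 2 / (q.1 - q.2) ^ 2 := by
    filter_upwards [ae_unitVol_prod] with q hq
    obtain ⟨⟨hx0, hx1⟩, ⟨hy0, hy1⟩⟩ := hq
    rcases eq_or_ne q.1 q.2 with h | h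
    · simp [h]
    · have h0 : 0 < (q.1 - q.2) ^ 2 := by have := sub_ne_zero.2 h; positivity
      rw [div_eq_inv_mul]
      gcongr ?_ * _
      refine inv_anti₀ h0 (sq_le_sq' ?_ ?_)
      · linarith [le_max_right q.1 q.2]
      · linarith [le_max_left q.1 q.2]
  have hφK : Integrable (fun q : ℝ × ℝ => K q * (φ q.1 - φ q.2) ^ 2) (unitVol.prod unitVol) := by
    refine (integrable_gagHalf hφ).mono' (by fun_prop) ?_
    filter_upwards [hle] with q hq
    rwa [Real.norm_of_nonneg (by simp only [hK]; positivity)]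
  obtain ⟨hi, hP⟩ := integral_picone_le (μ := unitVol) (K := K) (u := u) (φ := φ) (c := Λ ^ 2)
    (A := (ε ^ 2)⁻¹) (B := 2 * Λ ^ 2) (by positivity) hKm (fun q => by simp [hK, max_comm])
    (fun q => by simp only [hK]; positivity)
    (by
      filter_upwards [ae_unitVol_prod] with q hq
      have : 0 < max q.1 q.2 := hq.1.1.trans_le (le_max_left _ _)
      refine inv_anti₀ (by positivity) (pow_le_pow_left₀ hε.le (by linarith) 2))
    (by fun_prop) (by filter_upwards [ae_unitVol] with x hx using (hub x hx).1)
    (by filter_upwards [ae_unitVol] with x hx using (hub x hx).2) hφm hφ2 hφK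
  have hG : ∫ q : ℝ × ℝ, K q * (φ q.1 - φ q.2) ^ 2 ∂unitVol.prod unitVol ≤ gagHalfSq 1 φ := by
    rw [gagHalfSq_eq_integral_prod hφ]
    exact integral_mono_ae hφK (integrable_gagHalf hφ) hle
  have hW := integrable_sq_div hφm hφ2 hε
  have hlow : (Λ ^ 2)⁻¹ * (∫ x, φ x ^ 2 / (x + ε) ∂unitVol) - 5 * ∫ x, φ x ^ 2 ∂unitVol
      ≤ ∫ x, φ x ^ 2 / u x * ∫ y, K (x, y) * (u x - u y) ∂unitVol ∂unitVol := by
    rw [← integral_const_mul, ← integral_const_mul,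
      ← integral_sub (hW.const_mul _) (hφ2.const_mul _)]
    refine integral_mono_ae ((hW.const_mul _).sub (hφ2.const_mul _)) hi ?_
    filter_upwards [ae_unitVol] with x hx
    obtain ⟨h1, h2⟩ := hub x hx
    have hX : 0 < x + ε := by linarith [hx.1]
    have hL : 0 < Λ ^ 2 := by positivity
    have hux : 0 < u x := hL.trans_le h1
    calc (Λ ^ 2)⁻¹ * (φ x ^ 2 / (x + ε)) - 5 * φ x ^ 2
        ≤ φ x ^ 2 / u x * (2 / (x + ε)) - φ x ^ 2 / u x * (5 * Λ ^ 2) := by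
          have e1 : (Λ ^ 2)⁻¹ * (φ x ^ 2 / (x + ε)) ≤ φ x ^ 2 / u x * (2 / (x + ε)) := by
            have : (Λ ^ 2)⁻¹ ≤ 2 / u x := by
              rw [inv_eq_one_div, div_le_div_iff₀ hL hux]; linarith
            calc (Λ ^ 2)⁻¹ * (φ x ^ 2 / (x + ε)) ≤ 2 / u x * (φ x ^ 2 / (x + ε)) := by gcongr
              _ = _ := by ring
          have e2 : φ x ^ 2 / u x * (5 * Λ ^ 2) ≤ 5 * φ x ^ 2 := by
            rw [div_mul_eq_mul_div, div_le_iff₀ hux]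
            nlinarith [mul_le_mul_of_nonneg_left h1 (sq_nonneg (φ x))]
          linarith
      _ = φ x ^ 2 / u x * (2 / (x + ε) - 5 * Λ ^ 2) := by ring
      _ ≤ _ := by
          gcongr
          exact integral_kernel_profile_ge hε hΛ hΛ1 hx
  set W := ∫ x, φ x ^ 2 / (x + ε) ∂unitVol
  set P := ∫ x, φ x ^ 2 ∂unitVol
  have : 2 * ((Λ ^ 2)⁻¹ * W) ≤ gagHalfSq 1 φ + 10 * P := by linarith
  calc W = Λ ^ 2 / 2 * (2 * ((Λ ^ 2)⁻¹ * W)) := by field_simp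
    _ ≤ _ := by gcongr

theorem measurePreserving_one_sub :
    MeasurePreserving (MeasurableEquiv.subLeft (1:ℝ)) unitVol unitVol := by
  have h := (Measure.measurePreserving_sub_left (volume : Measure ℝ) 1).restrict_preimage
    (s := Set.Ioo 0 1) measurableSet_Ioo
  have : (fun t : ℝ => 1 - t) ⁻¹' Set.Ioo 0 1 = Set.Ioo 0 1 := by
    ext t; simp
  rw [this] at h
  exact h

theorem integral_unitVol_one_sub (f : ℝ → ℝ) :
    ∫ x, f (1 - x) ∂unitVol = ∫ x, f x ∂unitVol :=
  measurePreserving_one_sub.integral_comp' f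

theorem gagHalf_one_sub {φ : ℝ → ℝ} (hφ : gagHalfFinite 1 φ) :
    gagHalfFinite 1 (fun x => φ (1 - x)) ∧ gagHalfSq 1 (fun x => φ (1 - x)) = gagHalfSq 1 φ := by
  have hm : MeasurePreserving
      ((MeasurableEquiv.subLeft (1:ℝ)).prodCongr (MeasurableEquiv.subLeft (1:ℝ)))
      (unitVol.prod unitVol) (unitVol.prod unitVol) :=
    measurePreserving_one_sub.prod measurePreserving_one_sub
  have hfun : (fun q : ℝ × ℝ => (φ (1 - q.1) - φ (1 - q.2)) ^ 2 / (q.1 - q.2) ^ 2)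
      = fun q => (fun q : ℝ × ℝ => (φ q.1 - φ q.2) ^ 2 / (q.1 - q.2) ^ 2)
        (((MeasurableEquiv.subLeft (1:ℝ)).prodCongr (MeasurableEquiv.subLeft (1:ℝ))) q) := by
    ext q
    change _ = (φ (1 - q.1) - φ (1 - q.2)) ^ 2 / ((1 - q.1) - (1 - q.2)) ^ 2
    congr 1
    ring
  have hfin : gagHalfFinite 1 (fun x => φ (1 - x)) := by
    have := (hm.integrable_comp_emb (MeasurableEquiv.measurableEmbedding _)).2 (integrable_gagHalf hφ)
    rw [gagHalfFinite, IntegrableOn, ← Measure.prod_restrict, hfun]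
    exact this
  refine ⟨hfin, ?_⟩
  rw [gagHalfSq_eq_integral_prod hfin, gagHalfSq_eq_integral_prod hφ, hfun]
  exact hm.integral_comp' fun q : ℝ × ℝ => (φ q.1 - φ q.2) ^ 2 / (q.1 - q.2) ^ 2

/-- A cutoff vanishing at both ends of the unit interval, with transition length `ε`. -/
noncomputable def endCutoff (ε x : ℝ) : ℝ := x / (x + ε) * ((1 - x) / (1 - x + ε))

theorem measurable_endCutoff (ε : ℝ) : Measurable (endCutoff ε) :=
  (measurable_id.div (measurable_id.add_const ε)).mul
    ((measurable_const.sub measurable_id).div ((measurable_const.sub measurable_id).add_const ε))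

theorem div_add_mem_Icc {ε x : ℝ} (hε : 0 < ε) (hx : 0 < x) : x / (x + ε) ∈ Set.Icc (0:ℝ) 1 :=
  ⟨by positivity, by rw [div_le_one (by positivity)]; linarith⟩

theorem endCutoff_mem_Icc {ε x : ℝ} (hε : 0 < ε) (hx : x ∈ Set.Ioo (0:ℝ) 1) :
    endCutoff ε x ∈ Set.Icc (0:ℝ) 1 := by
  obtain ⟨h1, h2⟩ := div_add_mem_Icc hε hx.1
  obtain ⟨h3, h4⟩ := div_add_mem_Icc hε (sub_pos.2 hx.2)
  exact ⟨mul_nonneg h1 h3, mul_le_one₀ h2 h3 h4⟩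

theorem one_sub_endCutoff_le {ε x : ℝ} (hε : 0 < ε) (hx : x ∈ Set.Ioo (0:ℝ) 1) :
    1 - endCutoff ε x ≤ ε / (x + ε) + ε / (1 - x + ε) := by
  obtain ⟨h1, h2⟩ := div_add_mem_Icc hε hx.1
  obtain ⟨h3, h4⟩ := div_add_mem_Icc hε (sub_pos.2 hx.2)
  have hx0 := hx.1
  have hx1 := sub_pos.2 hx.2
  have e1 : ε / (x + ε) = 1 - x / (x + ε) := by field_simp; ring
  have e2 : ε / (1 - x + ε) = 1 - (1 - x) / (1 - x + ε) := by field_simp; ring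
  rw [e1, e2, endCutoff]
  nlinarith

theorem endCutoff_sq_div_le {ε x : ℝ} (hε : 0 < ε) (hx : x ∈ Set.Ioo (0:ℝ) 1) :
    endCutoff ε x ^ 2 / x ≤ 1 / (x + ε) := by
  obtain ⟨h1, h2⟩ := div_add_mem_Icc hε hx.1
  obtain ⟨h3, h4⟩ := div_add_mem_Icc hε (sub_pos.2 hx.2)
  have hx0 := hx.1
  have h5 : endCutoff ε x ^ 2 ≤ x / (x + ε) := by
    rw [endCutoff, mul_pow]
    have := pow_le_one₀ h3 h4 (n := 2)
    nlinarith [mul_nonneg h1 (sub_nonneg.2 h2), mul_nonneg (sq_nonneg (x / (x + ε))) (sub_nonneg.2 this)]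
  calc endCutoff ε x ^ 2 / x ≤ x / (x + ε) / x := by gcongr
    _ = 1 / (x + ε) := by field_simp

theorem endCutoff_one_sub (ε x : ℝ) : endCutoff ε (1 - x) = endCutoff ε x := by
  simp only [endCutoff, sub_sub_cancel]
  ring

theorem endCutoff_sub_sq_le {ε x y : ℝ} (hε : 0 < ε) (hx : x ∈ Set.Ioo (0:ℝ) 1)
    (hy : y ∈ Set.Ioo (0:ℝ) 1) :
    (endCutoff ε x - endCutoff ε y) ^ 2 ≤ 2 * (ε / (x + ε) ^ 2 * (ε / (y + ε) ^ 2)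
      + ε / (1 - x + ε) ^ 2 * (ε / (1 - y + ε) ^ 2)) * (x - y) ^ 2 := by
  obtain ⟨h1, h2⟩ := div_add_mem_Icc hε hx.1
  obtain ⟨h3, h4⟩ := div_add_mem_Icc hε (sub_pos.2 hy.2)
  have hx0 := hx.1
  have hx1 := sub_pos.2 hx.2
  have hy0 := hy.1
  have hy1 := sub_pos.2 hy.2
  set s := x / (x + ε) - y / (y + ε) with hs
  set t := (1 - x) / (1 - x + ε) - (1 - y) / (1 - y + ε) with ht
  have e : endCutoff ε x - endCutoff ε y = x / (x + ε) * t + (1 - y) / (1 - y + ε) * s := by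
    simp only [endCutoff, hs, ht]; ring
  have es : s ^ 2 = ε / (x + ε) ^ 2 * (ε / (y + ε) ^ 2) * (x - y) ^ 2 := by
    rw [hs]; field_simp; ring
  have et : t ^ 2 = ε / (1 - x + ε) ^ 2 * (ε / (1 - y + ε) ^ 2) * (x - y) ^ 2 := by
    rw [ht]; field_simp; ring
  rw [e]
  have i1 : (x / (x + ε) * t) ^ 2 ≤ t ^ 2 := by
    rw [mul_pow]
    exact mul_le_of_le_one_left (sq_nonneg _) (pow_le_one₀ h1 h2)
  have i2 : ((1 - y) / (1 - y + ε) * s) ^ 2 ≤ s ^ 2 := by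
    rw [mul_pow]
    exact mul_le_of_le_one_left (sq_nonneg _) (pow_le_one₀ h3 h4)
  nlinarith [sq_nonneg (x / (x + ε) * t - (1 - y) / (1 - y + ε) * s)]

theorem integrable_and_integral_div_sq_le {ε : ℝ} (hε : 0 < ε) :
    Integrable (fun x => ε / (x + ε) ^ 2) unitVol ∧ ∫ x, ε / (x + ε) ^ 2 ∂unitVol ≤ 1 := by
  have hd : ∀ y ∈ Set.uIcc (0:ℝ) 1, HasDerivAt (fun y => -ε / (y + ε)) (ε / (y + ε) ^ 2) y := by
    intro y hy
    rw [Set.uIcc_of_le zero_le_one] at hy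
    have hY : y + ε ≠ 0 := by linarith [hy.1]
    refine ((hasDerivAt_const y (-ε)).div ((hasDerivAt_id y).add_const ε) hY).congr_deriv ?_
    simp
  have hi : IntervalIntegrable (fun y => ε / (y + ε) ^ 2) volume 0 1 := by
    refine ContinuousOn.intervalIntegrable (ContinuousOn.div (by fun_prop) (by fun_prop) ?_)
    intro y hy
    rw [Set.uIcc_of_le zero_le_one] at hy
    have : 0 < y + ε := by linarith [hy.1]
    positivity
  refine ⟨(intervalIntegrable_iff_integrableOn_Ioo_of_le zero_le_one).1 hi, ?_⟩
  rw [← integral_Ioc_eq_integral_Ioo, ← intervalIntegral.integral_of_le zero_le_one,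
    intervalIntegral.integral_eq_sub_of_hasDerivAt hd hi]
  have : 0 < ε / (1 + ε) := by positivity
  have h2 : -ε / (0 + ε) = -1 := by field_simp; simp
  rw [h2, neg_div]
  linarith

theorem integrable_one_sub {f : ℝ → ℝ} (hf : Integrable f unitVol) :
    Integrable (fun x => f (1 - x)) unitVol :=
  (measurePreserving_one_sub.integrable_comp_emb (MeasurableEquiv.measurableEmbedding _)).2 hf

/-- Multiplying by the cutoff costs only the two weighted `L²` norms. -/
theorem endCutoff_mul_H1200 {φ : ℝ → ℝ} (hφm : Measurable φ) (hφ : gagHalfFinite 1 φ)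
    {ε : ℝ} (hε : 0 < ε) :
    H1200Finite 1 (fun x => endCutoff ε x * φ x) ∧
    H1200NormSq 1 (fun x => endCutoff ε x * φ x) ≤ 2 * gagHalfSq 1 φ
      + 5 * (∫ x, φ x ^ 2 / (x + ε) ∂unitVol) + 5 * ∫ x, φ x ^ 2 / (1 - x + ε) ∂unitVol := by
  have hφ2 := integrable_sq_of_gagHalfFinite hφm hφ
  have hm1 : Measurable fun x => φ (1 - x) := hφm.comp (measurable_const.sub measurable_id)
  have hφ2' : Integrable (fun x => φ (1 - x) ^ 2) unitVol := integrable_one_sub hφ2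
  have hW0 := integrable_sq_div hφm hφ2 hε
  have hW1 : Integrable (fun x => φ x ^ 2 / (1 - x + ε)) unitVol := by
    simpa using integrable_one_sub (integrable_sq_div hm1 hφ2' hε)
  have hψm : Measurable fun x => endCutoff ε x * φ x := (measurable_endCutoff ε).mul hφm
  obtain ⟨ha0, ha0'⟩ := integrable_and_integral_div_sq_le hε
  have ha1 : Integrable (fun x => ε / (1 - x + ε) ^ 2) unitVol := integrable_one_sub ha0
  have ha1' : ∫ x, ε / (1 - x + ε) ^ 2 ∂unitVol ≤ 1 := by
    rwa [integral_unitVol_one_sub fun x => ε / (x + ε) ^ 2]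
  have hmono : ∀ {d : ℝ → ℝ}, Measurable d → (∀ x ∈ Set.Ioo (0:ℝ) 1, 0 < d x) →
      Integrable (fun x => φ x ^ 2 / (d x + ε)) unitVol →
      Integrable (fun x => φ x ^ 2 * (ε / (d x + ε) ^ 2)) unitVol ∧
      ∫ x, φ x ^ 2 * (ε / (d x + ε) ^ 2) ∂unitVol ≤ ∫ x, φ x ^ 2 / (d x + ε) ∂unitVol := by
    intro d hd hd0 hi
    have hle : ∀ᵐ x ∂unitVol, φ x ^ 2 * (ε / (d x + ε) ^ 2) ≤ φ x ^ 2 / (d x + ε) := by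
      filter_upwards [ae_unitVol] with x hx
      have := hd0 x hx
      rw [div_eq_mul_one_div (φ x ^ 2)]
      gcongr ?_ * ?_
      rw [div_le_div_iff₀ (by positivity) (by positivity)]
      nlinarith
    have hi2 : Integrable (fun x => φ x ^ 2 * (ε / (d x + ε) ^ 2)) unitVol := by
      refine hi.mono' ((hφm.pow_const 2).mul
        (measurable_const.div ((hd.add_const ε).pow_const 2))).aestronglyMeasurable ?_
      filter_upwards [hle] with x hx
      rwa [Real.norm_of_nonneg (by positivity)]
    exact ⟨hi2, integral_mono_ae hi2 hi hle⟩
  obtain ⟨hb0, hb0'⟩ := hmono measurable_id (fun x hx => hx.1) hW0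
  obtain ⟨hb1, hb1'⟩ := hmono (d := fun x => 1 - x) (by fun_prop) (fun x hx => sub_pos.2 hx.2) hW1
  simp only [id] at hb0 hb0'
  set D : ℝ × ℝ → ℝ := fun q =>
    2 * ((φ q.1 - φ q.2) ^ 2 / (q.1 - q.2) ^ 2) +
      (4 * (ε / (q.1 + ε) ^ 2 * (φ q.2 ^ 2 * (ε / (q.2 + ε) ^ 2))) +
       4 * (ε / (1 - q.1 + ε) ^ 2 * (φ q.2 ^ 2 * (ε / (1 - q.2 + ε) ^ 2)))) with hD
  have hi0 := (integrable_gagHalf hφ).const_mul 2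
  have hi1 := (ha0.mul_prod hb0).const_mul 4
  have hi2 := (ha1.mul_prod hb1).const_mul 4
  have hi12 : Integrable (fun q : ℝ × ℝ =>
      4 * (ε / (q.1 + ε) ^ 2 * (φ q.2 ^ 2 * (ε / (q.2 + ε) ^ 2))) +
        4 * (ε / (1 - q.1 + ε) ^ 2 * (φ q.2 ^ 2 * (ε / (1 - q.2 + ε) ^ 2))))
      (unitVol.prod unitVol) := hi1.add hi2
  have hDi : Integrable D (unitVol.prod unitVol) := hi0.add hi12
  have hle : ∀ᵐ q ∂unitVol.prod unitVol,
      (endCutoff ε q.1 * φ q.1 - endCutoff ε q.2 * φ q.2) ^ 2 / (q.1 - q.2) ^ 2 ≤ D q := by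
    filter_upwards [ae_unitVol_prod] with q hq
    obtain ⟨hx, hy⟩ := hq
    have hc := endCutoff_sub_sq_le hε hx hy
    obtain ⟨hx0, hx1⟩ := endCutoff_mem_Icc hε hx
    rcases eq_or_ne q.1 q.2 with h | h
    · have hD0 : 0 ≤ D q := by simp only [hD]; positivity
      simpa [h] using hD0
    · have h0 : 0 < (q.1 - q.2) ^ 2 := by have := sub_ne_zero.2 h; positivity
      rw [div_le_iff₀ h0]
      set A := ε / (q.1 + ε) ^ 2 * (ε / (q.2 + ε) ^ 2)
      set B := ε / (1 - q.1 + ε) ^ 2 * (ε / (1 - q.2 + ε) ^ 2)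
      have e : D q * (q.1 - q.2) ^ 2 = 2 * (φ q.1 - φ q.2) ^ 2
          + 2 * (φ q.2 ^ 2 * (2 * (A + B) * (q.1 - q.2) ^ 2)) := by
        have : (φ q.1 - φ q.2) ^ 2 / (q.1 - q.2) ^ 2 * (q.1 - q.2) ^ 2 = (φ q.1 - φ q.2) ^ 2 :=
          div_mul_cancel₀ _ h0.ne'
        simp only [hD, A, B]
        linear_combination 2 * this
      rw [e]
      have i1 : (endCutoff ε q.1 * (φ q.1 - φ q.2)) ^ 2 ≤ (φ q.1 - φ q.2) ^ 2 := by
        rw [mul_pow]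
        exact mul_le_of_le_one_left (sq_nonneg _) (pow_le_one₀ hx0 hx1)
      have i2 : (φ q.2 * (endCutoff ε q.1 - endCutoff ε q.2)) ^ 2
          ≤ φ q.2 ^ 2 * (2 * (A + B) * (q.1 - q.2) ^ 2) := by
        rw [mul_pow]
        gcongr
      nlinarith [sq_nonneg (endCutoff ε q.1 * (φ q.1 - φ q.2)
        - φ q.2 * (endCutoff ε q.1 - endCutoff ε q.2))]
  have hGi : Integrable (fun q : ℝ × ℝ =>
      (endCutoff ε q.1 * φ q.1 - endCutoff ε q.2 * φ q.2) ^ 2 / (q.1 - q.2) ^ 2)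
      (unitVol.prod unitVol) := by
    refine hDi.mono' ?_ ?_
    · exact ((((hψm.comp measurable_fst).sub (hψm.comp measurable_snd)).pow_const 2).div
        ((measurable_fst.sub measurable_snd).pow_const 2)).aestronglyMeasurable
    · filter_upwards [hle] with q hq
      rwa [Real.norm_of_nonneg (by positivity)]
  have hfin : gagHalfFinite 1 (fun x => endCutoff ε x * φ x) := by
    rw [gagHalfFinite, IntegrableOn, ← Measure.prod_restrict]
    exact hGi
  have hgag : gagHalfSq 1 (fun x => endCutoff ε x * φ x) ≤ 2 * gagHalfSq 1 φ
      + 4 * (∫ x, φ x ^ 2 / (x + ε) ∂unitVol) + 4 * ∫ x, φ x ^ 2 / (1 - x + ε) ∂unitVol := by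
    rw [gagHalfSq_eq_integral_prod hfin]
    refine (integral_mono_ae hGi hDi hle).trans ?_
    simp only [hD]
    rw [integral_add hi0 hi12, integral_add hi1 hi2, integral_const_mul,
      integral_const_mul, integral_const_mul, integral_prod_mul (fun x => ε / (x + ε) ^ 2)
        (fun x => φ x ^ 2 * (ε / (x + ε) ^ 2)), integral_prod_mul (fun x => ε / (1 - x + ε) ^ 2)
        (fun x => φ x ^ 2 * (ε / (1 - x + ε) ^ 2)), ← gagHalfSq_eq_integral_prod hφ]
    have n0 : 0 ≤ ∫ x, φ x ^ 2 * (ε / (x + ε) ^ 2) ∂unitVol :=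
      integral_nonneg fun _ => by positivity
    have n1 : 0 ≤ ∫ x, φ x ^ 2 * (ε / (1 - x + ε) ^ 2) ∂unitVol :=
      integral_nonneg fun _ => by positivity
    nlinarith [mul_le_mul_of_nonneg_right ha0' n0, mul_le_mul_of_nonneg_right ha1' n1]
  have hend : ∀ {d : ℝ → ℝ}, Measurable d → (∀ x ∈ Set.Ioo (0:ℝ) 1, 0 < d x) →
      (∀ x ∈ Set.Ioo (0:ℝ) 1, endCutoff ε x ^ 2 / d x ≤ 1 / (d x + ε)) →
      Integrable (fun x => φ x ^ 2 / (d x + ε)) unitVol →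
      Integrable (fun x => (endCutoff ε x * φ x) ^ 2 / d x) unitVol ∧
      ∫ x, (endCutoff ε x * φ x) ^ 2 / d x ∂unitVol ≤ ∫ x, φ x ^ 2 / (d x + ε) ∂unitVol := by
    intro d hd hd0 hc hi
    have hle : ∀ᵐ x ∂unitVol, (endCutoff ε x * φ x) ^ 2 / d x ≤ φ x ^ 2 / (d x + ε) := by
      filter_upwards [ae_unitVol] with x hx
      calc (endCutoff ε x * φ x) ^ 2 / d x = φ x ^ 2 * (endCutoff ε x ^ 2 / d x) := by ring
        _ ≤ φ x ^ 2 * (1 / (d x + ε)) := mul_le_mul_of_nonneg_left (hc x hx) (sq_nonneg _)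
        _ = _ := by ring
    have hi2 : Integrable (fun x => (endCutoff ε x * φ x) ^ 2 / d x) unitVol := by
      refine hi.mono' ((hψm.pow_const 2).div hd).aestronglyMeasurable ?_
      filter_upwards [hle, ae_unitVol] with x hx hx'
      have := hd0 x hx'
      rwa [Real.norm_of_nonneg (by positivity)]
    exact ⟨hi2, integral_mono_ae hi2 hi hle⟩
  obtain ⟨hc0, hc0'⟩ := hend measurable_id (fun x hx => hx.1)
    (fun x hx => endCutoff_sq_div_le hε hx) hW0
  obtain ⟨hc1, hc1'⟩ := hend (d := fun x => 1 - x) (by fun_prop) (fun x hx => sub_pos.2 hx.2)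
    (fun x hx => by
      have := endCutoff_sq_div_le hε (x := 1 - x) ⟨sub_pos.2 hx.2, by linarith [hx.1]⟩
      rwa [endCutoff_one_sub] at this) hW1
  refine ⟨⟨hfin, hc0, hc1⟩, ?_⟩
  rw [H1200NormSq]
  simp only [id] at hc0'
  linarith

theorem sq_integral_mul_le {α : Type*} [MeasurableSpace α] {μ : Measure α} {f g : α → ℝ}
    (hf : Integrable (fun x => f x ^ 2) μ) (hg : Integrable (fun x => g x ^ 2) μ)
    (hfg : Integrable (fun x => f x * g x) μ) :
    (∫ x, f x * g x ∂μ) ^ 2 ≤ (∫ x, f x ^ 2 ∂μ) * ∫ x, g x ^ 2 ∂μ := by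
  have key : ∀ t : ℝ, 0 ≤ (∫ x, f x ^ 2 ∂μ) * (t * t) + (2 * ∫ x, f x * g x ∂μ) * t
      + ∫ x, g x ^ 2 ∂μ := by
    intro t
    have h1 : Integrable (fun x => (t * t) * f x ^ 2 + (2 * t) * (f x * g x)) μ :=
      (hf.const_mul _).add (hfg.const_mul _)
    calc (0:ℝ) ≤ ∫ x, (t * f x + g x) ^ 2 ∂μ := integral_nonneg fun _ => sq_nonneg _
      _ = ∫ x, (((t * t) * f x ^ 2 + (2 * t) * (f x * g x)) + g x ^ 2) ∂μ := by
        congr 1; ext x; ring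
      _ = _ := by
        rw [integral_add h1 hg, integral_add (hf.const_mul _) (hfg.const_mul _),
          integral_const_mul, integral_const_mul]
        ring
  have := discrim_le_zero key
  rw [discrim] at this
  linarith

theorem integral_abs_mul_div_le {φ : ℝ → ℝ} (hφm : Measurable φ)
    (hφ2 : Integrable (fun x => φ x ^ 2) unitVol) {ε : ℝ} (hε : 0 < ε) :
    Integrable (fun x => |φ x| * (ε / (x + ε))) unitVol ∧
    ∫ x, |φ x| * (ε / (x + ε)) ∂unitVol ≤ √(ε * ∫ x, φ x ^ 2 ∂unitVol) := by
  obtain ⟨ha, ha'⟩ := integrable_and_integral_div_sq_le hε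
  have hm : Measurable fun x : ℝ => ε / (x + ε) := measurable_const.div (measurable_id.add_const ε)
  have he : ∀ x : ℝ, (ε / (x + ε)) ^ 2 = ε * (ε / (x + ε) ^ 2) := fun x => by rw [div_pow]; ring
  have hg : Integrable (fun x : ℝ => (ε / (x + ε)) ^ 2) unitVol := by
    simp only [he]
    exact ha.const_mul ε
  have hf : Integrable (fun x : ℝ => |φ x| ^ 2) unitVol := by simpa using hφ2
  have hfg : Integrable (fun x => |φ x| * (ε / (x + ε))) unitVol := by
    refine (hf.add hg).mono' (hφm.abs.mul hm).aestronglyMeasurable ?_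
    filter_upwards [ae_unitVol] with x hx
    have := hx.1
    rw [Real.norm_of_nonneg (by positivity)]
    simp only [Pi.add_apply]
    nlinarith [sq_nonneg (|φ x| - ε / (x + ε)), sq_nonneg (|φ x|), sq_nonneg (ε / (x + ε))]
  refine ⟨hfg, Real.le_sqrt_of_sq_le ((sq_integral_mul_le hf hg hfg).trans ?_)⟩
  simp only [he, integral_const_mul, sq_abs]
  rw [mul_comm]
  have : 0 ≤ ∫ x, φ x ^ 2 ∂unitVol := integral_nonneg fun _ => sq_nonneg _
  gcongr
  nlinarith

/-- A tent of height `r` supported in `[c - r, c + r]`. -/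
noncomputable def tent (c r x : ℝ) : ℝ := max 0 (r - |x - c|)

theorem tent_sub_sq_le (c r x y : ℝ) : (tent c r x - tent c r y) ^ 2 ≤ (x - y) ^ 2 := by
  refine sq_le_sq.2 ?_
  simp only [tent, max_comm (0:ℝ)]
  refine (abs_max_sub_max_le_abs _ _ _).trans ?_
  rw [sub_sub_sub_cancel_left, abs_sub_comm]
  refine (abs_abs_sub_abs_le_abs_sub _ _).trans (le_of_eq ?_)
  congr 1
  ring

theorem tent_sq_le {c r d x : ℝ} (hr : 0 ≤ r) (hd : |x - c| ≤ r → r ≤ d) :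
    tent c r x ^ 2 ≤ r * d ∨ tent c r x = 0 := by
  rcases le_total r |x - c| with h | h
  · right
    exact max_eq_left (by linarith)
  · left
    have h1 := hd h
    have : tent c r x ≤ r := max_le hr (by linarith [abs_nonneg (x - c)])
    have h0 : 0 ≤ tent c r x := le_max_left _ _
    nlinarith

theorem tent_H1200 {c r : ℝ} (hr : 0 < r) (h0 : 2 * r ≤ c) (h1 : c ≤ 1 - 2 * r) (s : ℝ)
    (hs : |s| = 1) :
    H1200Finite 1 (fun x => s * tent c r x) ∧ H1200NormSq 1 (fun x => s * tent c r x) ≤ 3 := by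
  have hm : Measurable fun x => s * tent c r x :=
    (measurable_const.max (measurable_const.sub (measurable_id.sub_const c).abs)).const_mul s
  have hs2 : s ^ 2 = 1 := by rw [← sq_abs, hs]; norm_num
  have hg : ∀ q : ℝ × ℝ, (s * tent c r q.1 - s * tent c r q.2) ^ 2 / (q.1 - q.2) ^ 2 ≤ 1 := by
    intro q
    rw [← mul_sub, mul_pow, hs2, one_mul]
    exact div_le_one_of_le₀ (tent_sub_sq_le _ _ _ _) (sq_nonneg _)
  have hgi : Integrable (fun q : ℝ × ℝ =>
      (s * tent c r q.1 - s * tent c r q.2) ^ 2 / (q.1 - q.2) ^ 2) (unitVol.prod unitVol) := by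
    refine (integrable_const 1).mono' ?_ (.of_forall fun q => ?_)
    · exact ((((hm.comp measurable_fst).sub (hm.comp measurable_snd)).pow_const 2).div
        ((measurable_fst.sub measurable_snd).pow_const 2)).aestronglyMeasurable
    · rw [Real.norm_of_nonneg (by positivity)]
      exact hg q
  have hfin : gagHalfFinite 1 (fun x => s * tent c r x) := by
    rw [gagHalfFinite, IntegrableOn, ← Measure.prod_restrict]
    exact hgi
  have hend : ∀ {d : ℝ → ℝ}, Measurable d → (∀ x ∈ Set.Ioo (0:ℝ) 1, 0 < d x) →
      (∀ x, |x - c| ≤ r → r ≤ d x) →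
      Integrable (fun x => (s * tent c r x) ^ 2 / d x) unitVol ∧
      ∫ x, (s * tent c r x) ^ 2 / d x ∂unitVol ≤ 1 := by
    intro d hd hd0 hdr
    have hle : ∀ᵐ x ∂unitVol, (s * tent c r x) ^ 2 / d x ≤ 1 := by
      filter_upwards [ae_unitVol] with x hx
      have hdx := hd0 x hx
      rw [mul_pow, hs2, one_mul]
      rcases tent_sq_le hr.le (hdr x) with h | h
      · rw [div_le_one hdx]
        nlinarith
      · simp [h]
    have hi : Integrable (fun x => (s * tent c r x) ^ 2 / d x) unitVol := by
      refine (integrable_const 1).mono' ((hm.pow_const 2).div hd).aestronglyMeasurable ?_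
      filter_upwards [hle, ae_unitVol] with x hx hx'
      have := hd0 x hx'
      rwa [Real.norm_of_nonneg (by positivity)]
    refine ⟨hi, (integral_mono_ae hi (integrable_const 1) hle).trans (by simp)⟩
  obtain ⟨a0, b0⟩ := hend measurable_id (fun x hx => hx.1) (fun x hx => by
    have := (abs_le.1 hx).1
    simp only [id]
    linarith)
  obtain ⟨a1, b1⟩ := hend (d := fun x => 1 - x) (by fun_prop) (fun x hx => sub_pos.2 hx.2)
    (fun x hx => by
      have := (abs_le.1 hx).2
      linarith)
  refine ⟨⟨hfin, a0, a1⟩, ?_⟩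
  have : gagHalfSq 1 (fun x => s * tent c r x) ≤ 1 := by
    rw [gagHalfSq_eq_integral_prod hfin]
    exact (integral_mono hgi (integrable_const 1) hg).trans (by simp)
  rw [H1200NormSq]
  simp only [id] at b0
  linarith

theorem continuous_tent (c r : ℝ) : Continuous (tent c r) := by
  unfold tent
  fun_prop

theorem le_integral_tent {c r : ℝ} (hr : 0 < r) (h0 : 2 * r ≤ c) (h1 : c ≤ 1 - 2 * r) :
    r ^ 2 / 2 ≤ ∫ x, tent c r x ∂unitVol := by
  have hi : ∀ s : Set ℝ, s ⊆ Set.Icc 0 1 → IntegrableOn (tent c r) s volume := fun s hs =>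
    ((continuous_tent c r).continuousOn.integrableOn_compact isCompact_Icc).mono_set hs
  have hsub : Set.Ioo (c - r / 2) (c + r / 2) ⊆ Set.Ioo (0:ℝ) 1 :=
    Set.Ioo_subset_Ioo (by linarith) (by linarith)
  calc r ^ 2 / 2 = ∫ x in Set.Ioo (c - r / 2) (c + r / 2), r / 2 := by
        simp only [integral_const, measureReal_restrict_apply_univ, Real.volume_real_Ioo, smul_eq_mul]
        rw [max_eq_left (by linarith)]
        ring
    _ ≤ ∫ x in Set.Ioo (c - r / 2) (c + r / 2), tent c r x := by
        refine setIntegral_mono_on (by simp) (hi _ (hsub.trans Set.Ioo_subset_Icc_self))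
          measurableSet_Ioo fun x hx => ?_
        have : |x - c| ≤ r / 2 := by rw [abs_le]; constructor <;> linarith [hx.1, hx.2]
        exact le_max_of_le_right (by linarith)
    _ ≤ ∫ x in Set.Ioo (0:ℝ) 1, tent c r x :=
        setIntegral_mono_set (hi _ Set.Ioo_subset_Icc_self)
          (.of_forall fun x => le_max_left _ _) hsub.eventuallyLE

/-- An inverse inequality: on polynomials of degree at most `k` the supremum norm is bounded by
`k ^ 4` times the dual `H^{1/2}_{00}` norm. -/
theorem abs_eval_le_of_dual_bound {k : ℕ} (hk : 1 ≤ k) {p : Polynomial ℝ} (hp : p.natDegree ≤ k)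
    {N : ℝ} (hN : 0 ≤ N)
    (hpN : ∀ ψ : ℝ → ℝ, Measurable ψ → H1200Finite 1 ψ →
      ∫ x, p.eval x * ψ x ∂unitVol ≤ N * √(H1200NormSq 1 ψ)) :
    ∀ x ∈ Set.Icc (0:ℝ) 1, |p.eval x| ≤ 4608 * k ^ 4 * N := by
  obtain ⟨x₀, hx₀, hmax⟩ := isCompact_Icc.exists_isMaxOn (Set.nonempty_Icc.2 (zero_le_one' ℝ))
    (p.continuous.abs.continuousOn (s := Set.Icc 0 1))
  set M := |p.eval x₀| with hM
  have hb : ∀ x ∈ Set.Icc (0:ℝ) 1, |p.eval x| ≤ M := fun x hx => hmax hx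
  suffices h : M ≤ 4608 * k ^ 4 * N from fun x hx => (hb x hx).trans h
  rcases (abs_nonneg (p.eval x₀)).eq_or_lt with h0 | hMpos
  · rw [hM, ← h0]; positivity
  rw [← hM] at hMpos
  have hk1 : (1:ℝ) ≤ k := by exact_mod_cast hk
  have hk2 : (1:ℝ) ≤ (k:ℝ) ^ 2 := one_le_pow₀ hk1
  have hlip : ∀ x ∈ Set.Icc (0:ℝ) 1, |p.eval x - p.eval x₀| ≤ 4 * k ^ 2 * M * |x - x₀| := by
    intro x hx
    have := Convex.norm_image_sub_le_of_norm_deriv_le (f := fun x => p.eval x)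
      (s := Set.Icc (0:ℝ) 1) (C := 4 * k ^ 2 * M) (fun x _ => p.differentiableAt)
      (fun x hx => by
        rw [Polynomial.deriv]
        exact Polynomial.abs_derivative_eval_le hp hMpos hb hx) (convex_Icc 0 1) hx₀ hx
    simpa using this
  set r : ℝ := 1 / (24 * k ^ 2) with hr
  have hr0 : 0 < r := by positivity
  have hrk : r * k ^ 2 = 1 / 24 := by rw [hr]; field_simp
  have hr1 : r ≤ 1 / 24 := by nlinarith
  obtain ⟨c, hc0, hc1, hcx⟩ : ∃ c, 2 * r ≤ c ∧ c ≤ 1 - 2 * r ∧ |c - x₀| ≤ 2 * r := by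
    obtain ⟨ha, hb⟩ := hx₀
    rcases le_total x₀ (1 / 2) with h | h
    · exact ⟨x₀ + 2 * r, by linarith, by linarith, by
        rw [add_sub_cancel_left, abs_of_pos (by positivity)]⟩
    · exact ⟨x₀ - 2 * r, by linarith, by linarith, by
        rw [sub_sub_cancel_left, abs_neg, abs_of_pos (by positivity)]⟩
  obtain ⟨s, hs, hsp⟩ : ∃ s : ℝ, |s| = 1 ∧ s * p.eval x₀ = M := by
    rcases le_total 0 (p.eval x₀) with h | h
    · exact ⟨1, by simp, by rw [hM, abs_of_nonneg h, one_mul]⟩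
    · exact ⟨-1, by simp, by rw [hM, abs_of_nonpos h]; ring⟩
  obtain ⟨hfin, hnorm⟩ := tent_H1200 hr0 hc0 hc1 s hs
  have hN3 := hpN _ ((continuous_tent c r).measurable.const_mul s) hfin
  have hti : Integrable (tent c r) unitVol :=
    ((continuous_tent c r).continuousOn.integrableOn_compact isCompact_Icc).mono_set
      Set.Ioo_subset_Icc_self
  have hpi : Integrable (fun x => p.eval x * (s * tent c r x)) unitVol :=
    ((p.continuous.mul ((continuous_tent c r).const_mul s)).continuousOn.integrableOn_compact
      isCompact_Icc).mono_set Set.Ioo_subset_Icc_self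
  have hlow : M / 2 * ∫ x, tent c r x ∂unitVol ≤ ∫ x, p.eval x * (s * tent c r x) ∂unitVol := by
    rw [← integral_const_mul]
    refine integral_mono_ae (hti.const_mul _) hpi ?_
    filter_upwards [ae_unitVol] with x hx
    have ht0 : 0 ≤ tent c r x := le_max_left _ _
    rcases le_total r |x - c| with h | h
    · have : tent c r x = 0 := max_eq_left (by linarith)
      simp [this]
    · have h3 : |x - x₀| ≤ 3 * r := by
        calc |x - x₀| = |(x - c) + (c - x₀)| := by ring_nf
          _ ≤ |x - c| + |c - x₀| := abs_add_le _ _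
          _ ≤ 3 * r := by linarith
      have h4 : |p.eval x - p.eval x₀| ≤ M / 2 := by
        refine (hlip x (Set.Ioo_subset_Icc_self hx)).trans ?_
        calc 4 * (k:ℝ) ^ 2 * M * |x - x₀| ≤ 4 * k ^ 2 * M * (3 * r) := by gcongr
          _ = 12 * (r * k ^ 2) * M := by ring
          _ = M / 2 := by rw [hrk]; ring
      have h5 : |s * (p.eval x - p.eval x₀)| ≤ M / 2 := by rw [abs_mul, hs, one_mul]; exact h4
      have h6 : M / 2 ≤ s * p.eval x := by
        have := (abs_le.1 h5).1
        rw [mul_sub, hsp] at this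
        linarith
      calc M / 2 * tent c r x ≤ s * p.eval x * tent c r x := by gcongr
        _ = _ := by ring
  have hsq : √(H1200NormSq 1 fun x => s * tent c r x) ≤ 2 := by
    rw [Real.sqrt_le_left (by norm_num)]
    linarith
  have h7 : M / 2 * (r ^ 2 / 2) ≤ N * 2 :=
    calc M / 2 * (r ^ 2 / 2) ≤ M / 2 * ∫ x, tent c r x ∂unitVol := by
          gcongr; exact le_integral_tent hr0 hc0 hc1
      _ ≤ N * 2 := hlow.trans (hN3.trans (by gcongr))
  have h8 : (r * k ^ 2) ^ 2 = (1 / 24) ^ 2 := by rw [hrk]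
  have h9 : M * (r * k ^ 2) ^ 2 ≤ 8 * N * k ^ 4 := by
    calc M * (r * (k:ℝ) ^ 2) ^ 2 = 4 * (M / 2 * (r ^ 2 / 2)) * k ^ 4 := by ring
      _ ≤ 4 * (N * 2) * k ^ 4 := by gcongr
      _ = _ := by ring
  rw [h8] at h9
  linarith

theorem integral_eval_mul_le {k : ℕ} (hk : 2 ≤ k) {p : Polynomial ℝ} (hp : p.natDegree ≤ k)
    {N : ℝ} (hN : 0 ≤ N)
    (hpN : ∀ ψ : ℝ → ℝ, Measurable ψ → H1200Finite 1 ψ →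
      ∫ x, p.eval x * ψ x ∂unitVol ≤ N * √(H1200NormSq 1 ψ))
    {φ : ℝ → ℝ} (hφm : Measurable φ) (hφ : gagHalfFinite 1 φ) :
    ∫ x, p.eval x * φ x ∂unitVol
      ≤ 20000 * Real.log k * N * √(gagHalfSq 1 φ + ∫ x, φ x ^ 2 ∂unitVol) := by
  have hφ2 := integrable_sq_of_gagHalfFinite hφm hφ
  have hφ1 := integrable_of_integrable_sq hφm hφ2
  have hm1 : Measurable fun x => φ (1 - x) := hφm.comp (measurable_const.sub measurable_id)
  have hφ2' : Integrable (fun x => φ (1 - x) ^ 2) unitVol := integrable_one_sub hφ2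
  obtain ⟨hφ', hgag'⟩ := gagHalf_one_sub hφ
  have hk2 : (2:ℝ) ≤ k := by exact_mod_cast hk
  have hk0 : (0:ℝ) < k := by linarith
  have hlog2 : 1 / 2 ≤ Real.log 2 := by linarith [Real.log_two_gt_d9]
  have hlogk : Real.log 2 ≤ Real.log k := Real.log_le_log (by norm_num) hk2
  set ε : ℝ := ((k:ℝ) ^ 8)⁻¹ with hε
  have hε0 : 0 < ε := by positivity
  have hε1 : ε ≤ 1 := inv_le_one_of_one_le₀ (one_le_pow₀ (by linarith))
  have hlogε : Real.log ε = -(8 * Real.log k) := by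
    rw [hε, Real.log_inv, Real.log_pow]; norm_num
  have hl1 : 0 ≤ Real.log (1 + ε) := Real.log_nonneg (by linarith)
  have hl2 : Real.log (1 + ε) ≤ Real.log 2 := Real.log_le_log (by linarith) (by linarith)
  obtain ⟨Λ, hΛ⟩ : ∃ Λ, Λ = Real.log (1 + ε) - Real.log ε := ⟨_, rfl⟩
  have hΛ1 : 1 ≤ Λ := by linarith
  have hΛk : Λ ≤ 9 * Real.log k := by linarith
  set P := ∫ x, φ x ^ 2 ∂unitVol with hP
  have hP0 : 0 ≤ P := integral_nonneg fun _ => sq_nonneg _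
  have hG0 := gagHalfSq_nonneg 1 φ
  set B := gagHalfSq 1 φ + P with hB
  have hΛB : 0 ≤ Λ ^ 2 * gagHalfSq 1 φ := by positivity
  have hW0 : ∫ x, φ x ^ 2 / (x + ε) ∂unitVol ≤ 5 * Λ ^ 2 * B := by
    have := integral_sq_div_le hφm hφ hε0 hΛ hΛ1
    rw [← hP] at this
    nlinarith
  have hW1 : ∫ x, φ x ^ 2 / (1 - x + ε) ∂unitVol ≤ 5 * Λ ^ 2 * B := by
    have := integral_sq_div_le hm1 hφ' hε0 hΛ hΛ1
    rw [hgag', integral_unitVol_one_sub fun x => φ x ^ 2, ← hP,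
      ← integral_unitVol_one_sub] at this
    simp only [sub_sub_cancel] at this
    nlinarith
  obtain ⟨hfin, hnorm⟩ := endCutoff_mul_H1200 hφm hφ hε0
  have hB0 : 0 ≤ B := add_nonneg hG0 hP0
  have hnorm2 : √(H1200NormSq 1 fun x => endCutoff ε x * φ x) ≤ 8 * Λ * √B := by
    refine Real.sqrt_le_iff.2 ⟨by positivity, ?_⟩
    rw [mul_pow, Real.sq_sqrt hB0]
    have : B ≤ Λ ^ 2 * B := le_mul_of_one_le_left hB0 (one_le_pow₀ hΛ1)
    nlinarith
  have hmain : ∫ x, p.eval x * (endCutoff ε x * φ x) ∂unitVol ≤ 72 * Real.log k * N * √B :=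
    calc _ ≤ N * √(H1200NormSq 1 fun x => endCutoff ε x * φ x) :=
          hpN _ ((measurable_endCutoff ε).mul hφm) hfin
      _ ≤ N * (8 * (9 * Real.log k) * √B) := by
          gcongr
          exact hnorm2.trans (by gcongr)
      _ = _ := by ring
  have hbound := abs_eval_le_of_dual_bound (by omega) hp hN hpN
  have hpb : ∀ᵐ x ∂unitVol, ‖p.eval x‖ ≤ 4608 * k ^ 4 * N := by
    filter_upwards [ae_unitVol] with x hx using hbound x (Set.Ioo_subset_Icc_self hx)
  have hpφ : Integrable (fun x => p.eval x * φ x) unitVol :=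
    hφ1.bdd_mul p.continuous.aestronglyMeasurable hpb
  have hpψ : Integrable (fun x => p.eval x * (endCutoff ε x * φ x)) unitVol := by
    refine Integrable.bdd_mul (hφ1.bdd_mul (c := 1) (measurable_endCutoff ε).aestronglyMeasurable ?_)
      p.continuous.aestronglyMeasurable hpb
    filter_upwards [ae_unitVol] with x hx
    obtain ⟨h1, h2⟩ := endCutoff_mem_Icc hε0 hx
    rwa [Real.norm_of_nonneg h1]
  obtain ⟨hR0i, hR0⟩ := integral_abs_mul_div_le hφm hφ2 hε0
  obtain ⟨hR1i, hR1⟩ := integral_abs_mul_div_le hm1 hφ2' hε0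
  rw [integral_unitVol_one_sub fun x => φ x ^ 2, ← integral_unitVol_one_sub] at hR1
  replace hR1i := integrable_one_sub hR1i
  simp only [sub_sub_cancel] at hR1 hR1i
  have hsqrt : √(ε * P) = ((k:ℝ) ^ 4)⁻¹ * √P := by
    rw [Real.sqrt_mul hε0.le]
    congr 1
    rw [Real.sqrt_eq_iff_mul_self_eq hε0.le (by positivity), hε, ← mul_inv]
    congr 1
    ring
  rw [← hP, hsqrt] at hR0 hR1
  have hrem : ∫ x, p.eval x * φ x ∂unitVol - ∫ x, p.eval x * (endCutoff ε x * φ x) ∂unitVol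
      ≤ 9216 * N * √B := by
    rw [← integral_sub hpφ hpψ]
    calc _ ≤ ∫ x, 4608 * k ^ 4 * N *
            (|φ x| * (ε / (x + ε)) + |φ x| * (ε / (1 - x + ε))) ∂unitVol := by
          refine integral_mono_ae (hpφ.sub hpψ) ((hR0i.add hR1i).const_mul _) ?_
          filter_upwards [ae_unitVol, hpb] with x hx hpx
          obtain ⟨h1, h2⟩ := endCutoff_mem_Icc hε0 hx
          calc p.eval x * φ x - p.eval x * (endCutoff ε x * φ x)
              = p.eval x * (φ x * (1 - endCutoff ε x)) := by ring
            _ ≤ |p.eval x| * (|φ x| * (1 - endCutoff ε x)) := by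
                refine (le_abs_self _).trans (le_of_eq ?_)
                rw [abs_mul, abs_mul, abs_of_nonneg (sub_nonneg.2 h2)]
            _ ≤ 4608 * k ^ 4 * N * (|φ x| * (ε / (x + ε) + ε / (1 - x + ε))) := by
                have := sub_nonneg.2 h2
                gcongr
                · exact hpx
                · exact one_sub_endCutoff_le hε0 hx
            _ = _ := by ring
      _ ≤ 4608 * k ^ 4 * N * (((k:ℝ) ^ 4)⁻¹ * √P + ((k:ℝ) ^ 4)⁻¹ * √P) := by
          rw [integral_const_mul, integral_add hR0i hR1i]
          gcongr
      _ = 9216 * N * √P := by field_simp; ring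
      _ ≤ 9216 * N * √B := by
          gcongr
          linarith
  have h1 : N * √B ≤ 2 * Real.log k * (N * √B) :=
    le_mul_of_one_le_left (by positivity) (by linarith)
  have h2 : 0 ≤ Real.log k * (N * √B) := mul_nonneg (by linarith) (by positivity)
  nlinarith

theorem integrableOn_comp_smul_iff {E : Type*} [NormedAddCommGroup E] [NormedSpace ℝ E]
    [MeasurableSpace E] [BorelSpace E] [FiniteDimensional ℝ E] {μ : Measure E} [μ.IsAddHaarMeasure]
    {f : E → ℝ} {s : Set E} (hs : MeasurableSet s) {h : ℝ} (hh : h ≠ 0) :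
    IntegrableOn (fun x => f (h • x)) ((h • ·) ⁻¹' s) μ ↔ IntegrableOn f s μ := by
  rw [← integrable_indicator_iff hs, ← integrable_indicator_iff
    ((measurable_const_smul h) hs), ← integrable_comp_smul_iff μ (s.indicator f) hh]
  rfl

theorem mul_mem_Ioo_iff {h x : ℝ} (hh : 0 < h) : h * x ∈ Set.Ioo 0 h ↔ x ∈ Set.Ioo (0:ℝ) 1 := by
  simp [Set.mem_Ioo, hh]

theorem integrableOn_Ioo_iff_unitVol {h : ℝ} (hh : 0 < h) {f : ℝ → ℝ} :
    IntegrableOn f (Set.Ioo 0 h) ↔ Integrable (fun x => f (h * x)) unitVol := by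
  have : (h • · : ℝ → ℝ) ⁻¹' Set.Ioo 0 h = Set.Ioo 0 1 := by
    ext x
    exact mul_mem_Ioo_iff hh
  rw [← integrableOn_comp_smul_iff measurableSet_Ioo hh.ne', this]
  rfl

theorem integral_Ioo_eq_unitVol {h : ℝ} (hh : 0 < h) (f : ℝ → ℝ) :
    ∫ x in Set.Ioo 0 h, f x = h * ∫ x, f (h * x) ∂unitVol := by
  have := intervalIntegral.smul_integral_comp_mul_left (a := 0) (b := 1) f h
  rw [mul_zero, mul_one, intervalIntegral.integral_of_le zero_le_one,
    intervalIntegral.integral_of_le hh.le, integral_Ioc_eq_integral_Ioo,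
    integral_Ioc_eq_integral_Ioo] at this
  exact this.symm

theorem gagHalfFinite_iff {h : ℝ} (hh : 0 < h) {φ : ℝ → ℝ} :
    gagHalfFinite h φ ↔ gagHalfFinite 1 (fun x => φ (h * x)) := by
  have hs : (h • · : ℝ × ℝ → ℝ × ℝ) ⁻¹' (Set.Ioo 0 h ×ˢ Set.Ioo 0 h)
      = Set.Ioo 0 1 ×ˢ Set.Ioo 0 1 := by
    ext q
    exact and_congr (mul_mem_Ioo_iff hh) (mul_mem_Ioo_iff hh)
  have hf : (fun q : ℝ × ℝ => (φ (h • q).1 - φ (h • q).2) ^ 2 / ((h • q).1 - (h • q).2) ^ 2)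
      = fun q => (h ^ 2)⁻¹ * ((φ (h * q.1) - φ (h * q.2)) ^ 2 / (q.1 - q.2) ^ 2) := by
    ext q
    simp only [Prod.smul_fst, Prod.smul_snd, smul_eq_mul, ← mul_sub, mul_pow]
    rw [div_mul_eq_div_div_swap, div_eq_inv_mul _ (h ^ 2)]
  rw [gagHalfFinite, gagHalfFinite,
    ← integrableOn_comp_smul_iff (measurableSet_Ioo.prod measurableSet_Ioo) hh.ne', hs, hf,
    IntegrableOn, integrable_const_mul_iff (by simp [hh.ne'])]
  rfl

theorem gagHalfSq_eq_comp_mul {h : ℝ} (hh : 0 < h) (φ : ℝ → ℝ) :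
    gagHalfSq h φ = gagHalfSq 1 (fun x => φ (h * x)) := by
  simp only [gagHalfSq]
  rw [integral_Ioo_eq_unitVol hh, ← integral_const_mul]
  congr 1
  ext x
  rw [integral_Ioo_eq_unitVol hh, ← integral_const_mul, ← integral_const_mul]
  congr 1
  ext y
  rw [← mul_sub, mul_pow]
  field_simp

theorem H1200Finite_iff {h : ℝ} (hh : 0 < h) {ψ : ℝ → ℝ} :
    H1200Finite h ψ ↔ H1200Finite 1 (fun x => ψ (h * x)) := by
  have e1 : (fun x => ψ (h * x) ^ 2 / (h * x)) = fun x => h⁻¹ * (ψ (h * x) ^ 2 / x) := by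
    ext x; rw [div_mul_eq_div_div_swap, div_eq_inv_mul _ h]
  have e2 : (fun x => ψ (h * x) ^ 2 / (h - h * x)) = fun x => h⁻¹ * (ψ (h * x) ^ 2 / (1 - x)) := by
    ext x; rw [← mul_one_sub, div_mul_eq_div_div_swap, div_eq_inv_mul _ h]
  rw [H1200Finite, H1200Finite, ← gagHalfFinite_iff hh, integrableOn_Ioo_iff_unitVol hh,
    integrableOn_Ioo_iff_unitVol hh, e1, e2, integrable_const_mul_iff (by simp [hh.ne']),
    integrable_const_mul_iff (by simp [hh.ne'])]
  rfl

theorem H1200NormSq_eq_comp_mul {h : ℝ} (hh : 0 < h) (ψ : ℝ → ℝ) :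
    H1200NormSq h ψ = H1200NormSq 1 (fun x => ψ (h * x)) := by
  rw [H1200NormSq, H1200NormSq, ← gagHalfSq_eq_comp_mul hh, integral_Ioo_eq_unitVol hh,
    integral_Ioo_eq_unitVol hh, ← integral_const_mul, ← integral_const_mul]
  congr 2
  · congr 2
    ext x
    field_simp
  · ext x
    rw [← mul_one_sub, ← div_div, mul_div_assoc']
    field_simp

theorem stmt_6 : ∃ C : ℝ, 0 < C ∧ ∀ k : ℕ, 2 ≤ k → ∀ h : ℝ, 0 < h →
    ∀ lam : Polynomial ℝ, lam.natDegree ≤ k → ∀ N : ℝ, 0 ≤ N →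
    (∀ ψ : ℝ → ℝ, Measurable ψ → H1200Finite h ψ →
      (∫ x in Set.Ioo (0:ℝ) h, lam.eval x * ψ x) ≤ N * Real.sqrt (H1200NormSq h ψ)) →
    |∫ x in Set.Ioo (0:ℝ) h, lam.eval x| ≤ C * Real.log k * N ∧
    ∀ φ : ℝ → ℝ, Measurable φ → IntegrableOn φ (Set.Ioo (0:ℝ) h) → gagHalfFinite h φ →
      (∫ x in Set.Ioo (0:ℝ) h, φ x) = 0 →
      (∫ x in Set.Ioo (0:ℝ) h, lam.eval x * φ x) ≤
        C * Real.log k * N * Real.sqrt (gagHalfSq h φ) := by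
  refine ⟨40000, by norm_num, ?_⟩
  intro k hk h hh lam hlam N hN hdual
  set p : Polynomial ℝ := Polynomial.C h * lam.comp (Polynomial.C h * Polynomial.X) with hp
  have hpe : ∀ x, p.eval x = h * lam.eval (h * x) := fun x => by simp [hp]
  have hpd : p.natDegree ≤ k := by
    refine (Polynomial.natDegree_C_mul_le _ _).trans (Polynomial.natDegree_comp_le.trans ?_)
    calc lam.natDegree * _ ≤ lam.natDegree * 1 :=
          Nat.mul_le_mul_left _ ((Polynomial.natDegree_C_mul_le _ _).trans Polynomial.natDegree_X_le)
      _ ≤ k := by simpa using hlam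
  have hint : ∀ φ : ℝ → ℝ, ∫ x in Set.Ioo (0:ℝ) h, lam.eval x * φ x
      = ∫ x, p.eval x * φ (h * x) ∂unitVol := by
    intro φ
    rw [integral_Ioo_eq_unitVol hh, ← integral_const_mul]
    simp only [hpe, mul_assoc]
  have hpN : ∀ ψ : ℝ → ℝ, Measurable ψ → H1200Finite 1 ψ →
      ∫ x, p.eval x * ψ x ∂unitVol ≤ N * √(H1200NormSq 1 ψ) := by
    intro ψ hψm hψ
    have hc : (fun x => ψ (h⁻¹ * (h * x))) = ψ := by
      ext x
      rw [inv_mul_cancel_left₀ hh.ne']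
    have := hdual (fun x => ψ (h⁻¹ * x)) (hψm.comp (measurable_const_mul _))
      ((H1200Finite_iff hh).2 (by rwa [hc]))
    rw [hint, H1200NormSq_eq_comp_mul hh, hc] at this
    simpa [inv_mul_cancel_left₀ hh.ne'] using this
  have hmain := fun φ => integral_eval_mul_le hk hpd hN hpN (φ := φ)
  have hlog : 0 ≤ Real.log k := Real.log_natCast_nonneg k
  have hlogN : 0 ≤ Real.log k * N := mul_nonneg hlog hN
  refine ⟨?_, fun φ hφm _ hφ hφ0 => ?_⟩
  · have hc : ∀ c : ℝ, |c| = 1 → c * ∫ x in Set.Ioo (0:ℝ) h, lam.eval x ≤ 20000 * Real.log k * N := by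
      intro c hc
      have hc2 : c ^ 2 = 1 := by rw [← sq_abs, hc, one_pow]
      have := hmain (fun _ => c) measurable_const (by simp [gagHalfFinite])
      rw [← hint fun _ => c, integral_mul_const, mul_comm] at this
      simpa [gagHalfSq, hc2] using this
    rw [abs_le]
    have h1 := hc 1 (by simp)
    have h2 := hc (-1) (by simp)
    constructor <;> linarith
  · have hm : Measurable fun x => φ (h * x) := hφm.comp (measurable_const_mul h)
    have hf := (gagHalfFinite_iff hh).1 hφ
    have h0 : ∫ x, φ (h * x) ∂unitVol = 0 := by
      rw [integral_Ioo_eq_unitVol hh] at hφ0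
      exact (mul_eq_zero.1 hφ0).resolve_left hh.ne'
    have hsq : √(gagHalfSq 1 (fun x => φ (h * x)) + ∫ x, φ (h * x) ^ 2 ∂unitVol)
        ≤ 2 * √(gagHalfSq h φ) := by
      rw [← gagHalfSq_eq_comp_mul hh]
      have hP := integral_sq_le_gagHalfSq hm hf h0
      rw [← gagHalfSq_eq_comp_mul hh] at hP
      refine Real.sqrt_le_iff.2 ⟨by positivity, ?_⟩
      rw [mul_pow, Real.sq_sqrt (gagHalfSq_nonneg h φ)]
      linarith [gagHalfSq_nonneg h φ]
    calc _ ≤ 20000 * Real.log k * N * (2 * √(gagHalfSq h φ)) := by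
          rw [hint]
          exact (hmain _ hm hf).trans (by gcongr)
      _ = _ := by ring
end

section
/- Let γ₀, γ₁ > 0. There exist constants c₁, c₂ > 0 depending only on γ₀ and γ₁ such that the following holds. Let K ⊆ ℝ² be a nonempty bounded open set with diameter d, star-shaped with respect to every point of a closed ball of radius γ₀ d contained in K; let τ ⊆ ∂K be a compact connected subset of the boundary with ℋ¹(τ) ≥ γ₁ d; and let u be a real-valued function that is continuously differentiable on a neighborhood of the closure of K. Then c₁ (|ū^τ|² + ∫_K |∇u|²) ≤ |ū^K|² + ∫_K |∇u|² ≤ c₂ (|ū^τ|² + ∫_K |∇u|²), where ū^τ = ℋ¹(τ)⁻¹ ∫_τ u dℋ¹ and ū^K = |K|⁻¹ ∫_K u. -/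
open MeasureTheory
open scoped ENNReal

section StarShaped

variable {V : Type*} [NormedAddCommGroup V] [NormedSpace ℝ V] {K : Set V} {y : V} {ρ : ℝ}

theorem mem_of_norm_sub_lineMap_lt (hK : ∀ p ∈ Metric.closedBall y ρ, StarConvex ℝ p K)
    {x p : V} (hx : x ∈ closure K) {t : ℝ} (ht0 : 0 ≤ t) (ht1 : t < 1)
    (hp : ‖p - (y + t • (x - y))‖ < (1 - t) * ρ) : p ∈ K := by
  obtain ⟨x', hx'K, hx'⟩ := Metric.mem_closure_iff.1 hx _ (sub_pos.2 hp)
  rw [dist_eq_norm] at hx'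
  have h1 : 0 < 1 - t := by linarith
  set q : V := (1 - t)⁻¹ • (p - t • x') with hq
  have hqy : q - y = (1 - t)⁻¹ • ((p - (y + t • (x - y))) + t • (x - x')) := by
    have : y = (1 - t)⁻¹ • ((1 - t) • y) := by rw [smul_smul, inv_mul_cancel₀ h1.ne', one_smul]
    rw [hq]
    nth_rewrite 1 [this]
    rw [← smul_sub]
    congr 1
    module
  have hqmem : q ∈ Metric.closedBall y ρ := by
    rw [mem_closedBall_iff_norm, hqy, norm_smul, norm_inv, Real.norm_of_nonneg h1.le,
      inv_mul_le_iff₀ h1]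
    refine (norm_add_le _ _).trans ?_
    rw [norm_smul, Real.norm_of_nonneg ht0]
    nlinarith [norm_nonneg (x - x')]
  have := hK q hqmem hx'K h1.le ht0 (by ring)
  rwa [hq, smul_smul, mul_inv_cancel₀ h1.ne', one_smul, sub_add_cancel] at this

theorem lineMap_mem_of_mem_closure (hK : ∀ p ∈ Metric.closedBall y ρ, StarConvex ℝ p K)
    (hρ : 0 < ρ) {x : V} (hx : x ∈ closure K) {t : ℝ} (ht0 : 0 ≤ t) (ht1 : t < 1) :
    y + t • (x - y) ∈ K :=
  mem_of_norm_sub_lineMap_lt hK hx ht0 ht1 (by simpa using mul_pos (sub_pos.2 ht1) hρ)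

/-- Boundary points of a star-shaped open set are at least the radius of the kernel ball away
from its centre. -/
theorem le_norm_sub_of_mem_frontier (hKo : IsOpen K)
    (hK : ∀ p ∈ Metric.closedBall y ρ, StarConvex ℝ p K) {x : V} (hx : x ∈ frontier K) :
    ρ ≤ ‖x - y‖ := by
  by_contra! h
  refine (hKo.frontier_eq ▸ hx).2 (mem_of_norm_sub_lineMap_lt hK hx.1 le_rfl one_pos ?_)
  simpa using h

theorem norm_sub_le_of_frontier_polar (hKo : IsOpen K) (hρ : 0 < ρ)
    (hK : ∀ p ∈ Metric.closedBall y ρ, StarConvex ℝ p K) {d R R' : ℝ} {a b : V}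
    (ha : ‖a‖ = 1) (hx : y + R • a ∈ frontier K) (hx' : y + R' • b ∈ frontier K)
    (hR' : 0 < R') (hRd : R ≤ d) (hR'R : R' ≤ R) :
    ‖(y + R • a) - (y + R' • b)‖ ≤ (d + d ^ 2 / ρ) * ‖a - b‖ := by
  have hR : 0 < R := hR'.trans_le hR'R
  have hab := norm_nonneg (a - b)
  have hd : 0 < d := hR.trans_le hRd
  have key : R - R' ≤ d ^ 2 / ρ * ‖a - b‖ := by
    rcases hR'R.eq_or_lt with h | h
    · rw [h, sub_self]; positivity
    have hnot : ¬ ‖(y + R' • b) - (y + (R' / R) • ((y + R • a) - y))‖ < (1 - R' / R) * ρ :=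
      fun hlt => (hKo.frontier_eq ▸ hx').2 (mem_of_norm_sub_lineMap_lt hK hx.1 (by positivity)
        (by rwa [div_lt_one hR]) hlt)
    have heq : (y + R' • b) - (y + (R' / R) • ((y + R • a) - y)) = -(R' • (a - b)) := by
      rw [add_sub_cancel_left, smul_smul, div_mul_cancel₀ _ hR.ne']
      module
    rw [heq, norm_neg, norm_smul, Real.norm_of_nonneg hR'.le, not_lt, one_sub_div hR.ne',
      div_mul_eq_mul_div, div_le_iff₀ hR] at hnot
    rw [div_mul_eq_mul_div, le_div_iff₀ hρ]
    refine hnot.trans ?_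
    have : R' * R ≤ d ^ 2 := by nlinarith
    nlinarith
  have heq : (y + R • a) - (y + R' • b) = R' • (a - b) + (R - R') • a := by module
  rw [heq]
  refine (norm_add_le _ _).trans ?_
  rw [norm_smul, norm_smul, ha, mul_one, Real.norm_of_nonneg hR'.le,
    Real.norm_of_nonneg (sub_nonneg.2 hR'R), add_mul]
  gcongr
  exact hR'R.trans hRd

end StarShaped

section Polar

open Complex in
theorem norm_exp_mul_I_sub_le (s t : ℝ) : ‖exp (s * I) - exp (t * I)‖ ≤ |s - t| := by
  have h : exp (s * I) - exp (t * I) = exp (t * I) * (exp (I * ((s - t : ℝ) : ℂ)) - 1) := by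
    rw [mul_sub, ← exp_add, mul_one]
    congr 2
    push_cast
    ring
  rw [h, norm_mul, norm_exp_ofReal_mul_I, one_mul]
  exact Real.norm_exp_I_mul_ofReal_sub_one_le

variable {V : Type*} [NormedAddCommGroup V] [InnerProductSpace ℝ V]

/-- The polar angle of `x` around `y`, with respect to an identification of the plane with `ℂ`. -/
noncomputable def polarAngle (e : ℂ ≃ₗᵢ[ℝ] V) (y x : V) : ℝ := Complex.arg (e.symm (x - y))

/-- The unit vector in direction `θ`. -/
noncomputable def unitDirection (e : ℂ ≃ₗᵢ[ℝ] V) (θ : ℝ) : V := e (Complex.exp (θ * Complex.I))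

variable (e : ℂ ≃ₗᵢ[ℝ] V)

theorem norm_unitDirection (θ : ℝ) : ‖unitDirection e θ‖ = 1 := by
  rw [unitDirection, LinearIsometryEquiv.norm_map, Complex.norm_exp_ofReal_mul_I]

theorem continuous_unitDirection : Continuous (unitDirection e) := by
  unfold unitDirection
  fun_prop

theorem add_norm_smul_unitDirection (x y : V) :
    y + ‖x - y‖ • unitDirection e (polarAngle e y x) = x := by
  have h : ‖x - y‖ • unitDirection e (polarAngle e y x) = x - y := by
    rw [unitDirection, polarAngle, ← map_smul, Complex.real_smul,
      ← LinearIsometryEquiv.norm_map e.symm (x - y), Complex.norm_mul_exp_arg_mul_I,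
      LinearIsometryEquiv.apply_symm_apply]
  rw [h, add_sub_cancel]

theorem measurable_polarAngle [MeasurableSpace V] [BorelSpace V] (y : V) :
    Measurable (polarAngle e y) :=
  Complex.measurable_arg.comp
    (e.symm.continuous.comp (continuous_id.sub continuous_const)).measurable

theorem polarAngle_mem_Ioc (x y : V) : polarAngle e y x ∈ Set.Ioc (-Real.pi) Real.pi :=
  Complex.arg_mem_Ioc _

variable {K : Set V} {y : V} {ρ d : ℝ}

theorem dist_le_mul_dist_polarAngle (hKo : IsOpen K) (hρ : 0 < ρ)
    (hK : ∀ p ∈ Metric.closedBall y ρ, StarConvex ℝ p K)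
    (hd : ∀ x ∈ closure K, ‖x - y‖ ≤ d) {x x' : V} (hx : x ∈ frontier K) (hx' : x' ∈ frontier K) :
    dist x x' ≤ (d + d ^ 2 / ρ) * dist (polarAngle e y x) (polarAngle e y x') := by
  wlog h : ‖x' - y‖ ≤ ‖x - y‖ generalizing x x'
  · rw [dist_comm x, dist_comm (polarAngle e y x)]
    exact this hx' hx (not_le.1 h).le
  have hR := hρ.trans_le (le_norm_sub_of_mem_frontier hKo hK hx')
  have hdx := hd x hx.1
  have hd0 : 0 ≤ d := (norm_nonneg _).trans hdx
  have := norm_sub_le_of_frontier_polar hKo hρ hK (norm_unitDirection e (polarAngle e y x))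
    (b := unitDirection e (polarAngle e y x')) (R := ‖x - y‖) (R' := ‖x' - y‖)
    (by rwa [add_norm_smul_unitDirection]) (by rwa [add_norm_smul_unitDirection]) hR hdx h
  rw [add_norm_smul_unitDirection, add_norm_smul_unitDirection] at this
  rw [dist_eq_norm, Real.dist_eq]
  refine this.trans ?_
  gcongr
  rw [unitDirection, unitDirection, ← map_sub, LinearIsometryEquiv.norm_map]
  exact norm_exp_mul_I_sub_le _ _

variable [MeasurableSpace V] [BorelSpace V]

theorem map_polarAngle_hausdorffMeasure_le (hKo : IsOpen K) (hρ : 0 < ρ)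
    (hK : ∀ p ∈ Metric.closedBall y ρ, StarConvex ℝ p K)
    (hd : ∀ x ∈ closure K, ‖x - y‖ ≤ d) :
    (Measure.map (polarAngle e y) ((Measure.hausdorffMeasure 1).restrict (frontier K))) ≤
      ENNReal.ofReal (d + d ^ 2 / ρ) • volume.restrict (Set.Ioc (-Real.pi) Real.pi) := by
  refine Measure.le_iff.2 fun S hS => ?_
  have hm := measurable_polarAngle e y
  rw [Measure.map_apply hm hS, Measure.restrict_apply (hm hS), Measure.smul_apply,
    Measure.restrict_apply hS, smul_eq_mul]
  set T := polarAngle e y ⁻¹' S ∩ frontier K with hT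
  rcases T.eq_empty_or_nonempty with hTe | ⟨x₀, hx₀⟩
  · simp [hTe]
  have hd0 : 0 ≤ d := (norm_nonneg _).trans (hd x₀ hx₀.2.1)
  have hC : 0 ≤ d + d ^ 2 / ρ := by positivity
  have hinj : Set.InjOn (polarAngle e y) T := fun x hx x' hx' h => by
    have := dist_le_mul_dist_polarAngle e hKo hρ hK hd hx.2 hx'.2
    rw [h, dist_self, mul_zero] at this
    exact dist_le_zero.1 this
  have : Nonempty V := ⟨y⟩
  have hleft := hinj.leftInvOn_invFunOn
  set g := Function.invFunOn (polarAngle e y) T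
  have himg : g '' (polarAngle e y '' T) = T := hleft.image_image
  have hlip : LipschitzOnWith (Real.toNNReal (d + d ^ 2 / ρ)) g (polarAngle e y '' T) := by
    refine LipschitzOnWith.of_dist_le_mul ?_
    rintro _ ⟨x, hx, rfl⟩ _ ⟨x', hx', rfl⟩
    rw [hleft hx, hleft hx', Real.coe_toNNReal _ hC]
    exact dist_le_mul_dist_polarAngle e hKo hρ hK hd hx.2 hx'.2
  have h := hlip.hausdorffMeasure_image_le zero_le_one
  rw [himg, ENNReal.rpow_one, hausdorffMeasure_real] at h
  refine h.trans ?_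
  change ENNReal.ofReal _ * _ ≤ _
  gcongr
  rintro _ ⟨x, hx, rfl⟩
  exact ⟨hx.1, polarAngle_mem_Ioc e x y⟩

theorem hausdorffMeasure_frontier_lt_top (e : ℂ ≃ₗᵢ[ℝ] V) (hKo : IsOpen K) (hρ : 0 < ρ)
    (hK : ∀ p ∈ Metric.closedBall y ρ, StarConvex ℝ p K)
    (hd : ∀ x ∈ closure K, ‖x - y‖ ≤ d) : (Measure.hausdorffMeasure 1) (frontier K) < ⊤ := by
  have h := map_polarAngle_hausdorffMeasure_le e hKo hρ hK hd Set.univ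
  rw [Measure.map_apply (measurable_polarAngle e y) MeasurableSet.univ, Set.preimage_univ,
    Measure.restrict_apply_univ] at h
  refine h.trans_lt ?_
  simp only [Measure.smul_apply, Measure.restrict_apply_univ, Real.volume_Ioc, smul_eq_mul]
  exact ENNReal.mul_lt_top ENNReal.ofReal_lt_top ENNReal.ofReal_lt_top

theorem lintegral_unitDirection_le [FiniteDimensional ℝ V] (hρ : 0 < ρ) {g : V → ℝ≥0∞}
    (hg : Measurable g) (y : V) :
    ∫⁻ θ in Set.Ioc (-Real.pi) Real.pi, ∫⁻ r in Set.Ioi ρ, g (y + r • unitDirection e θ) ≤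
      ENNReal.ofReal ρ⁻¹ * ∫⁻ x, g x := by
  have hmeas : Measurable fun p : ℝ × ℝ => g (y + p.1 • unitDirection e p.2) := by
    refine hg.comp (Continuous.measurable ?_)
    exact continuous_const.add (continuous_fst.smul
      ((continuous_unitDirection e).comp continuous_snd))
  have hpolar : ∫⁻ p in Set.Ioi (0 : ℝ) ×ˢ Set.Ioo (-Real.pi) Real.pi,
      ENNReal.ofReal p.1 * g (y + p.1 • unitDirection e p.2) = ∫⁻ x, g x := by
    have h1 : ∫⁻ x, g x = ∫⁻ z : ℂ, g (y + e z) := by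
      rw [← lintegral_add_left_eq_self g y]
      exact (e.measurePreserving.lintegral_comp_emb
        e.toHomeomorph.measurableEmbedding (fun x => g (y + x))).symm
    rw [h1, ← Complex.lintegral_comp_polarCoord_symm, polarCoord_target]
    refine lintegral_congr fun p => ?_
    rw [smul_eq_mul, Complex.polarCoord_symm_apply, unitDirection, ← map_smul, Complex.real_smul,
      Complex.exp_mul_I, Complex.ofReal_cos, Complex.ofReal_sin]
  have hsec (r : ℝ) : Measurable fun θ => g (y + r • unitDirection e θ) :=
    hmeas.comp measurable_prodMk_left
  have hmeas' : Measurable fun p : ℝ × ℝ =>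
      ENNReal.ofReal p.1 * g (y + p.1 • unitDirection e p.2) :=
    (ENNReal.measurable_ofReal.comp measurable_fst).mul hmeas
  have hpos : ∀ r ∈ Set.Ioi ρ, ∀ a : ℝ≥0∞, a ≤ ENNReal.ofReal ρ⁻¹ * (ENNReal.ofReal r * a) := by
    intro r hr a
    rw [← mul_assoc, ← ENNReal.ofReal_mul (inv_nonneg.2 hρ.le)]
    refine le_mul_of_one_le_left zero_le ?_
    rw [ENNReal.one_le_ofReal, ← div_eq_inv_mul, one_le_div hρ]
    exact (show ρ < r from hr).le
  calc _ = ∫⁻ θ in Set.Ioo (-Real.pi) Real.pi, ∫⁻ r in Set.Ioi ρ,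
        g (y + r • unitDirection e θ) := setLIntegral_congr Ioo_ae_eq_Ioc.symm
    _ = ∫⁻ r in Set.Ioi ρ, ∫⁻ θ in Set.Ioo (-Real.pi) Real.pi,
        g (y + r • unitDirection e θ) :=
      lintegral_lintegral_swap (hmeas.comp measurable_swap).aemeasurable
    _ ≤ ∫⁻ r in Set.Ioi ρ, ENNReal.ofReal ρ⁻¹ * ∫⁻ θ in Set.Ioo (-Real.pi) Real.pi,
        ENNReal.ofReal r * g (y + r • unitDirection e θ) := by
      refine setLIntegral_mono (hmeas'.lintegral_prod_right'.const_mul _) fun r hr => ?_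
      rw [lintegral_const_mul _ (hsec r)]
      exact hpos r hr _
    _ = ENNReal.ofReal ρ⁻¹ * ∫⁻ r in Set.Ioi ρ, ∫⁻ θ in Set.Ioo (-Real.pi) Real.pi,
        ENNReal.ofReal r * g (y + r • unitDirection e θ) :=
      lintegral_const_mul _ hmeas'.lintegral_prod_right'
    _ ≤ ENNReal.ofReal ρ⁻¹ * ∫⁻ r in Set.Ioi (0 : ℝ), ∫⁻ θ in Set.Ioo (-Real.pi) Real.pi,
        ENNReal.ofReal r * g (y + r • unitDirection e θ) := by
      gcongr
    _ = _ := by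
      rw [← hpolar, Measure.volume_eq_prod, setLIntegral_prod _ hmeas'.aemeasurable]

/-- Radial integration from an interior point of the kernel over the outer half of a star-shaped
planar set is controlled by area integration. -/
theorem lintegral_frontier_lineMap_le (e : ℂ ≃ₗᵢ[ℝ] V) [FiniteDimensional ℝ V] (hKo : IsOpen K) (hρ : 0 < ρ)
    (hK : ∀ p ∈ Metric.closedBall y ρ, StarConvex ℝ p K)
    (hd : ∀ x ∈ closure K, ‖x - y‖ ≤ d) {f : V → ℝ≥0∞} (hf : Measurable f) :
    ∫⁻ x in frontier K, (∫⁻ t in Set.Ioo (1 / 2 : ℝ) 1, f (y + t • (x - y)))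
        ∂(Measure.hausdorffMeasure 1 : Measure V) ≤
      ENNReal.ofReal ρ⁻¹ * (ENNReal.ofReal (d + d ^ 2 / ρ) *
        (ENNReal.ofReal (ρ / 2)⁻¹ * ∫⁻ x in K, f x)) := by
  set g := K.indicator f
  have hg : Measurable g := hf.indicator hKo.measurableSet
  set H : ℝ → ℝ≥0∞ := fun θ => ∫⁻ r in Set.Ioi (ρ / 2), g (y + r • unitDirection e θ)
  have hHm : Measurable H := by
    have : Measurable fun p : ℝ × ℝ => g (y + p.2 • unitDirection e p.1) :=
      hg.comp (continuous_const.add (continuous_snd.smul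
        ((continuous_unitDirection e).comp continuous_fst))).measurable
    exact this.lintegral_prod_right'
  have hinner : ∀ x ∈ frontier K, ∫⁻ t in Set.Ioo (1 / 2 : ℝ) 1, f (y + t • (x - y)) ≤
      ENNReal.ofReal ρ⁻¹ * H (polarAngle e y x) := by
    intro x hx
    have hRρ := le_norm_sub_of_mem_frontier hKo hK hx
    have hR := hρ.trans_le hRρ
    set R := ‖x - y‖
    set v := unitDirection e (polarAngle e y x)
    have hxy : x - y = R • v := by
      rw [eq_comm, ← add_right_inj y, add_norm_smul_unitDirection, add_sub_cancel]
    set G : ℝ → ℝ≥0∞ := (Set.Ioi (ρ / 2)).indicator fun r => g (y + r • v)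
    have hG : Measurable G := (by fun_prop : Measurable fun r : ℝ => g (y + r • v)).indicator
      measurableSet_Ioi
    calc ∫⁻ t in Set.Ioo (1 / 2 : ℝ) 1, f (y + t • (x - y))
        ≤ ∫⁻ t in Set.Ioo (1 / 2 : ℝ) 1, G (R * t) := by
          refine setLIntegral_mono (by fun_prop) fun t ht => ?_
          have h1 : R * t ∈ Set.Ioi (ρ / 2) := by
            have := ht.1
            simp only [Set.mem_Ioi]
            nlinarith
          have h2 : y + (R * t) • v = y + t • (x - y) := by rw [hxy, smul_smul, mul_comm]
          have h3 : y + t • (x - y) ∈ K :=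
            lineMap_mem_of_mem_closure hK hρ hx.1 (by linarith [ht.1]) ht.2
          simp only [G, g]
          rw [Set.indicator_of_mem h1, h2, Set.indicator_of_mem h3]
      _ ≤ ∫⁻ t, G (R * t) := setLIntegral_le_lintegral _ _
      _ = ENNReal.ofReal |R⁻¹| * ∫⁻ r, G r := by
          rw [← lintegral_map hG (measurable_const_mul R), Real.map_volume_mul_left hR.ne',
            lintegral_smul_measure, smul_eq_mul]
      _ ≤ ENNReal.ofReal ρ⁻¹ * H (polarAngle e y x) := by
          rw [abs_of_pos (inv_pos.2 hR), lintegral_indicator measurableSet_Ioi]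
          gcongr
  calc _ ≤ ∫⁻ x in frontier K, ENNReal.ofReal ρ⁻¹ * H (polarAngle e y x)
          ∂(Measure.hausdorffMeasure 1 : Measure V) :=
        setLIntegral_mono ((hHm.comp (measurable_polarAngle e y)).const_mul _) hinner
    _ = ENNReal.ofReal ρ⁻¹ * ∫⁻ θ, H θ ∂(Measure.map (polarAngle e y)
          ((Measure.hausdorffMeasure 1 : Measure V).restrict (frontier K))) := by
        rw [lintegral_map hHm (measurable_polarAngle e y),
          lintegral_const_mul (f := fun x => H (polarAngle e y x)) _
            (hHm.comp (measurable_polarAngle e y))]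
    _ ≤ ENNReal.ofReal ρ⁻¹ * (ENNReal.ofReal (d + d ^ 2 / ρ) *
          ∫⁻ θ in Set.Ioc (-Real.pi) Real.pi, H θ) := by
        gcongr
        refine (lintegral_mono' (map_polarAngle_hausdorffMeasure_le e hKo hρ hK hd) le_rfl).trans ?_
        rw [lintegral_smul_measure, smul_eq_mul]
    _ ≤ _ := by
        gcongr
        refine (lintegral_unitDirection_le e (half_pos hρ) hg y).trans ?_
        rw [lintegral_indicator hKo.measurableSet]

end Polar

section Poincare

theorem enorm_sub_le_lintegral_enorm_fderiv {V : Type*} [NormedAddCommGroup V] [NormedSpace ℝ V]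
    {U : Set V} (hU : IsOpen U) {u : V → ℝ} (hu : ContDiffOn ℝ 1 u U) {x y : V}
    (hseg : ∀ t ∈ Set.Icc (0 : ℝ) 1, y + t • (x - y) ∈ U) {D : ℝ} (hD : ‖x - y‖ ≤ D) :
    ‖u x - u y‖ₑ ≤ ENNReal.ofReal D *
      ∫⁻ t in Set.Ioo (0 : ℝ) 1, ‖fderiv ℝ u (y + t • (x - y))‖ₑ := by
  have hline : ∀ t : ℝ, HasDerivAt (fun t : ℝ => y + t • (x - y)) (x - y) t := fun t => by
    simpa using ((hasDerivAt_id t).smul_const (x - y)).const_add y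
  have hderiv : ∀ t ∈ Set.uIcc (0 : ℝ) 1, HasDerivAt (fun t : ℝ => u (y + t • (x - y)))
      (fderiv ℝ u (y + t • (x - y)) (x - y)) t := fun t ht => by
    rw [Set.uIcc_of_le zero_le_one] at ht
    have := (hu.differentiableOn one_ne_zero).differentiableAt (hU.mem_nhds (hseg t ht))
    exact this.hasFDerivAt.comp_hasDerivAt t (hline t)
  have hcont : ContinuousOn (fun t : ℝ => fderiv ℝ u (y + t • (x - y)) (x - y))
      (Set.uIcc 0 1) := by
    rw [Set.uIcc_of_le zero_le_one]
    refine ContinuousOn.clm_apply ?_ continuousOn_const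
    exact (hu.continuousOn_fderiv_of_isOpen hU le_rfl).comp (by fun_prop) hseg
  have h := intervalIntegral.integral_eq_sub_of_hasDerivAt hderiv hcont.intervalIntegrable
  simp only [one_smul, add_sub_cancel, zero_smul, add_zero] at h
  rw [← h, intervalIntegral.integral_of_le zero_le_one]
  refine (enorm_integral_le_lintegral_enorm _).trans ?_
  rw [setLIntegral_congr Ioo_ae_eq_Ioc.symm, ← lintegral_const_mul' _ _ ENNReal.ofReal_ne_top]
  refine lintegral_mono fun t => ?_
  rw [mul_comm]
  refine (ContinuousLinearMap.le_opENorm _ _).trans ?_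
  gcongr
  rw [← ofReal_norm]
  exact ENNReal.ofReal_le_ofReal hD

theorem lintegral_comp_add_smul_le {V : Type*} [NormedAddCommGroup V] [NormedSpace ℝ V]
    [MeasurableSpace V] [BorelSpace V] [FiniteDimensional ℝ V] (μ : Measure V)
    [μ.IsAddHaarMeasure] (hV : Module.finrank ℝ V = 2) {f : V → ℝ≥0∞}
    (hf : Measurable f) {s : ℝ} (hs : 1 / 2 ≤ s) (a : V) :
    ∫⁻ x, f (a + s • x) ∂μ ≤ 4 * ∫⁻ x, f x ∂μ := by
  have hs0 : 0 < s := by linarith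
  have h1 : ∫⁻ x, f (a + s • x) ∂μ = ∫⁻ z, f (a + z) ∂(Measure.map (s • ·) μ) :=
    (lintegral_map (f := fun z => f (a + z)) (by fun_prop) (measurable_const_smul s)).symm
  rw [h1, Measure.map_addHaar_smul μ hs0.ne', lintegral_smul_measure,
    lintegral_add_left_eq_self f a, hV, smul_eq_mul]
  gcongr
  rw [show (4 : ℝ≥0∞) = ENNReal.ofReal 4 by norm_num]
  refine ENNReal.ofReal_le_ofReal ?_
  rw [abs_of_pos (by positivity), inv_le_comm₀ (by positivity) (by norm_num)]
  nlinarith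

variable {V : Type*} [NormedAddCommGroup V] [InnerProductSpace ℝ V] [MeasurableSpace V]
  [BorelSpace V] [FiniteDimensional ℝ V] {K B : Set V} {D : ℝ}

/-- If the outer halves of the segments issued from `B` push the measure `ν` to something
controlled by area, then oscillations between `ν` and `B` are controlled by the gradient. -/
theorem lintegral_lintegral_enorm_sub_le (hV : Module.finrank ℝ V = 2) (hKo : IsOpen K)
    (hseg : ∀ y ∈ B, ∀ x ∈ closure K, ∀ t ∈ Set.Ico (0 : ℝ) 1, y + t • (x - y) ∈ K)
    (hD : ∀ y ∈ B, ∀ x ∈ closure K, ‖x - y‖ ≤ D)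
    {ν : Measure V} [SFinite ν] (hν : ∀ᵐ x ∂ν, x ∈ closure K) {M : ℝ≥0∞}
    (hM : ∀ y ∈ B, ∀ f : V → ℝ≥0∞, Measurable f →
      ∫⁻ x, (∫⁻ t in Set.Ioo (1 / 2 : ℝ) 1, f (y + t • (x - y))) ∂ν ≤ M * ∫⁻ x in K, f x)
    {U : Set V} (hU : IsOpen U) (hKU : closure K ⊆ U) {u : V → ℝ} (hu : ContDiffOn ℝ 1 u U) :
    ∫⁻ x, (∫⁻ y in B, ‖u x - u y‖ₑ) ∂ν ≤
      ENNReal.ofReal D * ((4 * ν Set.univ + M * volume B) * ∫⁻ x in K, ‖fderiv ℝ u x‖ₑ) := by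
  set f : V → ℝ≥0∞ := fun x => ‖fderiv ℝ u x‖ₑ
  have hf : Measurable f := (measurable_fderiv ℝ u).enorm
  set G := ∫⁻ x in K, f x
  have hm : Measurable fun p : (V × V) × ℝ => f (p.1.2 + p.2 • (p.1.1 - p.1.2)) :=
    hf.comp (by fun_prop)
  set A : Set ℝ → V → V → ℝ≥0∞ := fun S x y => ∫⁻ t in S, f (y + t • (x - y))
  have hA (S : Set ℝ) : Measurable fun p : V × V => A S p.1 p.2 := hm.lintegral_prod_right'
  have hnear : ∀ x ∈ closure K, ∫⁻ y in B, A (Set.Ioc 0 (1 / 2)) x y ≤ 4 * G := by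
    intro x hx
    have hmx : Measurable fun p : V × ℝ => f (p.1 + p.2 • (x - p.1)) := hf.comp (by fun_prop)
    calc ∫⁻ y in B, A (Set.Ioc 0 (1 / 2)) x y
        = ∫⁻ t in Set.Ioc (0 : ℝ) (1 / 2), ∫⁻ y in B, f (y + t • (x - y)) :=
          lintegral_lintegral_swap hmx.aemeasurable
      _ ≤ ∫⁻ t in Set.Ioc (0 : ℝ) (1 / 2), 4 * G := by
          refine setLIntegral_mono measurable_const fun t ht => ?_
          have hind : ∫⁻ y in B, f (y + t • (x - y)) ≤
              ∫⁻ y in B, K.indicator f (t • x + (1 - t) • y) := by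
            refine setLIntegral_mono ((hf.indicator hKo.measurableSet).comp (by fun_prop))
              fun y hy => ?_
            have := hseg y hy x hx t ⟨ht.1.le, by linarith [ht.2]⟩
            rw [show t • x + (1 - t) • y = y + t • (x - y) by module, Set.indicator_of_mem this]
          refine hind.trans ((setLIntegral_le_lintegral _ _).trans ?_)
          refine (lintegral_comp_add_smul_le volume hV (hf.indicator hKo.measurableSet)
            (by linarith [ht.2]) _).trans ?_
          rw [lintegral_indicator hKo.measurableSet]
      _ ≤ 4 * G := by
          rw [setLIntegral_const, Real.volume_Ioc]
          refine mul_le_of_le_one_right zero_le ?_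
          rw [ENNReal.ofReal_le_one]
          norm_num
  have hsplit : ∀ x y, A (Set.Ioo 0 1) x y ≤
      A (Set.Ioc 0 (1 / 2)) x y + A (Set.Ioo (1 / 2) 1) x y := fun x y => by
    refine le_trans (lintegral_mono_set ?_) (lintegral_union_le _ _ _)
    intro t ht
    rcases le_or_gt t (1 / 2) with h | h
    exacts [Or.inl ⟨ht.1, h⟩, Or.inr ⟨h, ht.2⟩]
  have hpt : ∀ x ∈ closure K, ∫⁻ y in B, ‖u x - u y‖ₑ ≤
      ENNReal.ofReal D * (4 * G + ∫⁻ y in B, A (Set.Ioo (1 / 2) 1) x y) := by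
    intro x hx
    have hAx (S : Set ℝ) : Measurable fun y => A S x y :=
      Measurable.of_uncurry_left (f := A S) (hA S)
    calc ∫⁻ y in B, ‖u x - u y‖ₑ
        ≤ ∫⁻ y in B, ENNReal.ofReal D *
            (A (Set.Ioc 0 (1 / 2)) x y + A (Set.Ioo (1 / 2) 1) x y) := by
          refine setLIntegral_mono (((hAx _).add (hAx _)).const_mul _) fun y hy => ?_
          refine (enorm_sub_le_lintegral_enorm_fderiv hU hu (fun t ht => ?_) (hD y hy x hx)).trans
            (mul_le_mul_right (hsplit x y) _)
          rcases ht.2.eq_or_lt with h | h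
          · rw [h, one_smul, add_sub_cancel]
            exact hKU hx
          · exact hKU (subset_closure (hseg y hy x hx t ⟨ht.1, h⟩))
      _ = ENNReal.ofReal D * ((∫⁻ y in B, A (Set.Ioc 0 (1 / 2)) x y) +
            ∫⁻ y in B, A (Set.Ioo (1 / 2) 1) x y) := by
          rw [lintegral_const_mul' _ _ ENNReal.ofReal_ne_top, lintegral_add_left (hAx _)]
      _ ≤ _ := by
          gcongr
          exact hnear x hx
  have hAint : Measurable fun x => ∫⁻ y in B, A (Set.Ioo (1 / 2) 1) x y :=
    (hA _).lintegral_prod_right'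
  calc ∫⁻ x, (∫⁻ y in B, ‖u x - u y‖ₑ) ∂ν
      ≤ ∫⁻ x, ENNReal.ofReal D * (4 * G + ∫⁻ y in B, A (Set.Ioo (1 / 2) 1) x y) ∂ν :=
        lintegral_mono_ae (hν.mono hpt)
    _ = ENNReal.ofReal D * (4 * G * ν Set.univ +
          ∫⁻ x, (∫⁻ y in B, A (Set.Ioo (1 / 2) 1) x y) ∂ν) := by
        rw [lintegral_const_mul' _ _ ENNReal.ofReal_ne_top, lintegral_add_left measurable_const,
          lintegral_const]
    _ = ENNReal.ofReal D * (4 * G * ν Set.univ +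
          ∫⁻ y in B, (∫⁻ x, A (Set.Ioo (1 / 2) 1) x y ∂ν)) := by
        rw [lintegral_lintegral_swap (hA _).aemeasurable]
    _ ≤ ENNReal.ofReal D * (4 * G * ν Set.univ + ∫⁻ y in B, M * G) := by
        gcongr ENNReal.ofReal D * (_ + ?_)
        exact setLIntegral_mono measurable_const fun y hy => hM y hy f hf
    _ = _ := by
        rw [setLIntegral_const]
        ring

/-- The measure `ν` and the planar set `B` have close averages of `u`. -/
theorem abs_average_sub_average_le (hV : Module.finrank ℝ V = 2) (hKo : IsOpen K)
    (hKb : Bornology.IsBounded K) (hBK : B ⊆ K) (hB0 : volume B ≠ 0)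
    (hD0 : 0 ≤ D)
    (hseg : ∀ y ∈ B, ∀ x ∈ closure K, ∀ t ∈ Set.Ico (0 : ℝ) 1, y + t • (x - y) ∈ K)
    (hD : ∀ y ∈ B, ∀ x ∈ closure K, ‖x - y‖ ≤ D)
    {ν : Measure V} [IsFiniteMeasure ν] [NeZero ν] (hν : ∀ᵐ x ∂ν, x ∈ closure K) {M : ℝ}
    (hM0 : 0 ≤ M) (hM : ∀ y ∈ B, ∀ f : V → ℝ≥0∞, Measurable f →
      ∫⁻ x, (∫⁻ t in Set.Ioo (1 / 2 : ℝ) 1, f (y + t • (x - y))) ∂ν ≤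
        ENNReal.ofReal M * ∫⁻ x in K, f x)
    {U : Set V} (hU : IsOpen U) (hKU : closure K ⊆ U) {u : V → ℝ} (hu : ContDiffOn ℝ 1 u U) :
    |(ν.real Set.univ)⁻¹ * (∫ x, u x ∂ν) - (volume.real B)⁻¹ * ∫ y in B, u y| ≤
      D * (4 / volume.real B + M / ν.real Set.univ) * ∫ x in K, ‖fderiv ℝ u x‖ := by
  have hcomp : IsCompact (closure K) := hKb.isCompact_closure
  have huK : ContinuousOn u (closure K) := hu.continuousOn.mono hKU
  have hfK : ContinuousOn (fderiv ℝ u) (closure K) :=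
    (hu.continuousOn_fderiv_of_isOpen hU le_rfl).mono hKU
  have hνeq : ν.restrict (closure K) = ν := Measure.restrict_eq_self_of_ae_mem hν
  have huν : Integrable u ν := by
    rw [← hνeq]
    exact huK.integrableOn_compact hcomp
  have huB : IntegrableOn u B :=
    (huK.integrableOn_compact hcomp).mono_set (hBK.trans subset_closure)
  have hfint : IntegrableOn (fun x => ‖fderiv ℝ u x‖) K :=
    (hfK.norm.integrableOn_compact hcomp).mono_set subset_closure
  have hBtop : volume B ≠ ⊤ := ((measure_mono hBK).trans_lt hKb.measure_lt_top).ne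
  have : IsFiniteMeasure (volume.restrict B) := isFiniteMeasure_restrict.2 hBtop
  have hbpos : 0 < volume.real B := ENNReal.toReal_pos hB0 hBtop
  have hnpos : 0 < ν.real Set.univ := measureReal_univ_pos
  set b := volume.real B
  set n := ν.real Set.univ
  set G := ∫ x in K, ‖fderiv ℝ u x‖
  have hG0 : 0 ≤ G := integral_nonneg fun _ => norm_nonneg _
  have hGe : ∫⁻ x in K, ‖fderiv ℝ u x‖ₑ = ENNReal.ofReal G := by
    rw [ofReal_integral_eq_lintegral_ofReal hfint (ae_of_all _ fun _ => norm_nonneg _)]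
    simp only [ofReal_norm]
  have hdouble : ∫ x, (∫ y in B, (u x - u y)) ∂ν = b * (∫ x, u x ∂ν) - n * ∫ y in B, u y := by
    have h1 : ∀ x, ∫ y in B, (u x - u y) = b * u x - ∫ y in B, u y := fun x => by
      rw [integral_sub (integrable_const _) huB, integral_const, measureReal_restrict_apply_univ,
        smul_eq_mul]
    simp_rw [h1]
    rw [integral_sub (huν.const_mul _) (integrable_const _), integral_const_mul, integral_const,
      smul_eq_mul]
  have hosc := lintegral_lintegral_enorm_sub_le hV hKo hseg hD hν hM hU hKU hu
  have hle : ‖∫ x, (∫ y in B, (u x - u y)) ∂ν‖ₑ ≤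
      ENNReal.ofReal (D * ((4 * n + M * b) * G)) := by
    refine (enorm_integral_le_lintegral_enorm _).trans
      ((lintegral_mono fun x => enorm_integral_le_lintegral_enorm _).trans (hosc.trans_eq ?_))
    rw [hGe, ENNReal.ofReal_mul hD0, ENNReal.ofReal_mul (by positivity),
      ENNReal.ofReal_add (by positivity) (by positivity), ENNReal.ofReal_mul (by norm_num),
      ENNReal.ofReal_mul hM0, ofReal_measureReal, ofReal_measureReal hBtop]
    norm_num
  rw [hdouble, ← ofReal_norm, ENNReal.ofReal_le_ofReal_iff (by positivity),
    Real.norm_eq_abs] at hle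
  have heq : n⁻¹ * (∫ x, u x ∂ν) - b⁻¹ * ∫ y in B, u y =
      (n * b)⁻¹ * (b * (∫ x, u x ∂ν) - n * ∫ y in B, u y) := by
    field_simp
  rw [heq, abs_mul, abs_of_pos (by positivity : 0 < (n * b)⁻¹)]
  calc _ ≤ (n * b)⁻¹ * (D * ((4 * n + M * b) * G)) := by gcongr
    _ = _ := by field_simp

theorem lintegral_lineMap_le_four_mul (hV : Module.finrank ℝ V = 2) (hKo : IsOpen K) {y : V}
    (hseg : ∀ x ∈ closure K, ∀ t ∈ Set.Ico (0 : ℝ) 1, y + t • (x - y) ∈ K)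
    {f : V → ℝ≥0∞} (hf : Measurable f) :
    ∫⁻ x in K, ∫⁻ t in Set.Ioo (1 / 2 : ℝ) 1, f (y + t • (x - y)) ≤ 4 * ∫⁻ x in K, f x := by
  have hm : Measurable fun p : V × ℝ => f (y + p.2 • (p.1 - y)) := hf.comp (by fun_prop)
  rw [lintegral_lintegral_swap hm.aemeasurable]
  calc _ ≤ ∫⁻ t in Set.Ioo (1 / 2 : ℝ) 1, 4 * ∫⁻ x in K, f x := by
        refine setLIntegral_mono measurable_const fun t ht => ?_
        have hfK := hf.indicator hKo.measurableSet
        calc ∫⁻ x in K, f (y + t • (x - y))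
            ≤ ∫⁻ x in K, K.indicator f ((1 - t) • y + t • x) := by
              refine setLIntegral_mono (hfK.comp (by fun_prop)) fun x hx => ?_
              have := hseg x (subset_closure hx) t ⟨by linarith [ht.1], ht.2⟩
              rw [show (1 - t) • y + t • x = y + t • (x - y) by module, Set.indicator_of_mem this]
          _ ≤ ∫⁻ x, K.indicator f ((1 - t) • y + t • x) := setLIntegral_le_lintegral _ _
          _ ≤ 4 * ∫⁻ x, K.indicator f x := lintegral_comp_add_smul_le volume hV hfK ht.1.le _
          _ = _ := by rw [lintegral_indicator hKo.measurableSet]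
    _ ≤ _ := by
        rw [setLIntegral_const, Real.volume_Ioo]
        refine mul_le_of_le_one_right zero_le ?_
        rw [ENNReal.ofReal_le_one]
        norm_num

theorem sq_integral_le_measureReal_mul {α : Type*} [MeasurableSpace α] {μ : Measure α}
    [IsFiniteMeasure μ] {F : α → ℝ} (hF : Integrable F μ) (hF2 : Integrable (fun x => F x ^ 2) μ) :
    (∫ x, F x ∂μ) ^ 2 ≤ μ.real Set.univ * ∫ x, F x ^ 2 ∂μ := by
  rcases eq_zero_or_neZero μ with rfl | hμ
  · simp
  have hpos : 0 < μ.real Set.univ := measureReal_univ_pos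
  set v := μ.real Set.univ
  set G := ∫ x, F x ∂μ
  have h : ∫ x, (v * F x - G) ^ 2 ∂μ = v * (v * (∫ x, F x ^ 2 ∂μ) - G ^ 2) := by
    have h1 : ∀ x, (v * F x - G) ^ 2 = v ^ 2 * F x ^ 2 - 2 * v * G * F x + G ^ 2 := fun x => by
      ring
    simp_rw [h1]
    rw [integral_add (f := fun x => v ^ 2 * F x ^ 2 - 2 * v * G * F x)
        ((hF2.const_mul _).sub (hF.const_mul _)) (integrable_const _),
      integral_sub (hF2.const_mul _) (hF.const_mul _), integral_const_mul, integral_const_mul,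
      integral_const, smul_eq_mul]
    ring
  have h0 : 0 ≤ ∫ x, (v * F x - G) ^ 2 ∂μ := integral_nonneg fun _ => sq_nonneg _
  rw [h] at h0
  linarith [nonneg_of_mul_nonneg_right h0 hpos]

end Poincare

theorem comparison_of_abs_sub_le {X Y Z W G d a b p : ℝ} (hd : 0 < d) (hp : 0 ≤ p) (hW : 0 ≤ W)
    (hX : |X - Z| ≤ a / d * G) (hY : |Y - Z| ≤ b / d * G) (hG : G ^ 2 ≤ p * d ^ 2 * W) :
    (2 + 2 * ((a + b) ^ 2 * p))⁻¹ * (X ^ 2 + W) ≤ Y ^ 2 + W ∧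
      Y ^ 2 + W ≤ (2 + 2 * ((a + b) ^ 2 * p)) * (X ^ 2 + W) := by
  have hXY : |X - Y| ≤ (a + b) / d * G := by
    calc |X - Y| ≤ |X - Z| + |Z - Y| := abs_sub_le _ _ _
      _ ≤ a / d * G + b / d * G := by rw [abs_sub_comm Z]; gcongr
      _ = _ := by ring
  have hsq : (X - Y) ^ 2 ≤ (a + b) ^ 2 * p * W := by
    calc (X - Y) ^ 2 = |X - Y| ^ 2 := (sq_abs _).symm
      _ ≤ ((a + b) / d * G) ^ 2 := by gcongr
      _ = ((a + b) / d) ^ 2 * G ^ 2 := mul_pow _ _ _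
      _ ≤ ((a + b) / d) ^ 2 * (p * d ^ 2 * W) := by gcongr
      _ = _ := by field_simp
  set C := (a + b) ^ 2 * p
  have hC : 0 ≤ C := by positivity
  have hCX : 0 ≤ C * X ^ 2 := by positivity
  have hCY : 0 ≤ C * Y ^ 2 := by positivity
  constructor
  · rw [inv_mul_le_iff₀ (by positivity)]
    nlinarith [sq_nonneg (X - 2 * Y)]
  · nlinarith [sq_nonneg (Y - 2 * X)]

theorem stmt_7 (γ₀ γ₁ : ℝ) (hγ₀ : 0 < γ₀) (hγ₁ : 0 < γ₁) :
    ∃ c₁ c₂ : ℝ, 0 < c₁ ∧ 0 < c₂ ∧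
      ∀ K : Set (EuclideanSpace ℝ (Fin 2)), K.Nonempty → IsOpen K → Bornology.IsBounded K →
      ∀ c : EuclideanSpace ℝ (Fin 2),
        Metric.closedBall c (γ₀ * Metric.diam K) ⊆ K →
        (∀ y ∈ Metric.closedBall c (γ₀ * Metric.diam K), ∀ z ∈ K, segment ℝ y z ⊆ K) →
      ∀ τ : Set (EuclideanSpace ℝ (Fin 2)),
        τ ⊆ frontier K → IsCompact τ → IsConnected τ →
        ENNReal.ofReal (γ₁ * Metric.diam K) ≤ μH[1] τ →
      ∀ u : EuclideanSpace ℝ (Fin 2) → ℝ,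
        (∃ U : Set (EuclideanSpace ℝ (Fin 2)),
          IsOpen U ∧ closure K ⊆ U ∧ ContDiffOn ℝ 1 u U) →
        c₁ * ((((μH[1] τ).toReal)⁻¹ * ∫ x in τ, u x ∂μH[1]) ^ 2
              + ∫ x in K, ‖fderiv ℝ u x‖ ^ 2) ≤
          (((volume K).toReal)⁻¹ * ∫ x in K, u x) ^ 2 + (∫ x in K, ‖fderiv ℝ u x‖ ^ 2) ∧
        (((volume K).toReal)⁻¹ * ∫ x in K, u x) ^ 2 + (∫ x in K, ‖fderiv ℝ u x‖ ^ 2) ≤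
          c₂ * ((((μH[1] τ).toReal)⁻¹ * ∫ x in τ, u x ∂μH[1]) ^ 2
              + ∫ x in K, ‖fderiv ℝ u x‖ ^ 2) := by
  set γ := γ₀ / 2 with hγdef
  have hγ : 0 < γ := half_pos hγ₀
  set a := 4 / (Real.pi * γ ^ 2) + 2 * (1 + 1 / γ) / (γ ^ 2 * γ₁) with ha
  set b := 8 / (Real.pi * γ ^ 2) with hb
  refine ⟨(2 + 2 * ((a + b) ^ 2 * Real.pi))⁻¹, 2 + 2 * ((a + b) ^ 2 * Real.pi), by positivity,
    by positivity, ?_⟩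
  intro K hKne hKo hKb c hball hstar τ hτK hτc hτconn hτ u hu
  obtain ⟨U, hU, hKU, hu⟩ := hu
  set d := Metric.diam K with hddef
  have hd : 0 < d := by
    refine Metric.diam_pos ?_ hKb
    by_contra h
    obtain ⟨x, hx⟩ := hKne
    rw [Set.not_nontrivial_iff] at h
    rw [h.eq_singleton_of_mem hx] at hKo
    exact not_isOpen_singleton x hKo
  have hV : Module.finrank ℝ (EuclideanSpace ℝ (Fin 2)) = 2 := finrank_euclideanSpace_fin
  set ρ := γ * d with hρdef
  have hρ : 0 < ρ := mul_pos hγ hd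
  set B := Metric.closedBall c ρ with hBdef
  have hBbig : B ⊆ Metric.closedBall c (γ₀ * d) :=
    Metric.closedBall_subset_closedBall (by rw [hρdef, hγdef]; nlinarith)
  have hBK : B ⊆ K := hBbig.trans hball
  have hker : ∀ y ∈ B, ∀ p ∈ Metric.closedBall y ρ, StarConvex ℝ p K := by
    intro y hy p hp
    rw [starConvex_iff_segment_subset]
    refine fun z hz => hstar p (Metric.closedBall_subset_closedBall' (ε₁ := ρ) ?_ hp) z hz
    have := Metric.mem_closedBall.1 hy
    rw [hρdef, hγdef] at *
    linarith
  have hseg : ∀ y ∈ B, ∀ x ∈ closure K, ∀ t ∈ Set.Ico (0 : ℝ) 1, y + t • (x - y) ∈ K :=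
    fun y hy x hx t ht => lineMap_mem_of_mem_closure (hker y hy) hρ hx ht.1 ht.2
  have hD : ∀ y ∈ B, ∀ x ∈ closure K, ‖x - y‖ ≤ d := by
    intro y hy x hx
    rw [← dist_eq_norm, hddef, ← Metric.diam_closure]
    exact Metric.dist_le_diam_of_mem hKb.closure hx (subset_closure (hBK hy))
  have hcB : c ∈ B := Metric.mem_closedBall_self hρ.le
  have hBvol : volume.real B = Real.pi * ρ ^ 2 := by
    rw [measureReal_def, hBdef, EuclideanSpace.volume_closedBall_fin_two]
    simp [hρ.le, Real.pi_pos.le, mul_comm]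
  have hBvol0 : volume B ≠ 0 := fun h => by
    rw [measureReal_def, h, ENNReal.toReal_zero] at hBvol
    have : 0 < Real.pi * ρ ^ 2 := by positivity
    exact this.ne hBvol
  have hKsub : K ⊆ Metric.closedBall c d := fun x hx => by
    rw [mem_closedBall_iff_norm]
    exact hD c hcB x (subset_closure hx)
  have hKvol : volume.real K ≤ Real.pi * d ^ 2 := by
    refine (measureReal_mono hKsub measure_closedBall_lt_top.ne).trans_eq ?_
    rw [measureReal_def, EuclideanSpace.volume_closedBall_fin_two]
    simp [hd.le, Real.pi_pos.le, mul_comm]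
  have hKfin : volume K ≠ ⊤ := hKb.measure_lt_top.ne
  have hKvol' : Real.pi * ρ ^ 2 ≤ volume.real K := hBvol ▸ measureReal_mono hBK hKfin
  have hfK : ContinuousOn (fun x => ‖fderiv ℝ u x‖) (closure K) :=
    ((hu.continuousOn_fderiv_of_isOpen hU le_rfl).mono hKU).norm
  have hG0 : 0 ≤ ∫ x in K, ‖fderiv ℝ u x‖ := integral_nonneg fun _ => norm_nonneg _
  have hW0 : 0 ≤ ∫ x in K, ‖fderiv ℝ u x‖ ^ 2 := integral_nonneg fun _ => sq_nonneg _
  have : IsFiniteMeasure (volume.restrict K) := isFiniteMeasure_restrict.2 hKfin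
  have hG : (∫ x in K, ‖fderiv ℝ u x‖) ^ 2 ≤
      Real.pi * d ^ 2 * ∫ x in K, ‖fderiv ℝ u x‖ ^ 2 := by
    have hint := (hfK.integrableOn_compact hKb.isCompact_closure (μ := volume)).mono_set
      subset_closure
    have hint2 := ((hfK.pow 2).integrableOn_compact hKb.isCompact_closure (μ := volume)).mono_set
      subset_closure
    refine (sq_integral_le_measureReal_mul hint hint2).trans ?_
    rw [measureReal_restrict_apply_univ]
    gcongr
  have hYZ : |((volume K).toReal)⁻¹ * (∫ x in K, u x) - (volume.real B)⁻¹ * ∫ y in B, u y| ≤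
      b / d * ∫ x in K, ‖fderiv ℝ u x‖ := by
    have : NeZero (volume.restrict K) := ⟨fun h => by
      rw [Measure.restrict_eq_zero] at h
      exact hBvol0 (measure_mono_null hBK h)⟩
    have h := abs_average_sub_average_le hV hKo hKb hBK hBvol0 hd.le hseg hD
      (ν := volume.restrict K) (M := 4)
      ((ae_restrict_mem hKo.measurableSet).mono fun x hx => subset_closure hx) (by norm_num)
      (fun y hy f hf => by
        rw [show ENNReal.ofReal 4 = 4 by norm_num]
        exact lintegral_lineMap_le_four_mul hV hKo (hseg y hy) hf) hU hKU hu
    rw [measureReal_restrict_apply_univ, hBvol] at h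
    rw [hBvol]
    refine h.trans ?_
    gcongr
    calc d * (4 / (Real.pi * ρ ^ 2) + 4 / volume.real K)
        ≤ d * (4 / (Real.pi * ρ ^ 2) + 4 / (Real.pi * ρ ^ 2)) := by gcongr
      _ = b / d := by
        rw [hb, hρdef]
        field_simp
        norm_num
  have hXZ : |((μH[1] τ).toReal)⁻¹ * (∫ x in τ, u x ∂μH[1]) -
      (volume.real B)⁻¹ * ∫ y in B, u y| ≤ a / d * ∫ x in K, ‖fderiv ℝ u x‖ := by
    let e : ℂ ≃ₗᵢ[ℝ] EuclideanSpace ℝ (Fin 2) := Complex.orthonormalBasisOneI.repr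
    have hτtop : μH[1] τ < ⊤ := (measure_mono hτK).trans_lt
      (hausdorffMeasure_frontier_lt_top e hKo hρ (hker c hcB) (hD c hcB))
    have hτlow : γ₁ * d ≤ (μH[1] τ).toReal := (ENNReal.ofReal_le_iff_le_toReal hτtop.ne).1 hτ
    have hτpos : 0 < γ₁ * d := mul_pos hγ₁ hd
    have : IsFiniteMeasure ((μH[1] : Measure (EuclideanSpace ℝ (Fin 2))).restrict τ) :=
      isFiniteMeasure_restrict.2 hτtop.ne
    have : NeZero ((μH[1] : Measure (EuclideanSpace ℝ (Fin 2))).restrict τ) := ⟨fun h => by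
      rw [Measure.restrict_eq_zero] at h
      rw [h, ENNReal.toReal_zero] at hτlow
      exact hτpos.not_ge hτlow⟩
    have h := abs_average_sub_average_le hV hKo hKb hBK hBvol0 hd.le hseg hD
      (ν := (μH[1] : Measure (EuclideanSpace ℝ (Fin 2))).restrict τ)
      (M := ρ⁻¹ * ((d + d ^ 2 / ρ) * (ρ / 2)⁻¹))
      ((ae_restrict_mem hτc.measurableSet).mono fun x hx => frontier_subset_closure (hτK hx))
      (by positivity)
      (fun y hy f hf => by
        rw [ENNReal.ofReal_mul (by positivity), ENNReal.ofReal_mul (by positivity), mul_assoc,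
          mul_assoc]
        exact (lintegral_mono_set hτK).trans
          (lintegral_frontier_lineMap_le e hKo hρ (hker y hy) (hD y hy) hf)) hU hKU hu
    rw [measureReal_restrict_apply_univ, hBvol] at h
    rw [hBvol]
    refine h.trans ?_
    gcongr
    calc d * (4 / (Real.pi * ρ ^ 2) + ρ⁻¹ * ((d + d ^ 2 / ρ) * (ρ / 2)⁻¹) / (μH[1] τ).toReal)
        ≤ d * (4 / (Real.pi * ρ ^ 2) + ρ⁻¹ * ((d + d ^ 2 / ρ) * (ρ / 2)⁻¹) / (γ₁ * d)) := by
          gcongr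
      _ = a / d := by
        rw [ha, hρdef]
        field_simp
  exact comparison_of_abs_sub_le hd Real.pi_pos.le hW0 hXZ hYZ hG
end

section
/- Let γ₀, γ₁ > 0. There exists a constant Ĉ > 0 depending only on γ₀ and γ₁ such that the following holds. Let K ⊆ ℝ² be a nonempty bounded open set with diameter d, star-shaped with respect to every point of a closed ball of radius γ₀ d contained in K; let τ ⊆ ∂K be a compact connected subset of the boundary with ℋ¹(τ) ≥ γ₁ d; and let u be a real-valued function continuously differentiable on a neighborhood of the closure of K with ∫_τ u dℋ¹ = 0. Then ∫_K u² ≤ Ĉ² d² ∫_K |∇u|². (Poincaré inequality for functions with zero mean on a boundary piece of length comparable to the diameter.) -/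
open MeasureTheory

open scoped ENNReal

lemma sq_lintegral_le {α : Type*} [MeasurableSpace α] (μ : Measure α) {f : α → ℝ≥0∞}
    (hf : AEMeasurable f μ) : (∫⁻ x, f x ∂μ) ^ 2 ≤ μ Set.univ * ∫⁻ x, f x ^ 2 ∂μ := by
  have h := ENNReal.lintegral_mul_le_Lp_mul_Lq μ Real.HolderConjugate.two_two
    (f := fun _ => 1) (g := f) aemeasurable_const hf
  have h2 := pow_le_pow_left₀ (zero_le) h 2
  simp only [Pi.mul_apply, one_mul, ENNReal.one_rpow, lintegral_const, mul_pow,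
    ← ENNReal.rpow_natCast, ← ENNReal.rpow_mul] at h2
  simpa using h2

section Geometry

variable {E : Type*} [NormedAddCommGroup E] [NormedSpace ℝ E] {K : Set E} {c : E} {r : ℝ}

lemma add_smul_sub_mem_of_mem_closure
    (hstar : ∀ y ∈ Metric.closedBall c r, ∀ z ∈ K, segment ℝ y z ⊆ K)
    {s y : E} (hs : s ∈ closure K) (hy : y ∈ Metric.ball c r) {t : ℝ} (ht0 : 0 < t)
    (ht1 : t ≤ 1) : s + t • (y - s) ∈ K := by
  rw [Metric.mem_ball, dist_eq_norm] at hy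
  have hδ : 0 < t * (r - ‖y - c‖) := mul_pos ht0 (by linarith)
  obtain ⟨z, hz, hsz⟩ := Metric.mem_closure_iff.1 hs _ hδ
  rw [dist_eq_norm] at hsz
  have hy' : y + ((1 - t) / t) • (s - z) ∈ Metric.closedBall c r := by
    rw [Metric.mem_closedBall, dist_eq_norm]
    have h1 : ‖((1 - t) / t) • (s - z)‖ ≤ r - ‖y - c‖ := by
      rw [norm_smul, Real.norm_of_nonneg (div_nonneg (by linarith) ht0.le), div_mul_eq_mul_div,
        div_le_iff₀ ht0]
      nlinarith [norm_nonneg (s - z)]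
    calc ‖y + ((1 - t) / t) • (s - z) - c‖ = ‖(y - c) + ((1 - t) / t) • (s - z)‖ := by
          congr 1; abel
      _ ≤ ‖y - c‖ + ‖((1 - t) / t) • (s - z)‖ := norm_add_le _ _
      _ ≤ r := by linarith
  refine hstar _ hy' z hz ⟨t, 1 - t, ht0.le, by linarith, by ring, ?_⟩
  rw [smul_add, smul_smul, mul_div_cancel₀ _ ht0.ne']
  module

variable {α β : E →ₗ[ℝ] ℝ}

lemma abscissa_sub_le (hr : 0 < r)
    (hstar : ∀ y ∈ Metric.closedBall c r, ∀ z ∈ K, segment ℝ y z ⊆ K)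
    (hα : ∀ v, |α v| ≤ ‖v‖) (hαβ : ∀ v, ‖v‖ ≤ |α v| + |β v|) {d : ℝ}
    {p q : E} (hp : p ∈ closure K) (hqK : q ∉ K) (hpd : ‖p - c‖ ≤ d) (hqd : ‖q - c‖ ≤ d)
    (hp0 : 0 < α (p - c)) (hq0 : 0 < α (q - c)) :
    α (p - c) - α (q - c) ≤
      d ^ 2 / r * |β (p - c) / α (p - c) - β (q - c) / α (q - c)| := by
  set a := α (p - c) with ha
  set b := α (q - c) with hb
  have had : a ≤ d := (le_abs_self _).trans ((hα _).trans hpd)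
  have hbd : b ≤ d := (le_abs_self _).trans ((hα _).trans hqd)
  rcases le_or_gt a b with hab | hab
  · exact (sub_nonpos.2 hab).trans (by positivity)
  set δ := |β (p - c) / a - β (q - c) / b| with hδ
  have hd0 : 0 ≤ d := hp0.le.trans had
  by_contra! hcon
  have ht0 : 0 < 1 - b / a := by rw [sub_pos, div_lt_one hp0]; exact hab
  have ht1 : 1 - b / a ≤ 1 := by have : 0 < b / a := by positivity
                                 linarith
  set v := (q - c) - (b / a) • (p - c) with hv
  have hαv : α v = 0 := by
    rw [hv, map_sub, map_smul, smul_eq_mul, ← ha, ← hb]; field_simp; ring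
  have hβv : |β v| = b * δ := by
    rw [hv, hδ, map_sub, map_smul, smul_eq_mul, ← abs_of_pos hq0, ← abs_mul, ← abs_neg,
      abs_of_pos hq0]
    congr 1; field_simp; ring
  have hvn : ‖v‖ ≤ b * δ := by simpa [hαv, hβv] using hαβ v
  have hvr : ‖v‖ < (1 - b / a) * r := by
    refine hvn.trans_lt ?_
    have h1 : d ^ 2 * δ < (a - b) * r := by
      rwa [div_mul_eq_mul_div, div_lt_iff₀ hr] at hcon
    have h2 : a * b * δ ≤ d ^ 2 * δ := by
      rw [sq]; gcongr
    rw [one_sub_div hp0.ne', div_mul_eq_mul_div, lt_div_iff₀ hp0]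
    nlinarith
  have hy : c + (1 - b / a)⁻¹ • v ∈ Metric.ball c r := by
    rw [mem_ball_iff_norm, add_sub_cancel_left, norm_smul, norm_inv, Real.norm_of_nonneg ht0.le,
      inv_mul_lt_iff₀ ht0]
    exact hvr
  refine hqK ?_
  convert add_smul_sub_mem_of_mem_closure hstar hp hy ht0 ht1 using 1
  rw [smul_sub, smul_add, smul_smul, mul_inv_cancel₀ ht0.ne', hv]
  module

lemma norm_sub_le_slope_sub (hr : 0 < r)
    (hstar : ∀ y ∈ Metric.closedBall c r, ∀ z ∈ K, segment ℝ y z ⊆ K)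
    (hα : ∀ v, |α v| ≤ ‖v‖) (hαβ : ∀ v, ‖v‖ ≤ |α v| + |β v|) {d : ℝ}
    {p q : E} (hp : p ∈ closure K) (hpK : p ∉ K) (hq : q ∈ closure K) (hqK : q ∉ K)
    (hpd : ‖p - c‖ ≤ d) (hqd : ‖q - c‖ ≤ d)
    (hp0 : 0 < α (p - c)) (hq0 : 0 < α (q - c)) (hpβ : |β (p - c)| ≤ α (p - c)) :
    ‖p - q‖ ≤
      (2 * d ^ 2 / r + d) * |β (p - c) / α (p - c) - β (q - c) / α (q - c)| := by
  have h1 := abscissa_sub_le hr hstar hα hαβ hp hqK hpd hqd hp0 hq0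
  have h2 := abscissa_sub_le hr hstar hα hαβ hq hpK hqd hpd hq0 hp0
  rw [abs_sub_comm] at h2
  have hbd : α (q - c) ≤ d := (le_abs_self _).trans ((hα _).trans hqd)
  set a := α (p - c) with ha
  set b := α (q - c) with hb
  set δ := |β (p - c) / a - β (q - c) / b| with hδ
  have h3 : |a - b| ≤ d ^ 2 / r * δ := abs_le.2 ⟨by linarith, h1⟩
  have e1 : α (p - q) = a - b := by rw [ha, hb, ← map_sub]; congr 1; abel
  have e2 : β (p - q) = (a - b) * (β (p - c) / a) + b * (β (p - c) / a - β (q - c) / b) := by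
    have : β (p - q) = β (p - c) - β (q - c) := by rw [← map_sub]; congr 1; abel
    rw [this]; field_simp; ring
  have h4 : |β (p - q)| ≤ |a - b| + d * δ := by
    rw [e2]
    refine (abs_add_le _ _).trans ?_
    rw [abs_mul, abs_mul, abs_of_pos hq0]
    have : |β (p - c) / a| ≤ 1 := by
      rw [abs_div, abs_of_pos hp0, div_le_one hp0]; exact hpβ
    have := mul_le_of_le_one_right (abs_nonneg (a - b)) this
    have : b * δ ≤ d * δ := by gcongr
    linarith
  have := hαβ (p - q)
  rw [e1] at this
  calc ‖p - q‖ ≤ 2 * (d ^ 2 / r * δ) + d * δ := by linarith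
    _ = _ := by ring

lemma abs_slope_sub_le (hr : 0 < r)
    (hα : ∀ v, |α v| ≤ ‖v‖) (hβ : ∀ v, |β v| ≤ ‖v‖) (hαβ : ∀ v, ‖v‖ ≤ |α v| + |β v|)
    {p q : E} (hq : r ≤ ‖q - c‖)
    (hp0 : 0 < α (p - c)) (hq0 : 0 < α (q - c)) (hpβ : |β (p - c)| ≤ α (p - c))
    (hqβ : |β (q - c)| ≤ α (q - c)) :
    |β (p - c) / α (p - c) - β (q - c) / α (q - c)| ≤ 4 / r * ‖p - q‖ := by
  have h0 := hαβ (q - c)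
  have h1 := hα (p - q)
  have h2 := hβ (p - q)
  have e1 : α (p - q) = α (p - c) - α (q - c) := by rw [← map_sub]; congr 1; abel
  have e2 : β (p - q) = β (p - c) - β (q - c) := by rw [← map_sub]; congr 1; abel
  set a := α (p - c) with ha
  set b := α (q - c) with hb
  rw [abs_of_pos hq0] at h0
  have hbr : r ≤ 2 * b := by linarith
  have key : b * (β (p - c) / a - β (q - c) / b)
      = β (p - q) - (β (p - c) / a) * α (p - q) := by
    rw [e1, e2]; field_simp; ring
  have h3 : b * |β (p - c) / a - β (q - c) / b| ≤ 2 * ‖p - q‖ := by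
    rw [← abs_of_pos hq0, ← abs_mul, abs_of_pos hq0, key]
    refine (abs_sub _ _).trans ?_
    rw [abs_mul]
    have : |β (p - c) / a| ≤ 1 := by
      rw [abs_div, abs_of_pos hp0, div_le_one hp0]; exact hpβ
    have := mul_le_of_le_one_left (abs_nonneg (α (p - q))) this
    linarith
  rw [div_mul_eq_mul_div, le_div_iff₀ hr]
  nlinarith [abs_nonneg (β (p - c) / a - β (q - c) / b)]

variable [MeasurableSpace E] [BorelSpace E]

lemma hausdorffMeasure_sector_le (hr : 0 < r) (hK : IsOpen K)
    (hball : Metric.closedBall c r ⊆ K)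
    (hstar : ∀ y ∈ Metric.closedBall c r, ∀ z ∈ K, segment ℝ y z ⊆ K)
    (hα : ∀ v, |α v| ≤ ‖v‖) (hβ : ∀ v, |β v| ≤ ‖v‖) (hαβ : ∀ v, ‖v‖ ≤ |α v| + |β v|)
    {d : ℝ} (hd : 0 < d) (hKd : ∀ p ∈ closure K, ‖p - c‖ ≤ d) (z : E) (ρ : ℝ) :
    μH[1] (frontier K ∩ Metric.closedBall z ρ ∩ {p | |β (p - c)| ≤ α (p - c)}) ≤
      ENNReal.ofReal ((2 * d ^ 2 / r + d) * (8 / r * ρ)) := by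
  set A := frontier K ∩ Metric.closedBall z ρ ∩ {p | |β (p - c)| ≤ α (p - c)} with hA
  set ψ : E → ℝ := fun p => β (p - c) / α (p - c) with hψ
  have hcl : ∀ p ∈ A, p ∈ closure K := fun p hp => frontier_subset_closure hp.1.1
  have hnot : ∀ p ∈ A, p ∉ K := fun p hp h => by
    have := hp.1.1; rw [hK.frontier_eq] at this; exact this.2 h
  have hrp : ∀ p ∈ A, r ≤ ‖p - c‖ := fun p hp => by
    by_contra! h
    exact hnot p hp (hball (by rw [mem_closedBall_iff_norm]; exact h.le))
  have hpos : ∀ p ∈ A, 0 < α (p - c) := fun p hp => by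
    have h1 := hrp p hp
    have h2 := hαβ (p - c)
    have h3 : |β (p - c)| ≤ α (p - c) := hp.2
    have h4 := (abs_nonneg _).trans h3
    rw [abs_of_nonneg h4] at h2
    linarith
  have hC : 0 ≤ 2 * d ^ 2 / r + d := by positivity
  have hanti : ∀ p ∈ A, ∀ q ∈ A, ‖p - q‖ ≤ (2 * d ^ 2 / r + d) * |ψ p - ψ q| :=
    fun p hp q hq => norm_sub_le_slope_sub hr hstar hα hαβ (hcl p hp) (hnot p hp) (hcl q hq)
      (hnot q hq) (hKd p (hcl p hp)) (hKd q (hcl q hq)) (hpos p hp) (hpos q hq) hp.2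
  set g := Function.invFunOn ψ A with hg
  have hgmem : ∀ x ∈ ψ '' A, g x ∈ A ∧ ψ (g x) = x := fun x hx =>
    ⟨Function.invFunOn_mem hx, Function.invFunOn_eq hx⟩
  have hlip : LipschitzOnWith (Real.toNNReal (2 * d ^ 2 / r + d)) g (ψ '' A) := by
    refine LipschitzOnWith.of_dist_le_mul fun x hx y hy => ?_
    have := hanti _ (hgmem x hx).1 _ (hgmem y hy).1
    rwa [(hgmem x hx).2, (hgmem y hy).2, ← dist_eq_norm, ← Real.dist_eq,
      ← Real.coe_toNNReal _ hC] at this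
  have hsub : A ⊆ g '' (ψ '' A) := fun p hp => by
    have hx := Set.mem_image_of_mem ψ hp
    refine ⟨ψ p, hx, ?_⟩
    have := hanti _ (hgmem _ hx).1 p hp
    rw [(hgmem _ hx).2, sub_self, abs_zero, mul_zero] at this
    exact sub_eq_zero.1 (norm_le_zero_iff.1 this)
  have hdiam : volume (ψ '' A) ≤ ENNReal.ofReal (8 / r * ρ) := by
    refine (Real.volume_le_diam _).trans (Metric.ediam_le ?_)
    rintro _ ⟨p, hp, rfl⟩ _ ⟨q, hq, rfl⟩
    rw [edist_dist]
    refine ENNReal.ofReal_le_ofReal ?_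
    rw [Real.dist_eq]
    refine (abs_slope_sub_le hr hα hβ hαβ (hrp q hq) (hpos p hp) (hpos q hq) hp.2 hq.2).trans ?_
    have : ‖p - q‖ ≤ ρ + ρ := by
      rw [← dist_eq_norm]
      exact (dist_triangle_right p q z).trans (add_le_add hp.1.2 hq.1.2)
    calc 4 / r * ‖p - q‖ ≤ 4 / r * (ρ + ρ) := by gcongr
      _ = 8 / r * ρ := by ring
  calc μH[1] A ≤ μH[1] (g '' (ψ '' A)) := measure_mono hsub
    _ ≤ _ := hlip.hausdorffMeasure_image_le zero_le_one
    _ ≤ ENNReal.ofReal (2 * d ^ 2 / r + d) * ENNReal.ofReal (8 / r * ρ) := by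
      rw [ENNReal.rpow_one, hausdorffMeasure_real]
      gcongr
      rfl
    _ = _ := (ENNReal.ofReal_mul hC).symm

end Geometry

lemma hausdorffMeasure_frontier_inter_closedBall_le {K : Set (EuclideanSpace ℝ (Fin 2))}
    {c : EuclideanSpace ℝ (Fin 2)} {r : ℝ} (hr : 0 < r) (hK : IsOpen K)
    (hball : Metric.closedBall c r ⊆ K)
    (hstar : ∀ y ∈ Metric.closedBall c r, ∀ z ∈ K, segment ℝ y z ⊆ K)
    {d : ℝ} (hd : 0 < d) (hKd : ∀ p ∈ closure K, ‖p - c‖ ≤ d)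
    (z : EuclideanSpace ℝ (Fin 2)) {ρ : ℝ} (hρ : 0 ≤ ρ) :
    μH[1] (frontier K ∩ Metric.closedBall z ρ) ≤
      ENNReal.ofReal (32 * (2 * d ^ 2 / r + d) / r * ρ) := by
  set π : Fin 2 → EuclideanSpace ℝ (Fin 2) →ₗ[ℝ] ℝ := fun i =>
    (EuclideanSpace.proj i : EuclideanSpace ℝ (Fin 2) →L[ℝ] ℝ).toLinearMap with hπ
  have hπv : ∀ i v, π i v = v i := fun i v => rfl
  have hle : ∀ i v, |π i v| ≤ ‖v‖ := fun i v => by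
    rw [hπv, ← Real.norm_eq_abs]; exact PiLp.norm_apply_le v i
  have hsum : ∀ v : EuclideanSpace ℝ (Fin 2), ‖v‖ ≤ |π 0 v| + |π 1 v| := fun v => by
    rw [EuclideanSpace.norm_eq, Fin.sum_univ_two, hπv, hπv]
    refine Real.sqrt_le_iff.2 ⟨by positivity, ?_⟩
    simp only [Real.norm_eq_abs]
    nlinarith [abs_nonneg (v 0), abs_nonneg (v 1)]
  have hsum' : ∀ v : EuclideanSpace ℝ (Fin 2), ‖v‖ ≤ |π 1 v| + |π 0 v| := fun v => by
    rw [add_comm]; exact hsum v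
  have hneg : ∀ i v, |(-π i) v| = |π i v| := fun i v => by simp
  set C := (2 * d ^ 2 / r + d) * (8 / r * ρ) with hC
  have hC0 : 0 ≤ C := by positivity
  have h1 := hausdorffMeasure_sector_le (α := π 0) (β := π 1) hr hK hball hstar
    (hle 0) (hle 1) hsum hd hKd z ρ
  have h2 := hausdorffMeasure_sector_le (α := π 1) (β := π 0) hr hK hball hstar
    (hle 1) (hle 0) hsum' hd hKd z ρ
  have h3 := hausdorffMeasure_sector_le (α := -π 0) (β := π 1) hr hK hball hstar
    (by simpa only [hneg] using hle 0) (hle 1) (by simpa only [hneg] using hsum) hd hKd z ρ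
  have h4 := hausdorffMeasure_sector_le (α := -π 1) (β := π 0) hr hK hball hstar
    (by simpa only [hneg] using hle 1) (hle 0) (by simpa only [hneg] using hsum') hd hKd z ρ
  set S := frontier K ∩ Metric.closedBall z ρ with hS
  have hcover : S ⊆ ((S ∩ {p | |π 1 (p - c)| ≤ π 0 (p - c)}) ∪
      (S ∩ {p | |π 0 (p - c)| ≤ π 1 (p - c)})) ∪
      ((S ∩ {p | |π 1 (p - c)| ≤ (-π 0) (p - c)}) ∪
      (S ∩ {p | |π 0 (p - c)| ≤ (-π 1) (p - c)})) := fun p hp => by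
    simp only [Set.mem_union, Set.mem_inter_iff, hp, true_and, Set.mem_ofPred_eq,
      LinearMap.neg_apply]
    rcases le_total |π 1 (p - c)| |π 0 (p - c)| with h | h
    · rcases abs_cases (π 0 (p - c)) with h' | h' <;> rw [h'.1] at h <;> tauto
    · rcases abs_cases (π 1 (p - c)) with h' | h' <;> rw [h'.1] at h <;> tauto
  calc μH[1] S ≤ _ := measure_mono hcover
    _ ≤ (ENNReal.ofReal C + ENNReal.ofReal C) + (ENNReal.ofReal C + ENNReal.ofReal C) := by
      refine (measure_union_le _ _).trans (add_le_add ?_ ?_)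
      · exact (measure_union_le _ _).trans (add_le_add h1 h2)
      · exact (measure_union_le _ _).trans (add_le_add h3 h4)
    _ = ENNReal.ofReal (32 * (2 * d ^ 2 / r + d) / r * ρ) := by
      rw [← ENNReal.ofReal_add hC0 hC0, ← ENNReal.ofReal_add (by positivity) (by positivity)]
      congr 1
      rw [hC]; ring

lemma enorm_sub_sq_le_lintegral {E : Type*} [NormedAddCommGroup E] [NormedSpace ℝ E]
    {K U : Set E} {c s y : E} {r d : ℝ}
    (hstar : ∀ y ∈ Metric.closedBall c r, ∀ z ∈ K, segment ℝ y z ⊆ K)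
    (hU : IsOpen U) (hKU : closure K ⊆ U) {u : E → ℝ} (hu : ContDiffOn ℝ 1 u U)
    (hs : s ∈ closure K) (hy : y ∈ Metric.ball c r) (hd : ‖y - s‖ ≤ d) :
    ‖u s - u y‖ₑ ^ 2 ≤ ∫⁻ t in Set.Ioc (0 : ℝ) 1, ENNReal.ofReal (4 * t ^ 2 * d ^ 2) *
      K.indicator (fun z => ‖fderiv ℝ u z‖ₑ ^ 2) (s + t ^ 2 • (y - s)) := by
  have hmem : ∀ t ∈ Set.Ioc (0 : ℝ) 1, s + t ^ 2 • (y - s) ∈ K := fun t ht =>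
    add_smul_sub_mem_of_mem_closure hstar hs hy (pow_pos ht.1 2) (pow_le_one₀ ht.1.le ht.2)
  have hmemU : ∀ t ∈ Set.Icc (0 : ℝ) 1, s + t ^ 2 • (y - s) ∈ U := fun t ht => by
    rcases ht.1.eq_or_lt with h | h
    · rw [← h]; simpa using hKU hs
    · exact hKU (subset_closure (hmem t ⟨h, ht.2⟩))
  have hpath : ∀ t : ℝ, HasDerivAt (fun t : ℝ => s + t ^ 2 • (y - s)) ((2 * t) • (y - s)) t :=
    fun t => by simpa using ((hasDerivAt_pow 2 t).smul_const (y - s)).const_add s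
  set f' : ℝ → ℝ := fun t => fderiv ℝ u (s + t ^ 2 • (y - s)) ((2 * t) • (y - s)) with hf'
  have hderiv : ∀ t ∈ Set.uIcc (0 : ℝ) 1,
      HasDerivAt (fun t : ℝ => u (s + t ^ 2 • (y - s))) (f' t) t := fun t ht => by
    rw [Set.uIcc_of_le zero_le_one] at ht
    have h1 : HasFDerivAt u (fderiv ℝ u (s + t ^ 2 • (y - s))) (s + t ^ 2 • (y - s)) :=
      ((hu.differentiableOn one_ne_zero).differentiableAt (hU.mem_nhds (hmemU t ht))).hasFDerivAt
    exact h1.comp_hasDerivAt t (hpath t)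
  have hcont : ContinuousOn f' (Set.Icc 0 1) := by
    refine ContinuousOn.clm_apply ?_ (by fun_prop)
    exact (hu.continuousOn_fderiv_of_isOpen hU le_rfl).comp (by fun_prop) hmemU
  have hint : ∫ t in (0 : ℝ)..1, f' t = u y - u s := by
    rw [intervalIntegral.integral_eq_sub_of_hasDerivAt hderiv
      (ContinuousOn.intervalIntegrable (by rwa [Set.uIcc_of_le zero_le_one]))]
    simp
  rw [intervalIntegral.integral_of_le zero_le_one] at hint
  have hmeas : AEStronglyMeasurable f' (volume.restrict (Set.Ioc 0 1)) :=
    (hcont.mono Set.Ioc_subset_Icc_self).aestronglyMeasurable measurableSet_Ioc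
  calc ‖u s - u y‖ₑ ^ 2 = ‖∫ t in Set.Ioc (0 : ℝ) 1, f' t‖ₑ ^ 2 := by
        rw [hint, ← enorm_neg, neg_sub]
    _ ≤ (∫⁻ t in Set.Ioc (0 : ℝ) 1, ‖f' t‖ₑ) ^ 2 := by
        gcongr; exact enorm_integral_le_lintegral_enorm _
    _ ≤ _ := sq_lintegral_le _ hmeas.enorm
    _ = ∫⁻ t in Set.Ioc (0 : ℝ) 1, ‖f' t‖ₑ ^ 2 := by simp
    _ ≤ _ := by
        refine setLIntegral_mono' measurableSet_Ioc fun t ht => ?_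
        rw [Set.indicator_of_mem (hmem t ht)]
        have h1 : ‖f' t‖ ^ 2 ≤ 4 * t ^ 2 * d ^ 2 * ‖fderiv ℝ u (s + t ^ 2 • (y - s))‖ ^ 2 := by
          have h2 : ‖f' t‖ ≤ ‖fderiv ℝ u (s + t ^ 2 • (y - s))‖ * (2 * t * d) := by
            refine (ContinuousLinearMap.le_opNorm _ _).trans ?_
            rw [norm_smul, Real.norm_of_nonneg (by linarith [ht.1])]
            have := ht.1
            gcongr
          refine (pow_le_pow_left₀ (norm_nonneg _) h2 2).trans_eq ?_
          ring
        rw [← ofReal_norm, ← ofReal_norm,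
          ← ENNReal.ofReal_pow (norm_nonneg _), ← ENNReal.ofReal_pow (norm_nonneg _),
          ← ENNReal.ofReal_mul (by positivity)]
        exact ENNReal.ofReal_le_ofReal h1

lemma lintegral_comp_smul_add {E : Type*} [NormedAddCommGroup E] [NormedSpace ℝ E]
    [MeasurableSpace E] [BorelSpace E] [FiniteDimensional ℝ E] (μ : Measure E)
    [μ.IsAddHaarMeasure] {t : ℝ} (ht : t ≠ 0) (v : E) {f : E → ℝ≥0∞} (hf : Measurable f) :
    ∫⁻ y, f (t • y + v) ∂μ =
      ENNReal.ofReal |(t ^ Module.finrank ℝ E)⁻¹| * ∫⁻ z, f z ∂μ := by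
  have hm : Measurable fun z => f (z + v) := hf.comp (measurable_add_const v)
  rw [← lintegral_add_right_eq_self f v, ← smul_eq_mul, ← lintegral_smul_measure,
    ← Measure.map_addHaar_smul μ ht, lintegral_map hm (measurable_const_smul t)]

lemma lintegral_lintegral_homothety_le {K : Set (EuclideanSpace ℝ (Fin 2))}
    {c : EuclideanSpace ℝ (Fin 2)} {r d M t : ℝ} (hrd : r ≤ d)
    (hKd : ∀ p ∈ closure K, ‖p - c‖ ≤ d)
    (m : Measure (EuclideanSpace ℝ (Fin 2))) [IsFiniteMeasure m]
    (hmK : ∀ᵐ s ∂m, s ∈ closure K)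
    (hm : ∀ z, ∀ ρ : ℝ, 0 ≤ ρ → m (Metric.closedBall z ρ) ≤ ENNReal.ofReal (M * ρ))
    {G : EuclideanSpace ℝ (Fin 2) → ℝ≥0∞} (hG : Measurable G) (ht0 : 0 < t) :
    ∫⁻ s, (∫⁻ y in Metric.ball c r, G (s + t • (y - s))) ∂m ≤
      ENNReal.ofReal (2 * M * d / t) * ∫⁻ z, G z := by
  set B := Metric.ball c r with hB
  have hBm : MeasurableSet B := Metric.isOpen_ball.measurableSet
  rcases lt_or_ge r 0 with hr | hr
  · have : B = ∅ := Metric.ball_eq_empty.2 hr.le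
    simp [this]
  have hd : 0 ≤ d := hr.trans hrd
  have hinner : ∀ s, ∫⁻ y in B, G (s + t • (y - s)) = ENNReal.ofReal (t ^ 2)⁻¹ *
      ∫⁻ z, G z * B.indicator 1 (t⁻¹ • (z - (1 - t) • s)) := fun s => by
    have hmeas : Measurable fun z =>
        G z * B.indicator (1 : EuclideanSpace ℝ (Fin 2) → ℝ≥0∞) (t⁻¹ • (z - (1 - t) • s)) := by
      refine hG.mul ((measurable_one.indicator hBm).comp ?_)
      fun_prop
    have h := lintegral_comp_smul_add volume ht0.ne' ((1 - t) • s) hmeas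
    rw [finrank_euclideanSpace_fin, abs_of_pos (by positivity)] at h
    rw [← h, ← lintegral_indicator hBm]
    refine lintegral_congr fun y => ?_
    rw [add_sub_cancel_right, smul_smul, inv_mul_cancel₀ ht0.ne', one_smul]
    have : s + t • (y - s) = t • y + (1 - t) • s := by module
    by_cases hy : y ∈ B <;> simp [hy, this]
  have hfiber : ∀ z, ∫⁻ s, B.indicator 1 (t⁻¹ • (z - (1 - t) • s)) ∂m ≤
      ENNReal.ofReal (M * (2 * t * d)) := fun z => by
    set S : Set (EuclideanSpace ℝ (Fin 2)) := {s | t⁻¹ • (z - (1 - t) • s) ∈ B} with hS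
    have hSm : MeasurableSet S := by
      refine measurableSet_preimage (f := fun s => t⁻¹ • (z - (1 - t) • s)) ?_ hBm
      fun_prop
    have hind : ∀ s, B.indicator (1 : EuclideanSpace ℝ (Fin 2) → ℝ≥0∞)
        (t⁻¹ • (z - (1 - t) • s)) = S.indicator 1 s := fun s => rfl
    simp_rw [hind]
    rw [lintegral_indicator_one hSm]
    rcases le_or_gt t (1 / 2) with h | h
    · refine (measure_mono ?_).trans (hm ((1 - t)⁻¹ • (z - t • c)) (2 * t * d) (by positivity))
      intro s hs
      set y := t⁻¹ • (z - (1 - t) • s) with hy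
      have hyB : ‖y - c‖ < r := by rw [← mem_ball_iff_norm]; exact hs
      have h1t : 0 < 1 - t := by linarith
      have hz : s - (1 - t)⁻¹ • (z - t • c) = -((1 - t)⁻¹ * t) • (y - c) := by
        rw [hy, neg_smul, smul_sub _ _ c, smul_smul, mul_assoc,
          mul_inv_cancel₀ ht0.ne', mul_one, smul_sub _ z, smul_sub _ z, smul_smul, smul_smul, inv_mul_cancel₀ h1t.ne', one_smul]
        abel
      rw [mem_closedBall_iff_norm, hz, norm_smul, norm_neg, Real.norm_of_nonneg (by positivity)]
      have : (1 - t)⁻¹ ≤ 2 := by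
        rw [inv_le_comm₀ h1t two_pos]; linarith
      have hyd : ‖y - c‖ ≤ d := hyB.le.trans hrd
      gcongr
    · refine (measure_mono_ae ?_).trans (hm c (2 * t * d) (by positivity))
      filter_upwards [hmK] with s hs _
      refine mem_closedBall_iff_norm.2 ((hKd s hs).trans ?_)
      nlinarith
  have hmeas2 : Measurable (Function.uncurry fun s z : EuclideanSpace ℝ (Fin 2) =>
      G z * B.indicator (1 : EuclideanSpace ℝ (Fin 2) → ℝ≥0∞) (t⁻¹ • (z - (1 - t) • s))) := by
    refine (hG.comp measurable_snd).mul ((measurable_one.indicator hBm).comp ?_)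
    fun_prop
  have hmeas3 : ∀ z, Measurable fun s : EuclideanSpace ℝ (Fin 2) =>
      B.indicator (1 : EuclideanSpace ℝ (Fin 2) → ℝ≥0∞) (t⁻¹ • (z - (1 - t) • s)) := fun z => by
    refine (measurable_one.indicator hBm).comp ?_
    fun_prop
  simp_rw [hinner]
  rw [lintegral_const_mul' _ _ ENNReal.ofReal_ne_top,
    lintegral_lintegral_swap hmeas2.aemeasurable]
  simp_rw [fun z => lintegral_const_mul (μ := m) (G z) (hmeas3 z)]
  calc ENNReal.ofReal (t ^ 2)⁻¹ *
        ∫⁻ z, G z * ∫⁻ s, B.indicator 1 (t⁻¹ • (z - (1 - t) • s)) ∂m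
      ≤ ENNReal.ofReal (t ^ 2)⁻¹ * ∫⁻ z, G z * ENNReal.ofReal (M * (2 * t * d)) := by
        gcongr with z; exact hfiber z
    _ = ENNReal.ofReal (t ^ 2)⁻¹ * ENNReal.ofReal (M * (2 * t * d)) * ∫⁻ z, G z := by
        rw [lintegral_mul_const' _ _ ENNReal.ofReal_ne_top]; ring
    _ = _ := by
        rw [← ENNReal.ofReal_mul (by positivity)]
        congr 2
        field_simp

lemma lintegral_lintegral_lintegral_reverse {α β γ : Type*} [MeasurableSpace α]
    [MeasurableSpace β] [MeasurableSpace γ] (μ : Measure α) (ν : Measure β) (κ : Measure γ)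
    [SFinite μ] [SFinite ν] [SFinite κ] {F : α → β → γ → ℝ≥0∞}
    (hF : Measurable fun p : α × β × γ => F p.1 p.2.1 p.2.2) :
    ∫⁻ a, ∫⁻ b, (∫⁻ c, F a b c ∂κ) ∂ν ∂μ = ∫⁻ c, ∫⁻ b, (∫⁻ a, F a b c ∂μ) ∂ν ∂κ := by
  have hbc : ∀ a, ∫⁻ b, (∫⁻ c, F a b c ∂κ) ∂ν = ∫⁻ c, (∫⁻ b, F a b c ∂ν) ∂κ := fun a =>
    lintegral_lintegral_swap (hF.comp (measurable_prodMk_left (x := a))).aemeasurable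
  have hac : Measurable fun p : (α × γ) × β => F p.1.1 p.2 p.1.2 :=
    hF.comp (f := fun p : (α × γ) × β => (p.1.1, p.2, p.1.2)) (by fun_prop)
  have hab : ∀ c, ∫⁻ a, (∫⁻ b, F a b c ∂ν) ∂μ = ∫⁻ b, (∫⁻ a, F a b c ∂μ) ∂ν := fun c =>
    lintegral_lintegral_swap
      (hF.comp (f := fun p : α × β => (p.1, p.2, c)) (by fun_prop)).aemeasurable
  simp_rw [hbc]
  rw [lintegral_lintegral_swap (f := fun a c => ∫⁻ b, F a b c ∂ν)
    hac.lintegral_prod_right'.aemeasurable]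
  simp_rw [hab]

lemma lintegral_lintegral_enorm_sub_sq_le {K U : Set (EuclideanSpace ℝ (Fin 2))}
    {c : EuclideanSpace ℝ (Fin 2)} {r d M : ℝ} (hK : IsOpen K) (hrd : r ≤ d)
    (hball : Metric.closedBall c r ⊆ K)
    (hstar : ∀ y ∈ Metric.closedBall c r, ∀ z ∈ K, segment ℝ y z ⊆ K)
    (hdiam : ∀ p ∈ closure K, ∀ q ∈ closure K, ‖p - q‖ ≤ d)
    (hKd : ∀ p ∈ closure K, ‖p - c‖ ≤ d)
    (hU : IsOpen U) (hKU : closure K ⊆ U) {u : EuclideanSpace ℝ (Fin 2) → ℝ}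
    (hu : ContDiffOn ℝ 1 u U)
    (m : Measure (EuclideanSpace ℝ (Fin 2))) [IsFiniteMeasure m]
    (hmK : ∀ᵐ s ∂m, s ∈ closure K)
    (hm : ∀ z, ∀ ρ : ℝ, 0 ≤ ρ → m (Metric.closedBall z ρ) ≤ ENNReal.ofReal (M * ρ)) :
    ∫⁻ y in Metric.ball c r, ∫⁻ s, ‖u s - u y‖ₑ ^ 2 ∂m ≤
      ENNReal.ofReal (8 * M * d ^ 3) * ∫⁻ z in K, ‖fderiv ℝ u z‖ₑ ^ 2 := by
  set G := K.indicator (fun z => ‖fderiv ℝ u z‖ₑ ^ 2) with hGdef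
  have hG : Measurable G :=
    ((measurable_fderiv ℝ u).enorm.pow_const 2).indicator hK.measurableSet
  have hBm : MeasurableSet (Metric.ball c r) := Metric.isOpen_ball.measurableSet
  set F : EuclideanSpace ℝ (Fin 2) → EuclideanSpace ℝ (Fin 2) → ℝ → ℝ≥0∞ := fun y s t =>
    ENNReal.ofReal (4 * t ^ 2 * d ^ 2) * G (s + t ^ 2 • (y - s)) with hF
  have hFm : Measurable fun p : EuclideanSpace ℝ (Fin 2) × EuclideanSpace ℝ (Fin 2) × ℝ =>
      F p.1 p.2.1 p.2.2 := by
    refine Measurable.mul ?_ (hG.comp ?_) <;> fun_prop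
  calc ∫⁻ y in Metric.ball c r, ∫⁻ s, ‖u s - u y‖ₑ ^ 2 ∂m
      ≤ ∫⁻ y in Metric.ball c r, ∫⁻ s, (∫⁻ t in Set.Ioc (0 : ℝ) 1, F y s t) ∂m := by
        refine setLIntegral_mono' hBm fun y hy => lintegral_mono_ae ?_
        filter_upwards [hmK] with s hs
        exact enorm_sub_sq_le_lintegral hstar hU hKU hu hs hy
          (hdiam _ (subset_closure (hball (Metric.ball_subset_closedBall hy))) _ hs)
    _ = ∫⁻ t in Set.Ioc (0 : ℝ) 1, ∫⁻ s, (∫⁻ y in Metric.ball c r, F y s t) ∂m :=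
        lintegral_lintegral_lintegral_reverse _ _ _ hFm
    _ ≤ ∫⁻ _ in Set.Ioc (0 : ℝ) 1, ENNReal.ofReal (8 * M * d ^ 3) * ∫⁻ z, G z := by
        refine setLIntegral_mono' measurableSet_Ioc fun t ht => ?_
        have ht2 : 0 < t ^ 2 := pow_pos ht.1 2
        simp only [hF]
        simp_rw [lintegral_const_mul' _ _ ENNReal.ofReal_ne_top]
        refine (mul_le_mul_right (lintegral_lintegral_homothety_le hrd hKd m hmK hm hG ht2)
          _).trans_eq ?_
        rw [← mul_assoc, ← ENNReal.ofReal_mul (by positivity)]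
        congr 2
        have := ht.1.ne'
        field_simp
        ring
    _ = ENNReal.ofReal (8 * M * d ^ 3) * ∫⁻ z in K, ‖fderiv ℝ u z‖ₑ ^ 2 := by
        rw [hGdef, lintegral_indicator hK.measurableSet]; simp

lemma volume_restrict_closedBall_le {K : Set (EuclideanSpace ℝ (Fin 2))}
    {c : EuclideanSpace ℝ (Fin 2)} {d : ℝ} (hd : 0 ≤ d) (hKd : ∀ p ∈ closure K, ‖p - c‖ ≤ d)
    (z : EuclideanSpace ℝ (Fin 2)) {ρ : ℝ} (hρ : 0 ≤ ρ) :
    volume.restrict K (Metric.closedBall z ρ) ≤ ENNReal.ofReal (Real.pi * d * ρ) := by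
  have hball : ∀ (x : EuclideanSpace ℝ (Fin 2)) {a : ℝ}, 0 ≤ a →
      volume (Metric.closedBall x a) = ENNReal.ofReal (Real.pi * a ^ 2) := fun x a ha => by
    rw [EuclideanSpace.volume_closedBall_fin_two, ← ENNReal.ofReal_pow ha,
      ← ENNReal.ofReal_mul (by positivity), mul_comm]
  have hpi := Real.pi_pos
  rcases le_total ρ d with h | h
  · refine (Measure.restrict_apply_le _ _).trans ((hball z hρ).trans_le ?_)
    refine ENNReal.ofReal_le_ofReal ?_
    rw [mul_assoc, sq]; gcongr
  · rw [Measure.restrict_apply Metric.isClosed_closedBall.measurableSet]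
    refine (measure_mono (t := Metric.closedBall c d) fun p hp =>
      mem_closedBall_iff_norm.2 (hKd p (subset_closure hp.2))).trans ((hball c hd).trans_le ?_)
    refine ENNReal.ofReal_le_ofReal ?_
    rw [mul_assoc, sq]; gcongr

lemma measure_mul_enorm_sq_le_of_integral_eq_zero {α : Type*} [MeasurableSpace α]
    {m : Measure α} [IsFiniteMeasure m] {u : α → ℝ} (hu : Integrable u m)
    (h0 : ∫ x, u x ∂m = 0) (b : ℝ) :
    m Set.univ * ‖b‖ₑ ^ 2 ≤ ∫⁻ x, ‖u x - b‖ₑ ^ 2 ∂m := by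
  rcases eq_or_ne (m Set.univ) 0 with hm | hm
  · simp [hm]
  have hint : ∫ x, (u x - b) ∂m = -(m.real Set.univ * b) := by
    rw [integral_sub hu (integrable_const b), h0]; simp
  have h1 : m Set.univ * ‖b‖ₑ = ‖∫ x, (u x - b) ∂m‖ₑ := by
    rw [hint, enorm_neg, enorm_mul, Measure.real, Real.enorm_of_nonneg ENNReal.toReal_nonneg,
      ENNReal.ofReal_toReal (measure_ne_top m _)]
  have h2 : m Set.univ * (m Set.univ * ‖b‖ₑ ^ 2) ≤
      m Set.univ * ∫⁻ x, ‖u x - b‖ₑ ^ 2 ∂m :=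
    calc m Set.univ * (m Set.univ * ‖b‖ₑ ^ 2) = ‖∫ x, (u x - b) ∂m‖ₑ ^ 2 := by
          rw [← h1]; ring
      _ ≤ (∫⁻ x, ‖u x - b‖ₑ ∂m) ^ 2 := by gcongr; exact enorm_integral_le_lintegral_enorm _
      _ ≤ _ := sq_lintegral_le m (hu.sub (integrable_const b)).aestronglyMeasurable.enorm
  exact (ENNReal.mul_le_mul_iff_right hm (measure_ne_top m _)).1 h2

lemma enorm_sq_le_two_mul (a b : ℝ) : ‖a‖ₑ ^ 2 ≤ 2 * ‖a - b‖ₑ ^ 2 + 2 * ‖b‖ₑ ^ 2 := by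
  have h : ‖a‖ ^ 2 ≤ 2 * ‖a - b‖ ^ 2 + 2 * ‖b‖ ^ 2 := by
    simp only [Real.norm_eq_abs, sq_abs]
    nlinarith [sq_nonneg (a - 2 * b)]
  have h2 : (2 : ℝ≥0∞) = ENNReal.ofReal 2 := by simp
  rw [← ofReal_norm, ← ofReal_norm, ← ofReal_norm, ← ENNReal.ofReal_pow (norm_nonneg _),
    ← ENNReal.ofReal_pow (norm_nonneg _), ← ENNReal.ofReal_pow (norm_nonneg _), h2,
    ← ENNReal.ofReal_mul two_pos.le, ← ENNReal.ofReal_mul two_pos.le,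
    ← ENNReal.ofReal_add (by positivity) (by positivity)]
  exact ENNReal.ofReal_le_ofReal h

lemma measure_mul_lintegral_enorm_sq_le {α : Type*} [MeasurableSpace α] {B : Set α}
    (ν κ m : Measure α) [IsFiniteMeasure κ] [IsFiniteMeasure m]
    {u : α → ℝ} (hu : Integrable u m) (h0 : ∫ x, u x ∂m = 0)
    (huB : AEMeasurable (fun y => ∫⁻ x, ‖u x - u y‖ₑ ^ 2 ∂κ) (ν.restrict B)) :
    ν B * (m Set.univ * ∫⁻ x, ‖u x‖ₑ ^ 2 ∂κ) ≤
      2 * m Set.univ * (∫⁻ y in B, ∫⁻ x, ‖u x - u y‖ₑ ^ 2 ∂κ ∂ν) +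
      2 * κ Set.univ * ∫⁻ y in B, ∫⁻ s, ‖u s - u y‖ₑ ^ 2 ∂m ∂ν := by
  have hpt : ∀ y, m Set.univ * ∫⁻ x, ‖u x‖ₑ ^ 2 ∂κ ≤
      2 * m Set.univ * (∫⁻ x, ‖u x - u y‖ₑ ^ 2 ∂κ) +
      2 * κ Set.univ * ∫⁻ s, ‖u s - u y‖ₑ ^ 2 ∂m := fun y =>
    calc m Set.univ * ∫⁻ x, ‖u x‖ₑ ^ 2 ∂κ
        ≤ m Set.univ * ∫⁻ x, (2 * ‖u x - u y‖ₑ ^ 2 + 2 * ‖u y‖ₑ ^ 2) ∂κ := by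
          gcongr with x; exact enorm_sq_le_two_mul _ _
      _ = 2 * m Set.univ * (∫⁻ x, ‖u x - u y‖ₑ ^ 2 ∂κ) +
          2 * κ Set.univ * (m Set.univ * ‖u y‖ₑ ^ 2) := by
          rw [lintegral_add_right _ measurable_const, lintegral_const_mul' _ _ (by simp),
            lintegral_const]
          ring
      _ ≤ _ := by gcongr; exact measure_mul_enorm_sq_le_of_integral_eq_zero hu h0 _
  calc ν B * (m Set.univ * ∫⁻ x, ‖u x‖ₑ ^ 2 ∂κ)
      = ∫⁻ _ in B, m Set.univ * ∫⁻ x, ‖u x‖ₑ ^ 2 ∂κ ∂ν := by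
        rw [setLIntegral_const, mul_comm]
    _ ≤ ∫⁻ y in B, (2 * m Set.univ * (∫⁻ x, ‖u x - u y‖ₑ ^ 2 ∂κ) +
          2 * κ Set.univ * ∫⁻ s, ‖u s - u y‖ₑ ^ 2 ∂m) ∂ν := lintegral_mono fun y => hpt y
    _ = _ := by
        have hm2 : 2 * m Set.univ ≠ ∞ := ENNReal.mul_ne_top (by simp) (measure_ne_top m _)
        have hκ2 : 2 * κ Set.univ ≠ ∞ := ENNReal.mul_ne_top (by simp) (measure_ne_top κ _)
        rw [lintegral_add_left' (huB.const_mul _), lintegral_const_mul' _ _ hm2,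
          lintegral_const_mul' _ _ hκ2]

lemma aemeasurable_lintegral_enorm_sub_sq {α : Type*} [MeasurableSpace α] {K B : Set α}
    (hK : MeasurableSet K) (hB : MeasurableSet B) (hBK : B ⊆ K) (ν : Measure α) [SFinite ν]
    {u : α → ℝ} (hu : Measurable (K.indicator u)) :
    AEMeasurable (fun y => ∫⁻ x in K, ‖u x - u y‖ₑ ^ 2 ∂ν) (ν.restrict B) := by
  refine ⟨fun y => ∫⁻ x in K, ‖K.indicator u x - K.indicator u y‖ₑ ^ 2 ∂ν, ?_, ?_⟩
  · have : Measurable fun p : α × α => ‖K.indicator u p.2 - K.indicator u p.1‖ₑ ^ 2 :=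
      ((hu.comp measurable_snd).sub (hu.comp measurable_fst)).enorm.pow_const 2
    exact this.lintegral_prod_right'
  · filter_upwards [ae_restrict_mem hB] with y hy
    refine setLIntegral_congr_fun hK fun x hx => ?_
    simp only [Set.indicator_of_mem hx, Set.indicator_of_mem (hBK hy)]

lemma setLIntegral_enorm_sq_eq_ofReal {α F : Type*} [MeasurableSpace α]
    [NormedAddCommGroup F] {μ : Measure α} {K : Set α} {f : α → F}
    (hf : IntegrableOn (fun x => ‖f x‖ ^ 2) K μ) :
    ∫⁻ x in K, ‖f x‖ₑ ^ 2 ∂μ = ENNReal.ofReal (∫ x in K, ‖f x‖ ^ 2 ∂μ) := by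
  rw [ofReal_integral_eq_lintegral_ofReal hf (Filter.Eventually.of_forall fun x => by positivity)]
  refine lintegral_congr fun x => ?_
  rw [ENNReal.ofReal_pow (norm_nonneg _), ofReal_norm]

theorem stmt_8 (γ₀ γ₁ : ℝ) (hγ₀ : 0 < γ₀) (hγ₁ : 0 < γ₁) :
    ∃ Chat : ℝ, 0 < Chat ∧
      ∀ K : Set (EuclideanSpace ℝ (Fin 2)), K.Nonempty → IsOpen K → Bornology.IsBounded K →
      ∀ c : EuclideanSpace ℝ (Fin 2),
        Metric.closedBall c (γ₀ * Metric.diam K) ⊆ K →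
        (∀ y ∈ Metric.closedBall c (γ₀ * Metric.diam K), ∀ z ∈ K, segment ℝ y z ⊆ K) →
      ∀ τ : Set (EuclideanSpace ℝ (Fin 2)),
        τ ⊆ frontier K → IsCompact τ → IsConnected τ →
        ENNReal.ofReal (γ₁ * Metric.diam K) ≤ μH[1] τ →
      ∀ u : EuclideanSpace ℝ (Fin 2) → ℝ,
        (∃ U : Set (EuclideanSpace ℝ (Fin 2)),
          IsOpen U ∧ closure K ⊆ U ∧ ContDiffOn ℝ 1 u U) →
        (∫ x in τ, u x ∂μH[1]) = 0 →
        (∫ x in K, u x ^ 2) ≤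
          Chat ^ 2 * Metric.diam K ^ 2 * ∫ x in K, ‖fderiv ℝ u x‖ ^ 2 := by
  set M := 32 * (2 / γ₀ ^ 2 + 1 / γ₀) with hM
  have hM0 : 0 < M := by positivity
  refine ⟨√(16 / γ₀ ^ 2 * (1 + M / γ₁)), by positivity, ?_⟩
  intro K hne hK hbdd c hball hstar τ hτK hτ _ hτγ u ⟨U, hU, hKU, hu⟩ hτ0
  rw [Real.sq_sqrt (by positivity)]
  set d := Metric.diam K with hd_def
  have hKc : IsCompact (closure K) := hbdd.isCompact_closure
  have hdiam : ∀ p ∈ closure K, ∀ q ∈ closure K, ‖p - q‖ ≤ d := fun p hp q hq => by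
    rw [← dist_eq_norm, hd_def, ← Metric.diam_closure]
    exact Metric.dist_le_diam_of_mem hbdd.closure hp hq
  have hd : 0 < d := by
    obtain ⟨x, hx⟩ := hne
    obtain ⟨ε, hε, hxε⟩ := Metric.isOpen_iff.1 hK x hx
    obtain ⟨v, hv⟩ := exists_norm_eq (EuclideanSpace ℝ (Fin 2)) (half_pos hε).le
    have h1 : x + v ∈ K := hxε (by rw [mem_ball_iff_norm, add_sub_cancel_left, hv]; linarith)
    have h2 := hdiam _ (subset_closure h1) _ (subset_closure hx)
    rw [add_sub_cancel_left, hv] at h2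
    linarith
  set r := γ₀ * d with hr_def
  have hr : 0 < r := by positivity
  have hcK : c ∈ closure K := subset_closure (hball (Metric.mem_closedBall_self hr.le))
  have hKd : ∀ p ∈ closure K, ‖p - c‖ ≤ d := fun p hp => hdiam p hp c hcK
  have hrd : r ≤ d := by
    obtain ⟨v, hv⟩ := exists_norm_eq (EuclideanSpace ℝ (Fin 2)) hr.le
    have h1 : c + v ∈ K :=
      hball (by rw [mem_closedBall_iff_norm, add_sub_cancel_left, hv])
    simpa [hv] using hKd _ (subset_closure h1)
  have hucont : ContinuousOn u (closure K) := hu.continuousOn.mono hKU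
  have hτcl : τ ⊆ closure K := hτK.trans frontier_subset_closure
  have hτball : ∀ z, ∀ ρ : ℝ, 0 ≤ ρ →
      (μH[1] : Measure (EuclideanSpace ℝ (Fin 2))).restrict τ (Metric.closedBall z ρ) ≤
        ENNReal.ofReal (M * ρ) := fun z ρ hρ => by
    rw [Measure.restrict_apply Metric.isClosed_closedBall.measurableSet, Set.inter_comm]
    refine (measure_mono (Set.inter_subset_inter_left _ hτK)).trans
      ((hausdorffMeasure_frontier_inter_closedBall_le hr hK hball hstar hd hKd z hρ).trans_eq ?_)
    congr 2
    rw [hM, hr_def]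
    field_simp
  have hτfin : μH[1] τ < ∞ := by
    have h := hτball c d hd.le
    rw [Measure.restrict_apply Metric.isClosed_closedBall.measurableSet,
      Set.inter_eq_right.2 fun p hp => mem_closedBall_iff_norm.2 (hKd p (hτcl hp))] at h
    exact h.trans_lt ENNReal.ofReal_lt_top
  have hpi := Real.pi_pos
  have hKvol : volume K ≤ ENNReal.ofReal (Real.pi * d ^ 2) := by
    have h := volume_restrict_closedBall_le hd.le hKd c hd.le
    rw [Measure.restrict_apply Metric.isClosed_closedBall.measurableSet,
      Set.inter_eq_right.2 fun p hp => mem_closedBall_iff_norm.2 (hKd p (subset_closure hp))] at h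
    rwa [mul_assoc, ← sq] at h
  have : IsFiniteMeasure ((μH[1] : Measure (EuclideanSpace ℝ (Fin 2))).restrict τ) :=
    ⟨by rwa [Measure.restrict_apply_univ]⟩
  have : IsFiniteMeasure ((volume : Measure (EuclideanSpace ℝ (Fin 2))).restrict K) :=
    ⟨by rw [Measure.restrict_apply_univ]; exact hKvol.trans_lt ENNReal.ofReal_lt_top⟩
  have huτ : IntegrableOn u τ μH[1] := by
    obtain ⟨C, hC⟩ := hτ.exists_bound_of_continuousOn (hucont.mono hτcl)
    refine Integrable.of_bound ((hucont.mono hτcl).aestronglyMeasurable hτ.measurableSet) C ?_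
    filter_upwards [ae_restrict_mem hτ.measurableSet] with x hx using hC x hx
  have huI : IntegrableOn (fun x => ‖u x‖ ^ 2) K :=
    ((hucont.norm.pow 2).integrableOn_compact hKc).mono_set subset_closure
  have hgI : IntegrableOn (fun x => ‖fderiv ℝ u x‖ ^ 2) K :=
    ((((hu.continuousOn_fderiv_of_isOpen hU le_rfl).mono hKU).norm.pow 2).integrableOn_compact
      hKc).mono_set subset_closure
  have hind : Measurable (K.indicator u) := by
    classical
    rw [← Set.piecewise_eq_indicator]
    exact (hucont.mono subset_closure).measurable_piecewise continuousOn_const hK.measurableSet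
  have hmain := measure_mul_lintegral_enorm_sq_le volume (volume.restrict K) (μH[1].restrict τ)
    huτ hτ0 (aemeasurable_lintegral_enorm_sub_sq hK.measurableSet
      (Metric.isOpen_ball (x := c) (ε := r)).measurableSet
      (Metric.ball_subset_closedBall.trans hball) volume hind)
  have hint_K := lintegral_lintegral_enorm_sub_sq_le hK hrd hball hstar hdiam hKd hU hKU hu
    (volume.restrict K)
    ((ae_restrict_mem hK.measurableSet).mono fun x hx => subset_closure hx)
    fun z ρ hρ => volume_restrict_closedBall_le hd.le hKd z hρ
  have hint_τ := lintegral_lintegral_enorm_sub_sq_le hK hrd hball hstar hdiam hKd hU hKU hu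
    (μH[1].restrict τ)
    ((ae_restrict_mem hτ.measurableSet).mono fun x hx => hτcl hx) hτball
  rw [setLIntegral_enorm_sq_eq_ofReal hgI] at hint_K hint_τ
  rw [setLIntegral_enorm_sq_eq_ofReal huI, Measure.restrict_apply_univ,
    Measure.restrict_apply_univ, EuclideanSpace.volume_ball_fin_two] at hmain
  simp only [Real.norm_eq_abs (u _), sq_abs] at hmain
  set I := ∫ x in K, ‖fderiv ℝ u x‖ ^ 2
  set J := ∫ x in K, u x ^ 2
  have hI0 : 0 ≤ I := integral_nonneg fun x => by positivity
  have hJ0 : 0 ≤ J := integral_nonneg fun x => by positivity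
  set L := (μH[1] τ).toReal
  have hτL : μH[1] τ = ENNReal.ofReal L := (ENNReal.ofReal_toReal hτfin.ne).symm
  have hLd : γ₁ * d ≤ L := (ENNReal.ofReal_le_iff_le_toReal hτfin.ne).1 hτγ
  have hL : 0 < L := (mul_pos hγ₁ hd).trans_le hLd
  have hreal : ENNReal.ofReal (r ^ 2 * Real.pi * (L * J)) ≤
      ENNReal.ofReal (2 * L * (8 * (Real.pi * d) * d ^ 3 * I) +
        2 * (Real.pi * d ^ 2) * (8 * M * d ^ 3 * I)) := by
    have h2 : (2 : ℝ≥0∞) = ENNReal.ofReal 2 := by simp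
    calc ENNReal.ofReal (r ^ 2 * Real.pi * (L * J))
        = ENNReal.ofReal r ^ 2 * ENNReal.ofReal Real.pi * (μH[1] τ * ENNReal.ofReal J) := by
          rw [hτL, ENNReal.ofReal_mul (by positivity), ENNReal.ofReal_mul (by positivity),
            ENNReal.ofReal_mul hL.le, ENNReal.ofReal_pow hr.le]
      _ ≤ _ := hmain
      _ ≤ 2 * μH[1] τ * (ENNReal.ofReal (8 * (Real.pi * d) * d ^ 3) * ENNReal.ofReal I) +
          2 * ENNReal.ofReal (Real.pi * d ^ 2) *
            (ENNReal.ofReal (8 * M * d ^ 3) * ENNReal.ofReal I) := by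
          gcongr
      _ = _ := by
          rw [hτL, h2, ← ENNReal.ofReal_mul two_pos.le, ← ENNReal.ofReal_mul two_pos.le,
            ← ENNReal.ofReal_mul (q := I) (by positivity),
            ← ENNReal.ofReal_mul (q := I) (by positivity),
            ← ENNReal.ofReal_mul (by positivity), ← ENNReal.ofReal_mul (by positivity),
            ← ENNReal.ofReal_add (by positivity) (by positivity)]
  rw [ENNReal.ofReal_le_ofReal_iff (by positivity), hr_def] at hreal
  have hfac : γ₀ ^ 2 * L * J ≤ 16 * d ^ 2 * I * (L + d * M) := by
    have hpos : 0 < Real.pi * d ^ 2 := by positivity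
    refine le_of_mul_le_mul_left ?_ hpos
    linarith
  have hdL : d * M ≤ L * (M / γ₁) := by
    rw [mul_div_assoc', le_div_iff₀ hγ₁]; nlinarith
  have hfin : γ₀ ^ 2 * L * J ≤ γ₀ ^ 2 * L * (16 / γ₀ ^ 2 * (1 + M / γ₁) * d ^ 2 * I) :=
    calc γ₀ ^ 2 * L * J ≤ 16 * d ^ 2 * I * (L + d * M) := hfac
      _ ≤ 16 * d ^ 2 * I * (L + L * (M / γ₁)) := by gcongr
      _ = _ := by field_simp
  exact le_of_mul_le_mul_left hfin (by positivity)
end
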